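/- arXiv:2602.23597 — 3 statements merged into one kernel-verified Lean document; each statement's English description precedes it below -/
import Mathlib

section
/- Let n ≥ 2 be an integer and let α ∈ (0, π/2) be a real number with cos(nα) ≠ 0 satisfying n·tan α = tan(nα). Then α/(2π) is a Diophantine number, i.e., there exist a real constant c > 0 and a real exponent τ < ∞ such that for every integer p and every positive natural number q one has |α/(2π) − p/q| ≥ c/q^τ. -/
open Polynomial in
/-- The polynomial `X (X - 1) ⋯ (X - r + 1) / r!`. -/
noncomputable def binomPoly (r : ℕ) : Polynomial ℂ :=
  ∏ i ∈ Finset.range r, (C ((i + 1 : ℂ)⁻¹) * (X - C (i : ℂ)))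

open Polynomial in
theorem binomPoly_succ (r : ℕ) :
    binomPoly (r + 1) = binomPoly r * (C ((r + 1 : ℂ)⁻¹) * (X - C (r : ℂ))) := by
  rw [binomPoly, Finset.prod_range_succ, ← binomPoly]

open Polynomial in
theorem binomPoly_succ_comp_X_add_one (r : ℕ) :
    (binomPoly (r + 1)).comp (X + 1) = C ((r + 1 : ℂ)⁻¹) * (X + 1) * binomPoly r := by
  induction r with
  | zero => simp [binomPoly]
  | succ r ih =>
    have h : ((r : ℂ) + 1) ≠ 0 := by exact_mod_cast r.succ_ne_zero
    rw [binomPoly_succ (r + 1), mul_comp, ih, binomPoly_succ r]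
    have e : (X - C (((r + 1 : ℕ) : ℂ))).comp (X + 1) = (X - C (r : ℂ) : Polynomial ℂ) := by
      simp
    rw [mul_comp, e, C_comp]
    ring

open Polynomial in
theorem binomPoly_succ_comp_X_add_one' (r : ℕ) :
    (binomPoly (r + 1)).comp (X + 1) = binomPoly (r + 1) + binomPoly r := by
  rw [binomPoly_succ_comp_X_add_one, binomPoly_succ]
  have h : (C ((r + 1 : ℂ)⁻¹) : Polynomial ℂ) * (C (r : ℂ) + 1) = 1 := by
    rw [← C_1, ← C_add, ← C_mul, C_1, inv_mul_cancel₀ (by exact_mod_cast r.succ_ne_zero)]; simp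
  linear_combination binomPoly r * h

theorem natDegree_binomPoly (r : ℕ) : (binomPoly r).natDegree = r := by
  induction r with
  | zero => simp [binomPoly]
  | succ r ih =>
    have h : ((r : ℂ) + 1)⁻¹ ≠ 0 := inv_ne_zero (by exact_mod_cast r.succ_ne_zero)
    have h0 : binomPoly r ≠ 0 := by
      rw [binomPoly, Finset.prod_ne_zero_iff]
      intro i _
      exact mul_ne_zero (Polynomial.C_ne_zero.mpr (inv_ne_zero (by exact_mod_cast i.succ_ne_zero)))
        (Polynomial.X_sub_C_ne_zero _)
    rw [binomPoly_succ, Polynomial.natDegree_mul h0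
      (mul_ne_zero (Polynomial.C_ne_zero.mpr h) (Polynomial.X_sub_C_ne_zero _)),
      Polynomial.natDegree_C_mul h, Polynomial.natDegree_X_sub_C, ih]

theorem binomPoly_ne_zero (r : ℕ) : binomPoly r ≠ 0 := by
  rcases r with _ | r
  · simp [binomPoly]
  · intro h
    have := natDegree_binomPoly (r + 1)
    simp [h] at this

theorem norm_eval_binomPoly_le (r : ℕ) (z : ℂ) :
    ‖(binomPoly r).eval z‖ ≤ Real.exp (‖z‖ + r) := by
  have h : ‖(binomPoly r).eval z‖ ≤ (‖z‖ + r) ^ r / r.factorial := by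
    have h1 : ‖(binomPoly r).eval z‖ ≤ ∏ i ∈ Finset.range r, (((i : ℝ) + 1)⁻¹ * (‖z‖ + r)) := by
      rw [binomPoly, Polynomial.eval_prod, norm_prod]
      refine Finset.prod_le_prod (fun _ _ => norm_nonneg _) fun i hi => ?_
      have hi' : (i : ℝ) ≤ r := by exact_mod_cast (Finset.mem_range.mp hi).le
      have h2 : ‖((i : ℂ) + 1)⁻¹‖ = ((i : ℝ) + 1)⁻¹ := by
        rw [norm_inv]; norm_cast
      simp only [Polynomial.eval_mul, Polynomial.eval_C, Polynomial.eval_sub, Polynomial.eval_X,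
        norm_mul, h2]
      gcongr
      calc ‖z - i‖ ≤ ‖z‖ + ‖(i : ℂ)‖ := norm_sub_le _ _
        _ ≤ ‖z‖ + r := by simpa using hi'
    refine h1.trans_eq ?_
    rw [Finset.prod_mul_distrib, Finset.prod_const, Finset.card_range, Finset.prod_inv_distrib,
      ← Finset.prod_range_add_one_eq_factorial]
    push_cast
    field_simp
  exact h.trans (Real.pow_div_factorial_le_exp _ (by positivity) _)

open Polynomial in
/-- `Q (s + ν X)` has integer coefficients. -/
def IntegralAt (ν : ℕ) (s : ℕ) (Q : Polynomial ℂ) : Prop :=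
  Q.comp (C (s : ℂ) + C (ν : ℂ) * X) ∈ (Polynomial.mapRingHom (Int.castRingHom ℂ)).range

open Polynomial in
theorem exists_binomPoly_comp_C_mul_X {ν h : ℕ} (hν : ∀ i, 1 ≤ i → i ≤ h → i ∣ ν) (r : ℕ)
    (hr : r ≤ h) : ∃ W ∈ (Polynomial.mapRingHom (Int.castRingHom ℂ)).range,
      C ((r + 1 : ℂ)) * (binomPoly (r + 1)).comp (C (ν : ℂ) * X) = C (ν : ℂ) * X * W := by
  induction r with
  | zero => exact ⟨1, one_mem _, by simp [binomPoly]⟩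
  | succ r ih =>
    obtain ⟨W, hW, hW'⟩ := ih (by omega)
    obtain ⟨m, hm⟩ := hν (r + 1) (by omega) hr
    refine ⟨W * (C (m : ℂ) * X - 1), mul_mem hW (sub_mem (mul_mem ⟨C (m : ℤ), by simp⟩
      ⟨X, by simp⟩) (one_mem _)), ?_⟩
    have h1 : (((r + 1 : ℕ) : ℂ) + 1) ≠ 0 := by exact_mod_cast (r + 1).succ_ne_zero
    have hm' : (C (ν : ℂ) : Polynomial ℂ) = C ((r : ℂ) + 1) * C (m : ℂ) := by
      rw [hm, ← C_mul]; push_cast; rfl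
    have e : C (((r + 1 : ℕ) : ℂ) + 1) * (binomPoly (r + 1 + 1)).comp (C (ν : ℂ) * X) =
        (binomPoly (r + 1)).comp (C (ν : ℂ) * X) * (C (ν : ℂ) * X - C ((r : ℂ) + 1)) := by
      rw [binomPoly_succ (r + 1), mul_comp, mul_comp, C_comp, sub_comp, X_comp, C_comp,
        mul_left_comm, ← mul_assoc (C _) (C _), ← C_mul, mul_inv_cancel₀ h1]
      simp
    rw [e]
    linear_combination (C (m : ℂ) * X - 1) * hW' +
      (binomPoly (r + 1)).comp (C (ν : ℂ) * X) * X * hm'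

open Polynomial in
theorem integralAt_binomPoly {ν h : ℕ} (hν : ∀ i, 1 ≤ i → i ≤ h → i ∣ ν) (s r : ℕ) (hr : r ≤ h) :
    IntegralAt ν s (binomPoly r) := by
  induction s generalizing r with
  | zero =>
    rw [IntegralAt]
    rcases r with _ | r
    · simp [binomPoly]
    · obtain ⟨m, hm⟩ := hν (r + 1) (by omega) hr
      obtain ⟨W, hW, hW'⟩ := exists_binomPoly_comp_C_mul_X hν r (by omega)
      have h1 : (C ((r : ℂ) + 1) : Polynomial ℂ) ≠ 0 :=
        C_ne_zero.mpr (by exact_mod_cast r.succ_ne_zero)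
      have e : (binomPoly (r + 1)).comp (C (ν : ℂ) * X) = C (m : ℂ) * X * W := by
        apply mul_left_cancel₀ h1
        rw [hW', hm]
        push_cast
        rw [C_mul]
        ring
      simp only [Nat.cast_zero, C_0, zero_add]
      rw [e]
      exact mul_mem (mul_mem ⟨C (m : ℤ), by simp⟩ ⟨X, by simp⟩) hW
  | succ s ih =>
    rcases r with _ | r
    · simp [IntegralAt, binomPoly]
    have h1 := ih (r + 1) hr
    have h2 := ih r (by omega)
    have h3 : (binomPoly (r + 1)).comp (C ((s + 1 : ℕ) : ℂ) + C (ν : ℂ) * X) =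
        (binomPoly (r + 1)).comp (C (s : ℂ) + C (ν : ℂ) * X) +
        (binomPoly r).comp (C (s : ℂ) + C (ν : ℂ) * X) := by
      rw [← add_comp, ← binomPoly_succ_comp_X_add_one', comp_assoc]
      congr 1
      simp
      ring
    rw [IntegralAt, h3]
    exact add_mem h1 h2

theorem IntegralAt.mul {ν s : ℕ} {P Q : Polynomial ℂ} (hP : IntegralAt ν s P)
    (hQ : IntegralAt ν s Q) : IntegralAt ν s (P * Q) := by
  rw [IntegralAt, Polynomial.mul_comp]
  exact mul_mem hP hQ

theorem IntegralAt.pow {ν s : ℕ} {P : Polynomial ℂ} (hP : IntegralAt ν s P) (n : ℕ) :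
    IntegralAt ν s (P ^ n) := by
  rw [IntegralAt, Polynomial.pow_comp]
  exact pow_mem hP n

open Polynomial in
theorem IntegralAt.exists_int {ν s : ℕ} {Q : Polynomial ℂ} (hQ : IntegralAt ν s Q) (a : ℕ) :
    ∃ m : ℤ, (m : ℂ) = (ν : ℂ) ^ a * (hasseDeriv a Q).eval (s : ℂ) := by
  obtain ⟨R, hR⟩ := RingHom.mem_range.mp hQ
  refine ⟨R.coeff a, ?_⟩
  have h1 : Q.comp (C (s : ℂ) + C (ν : ℂ) * X) = (taylor (s : ℂ) Q).comp (C (ν : ℂ) * X) := by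
    rw [taylor_apply, comp_assoc]
    congr 1
    simp [add_comm]
  have h2 := congrArg (fun P => coeff P a) hR
  simp only [h1, comp_C_mul_X_coeff, taylor_coeff] at h2
  rw [mul_comm, ← h2]
  simp

/-- The polynomial of degree `l * h + r` built from binomial polynomials of degree at most `h`. -/
noncomputable def blockPoly (h l r : ℕ) : Polynomial ℂ := binomPoly h ^ l * binomPoly r

theorem natDegree_blockPoly (h l r : ℕ) : (blockPoly h l r).natDegree = l * h + r := by
  rw [blockPoly, Polynomial.natDegree_mul (pow_ne_zero _ (binomPoly_ne_zero _))
    (binomPoly_ne_zero _), Polynomial.natDegree_pow, natDegree_binomPoly, natDegree_binomPoly]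

theorem blockPoly_ne_zero (h l r : ℕ) : blockPoly h l r ≠ 0 :=
  mul_ne_zero (pow_ne_zero _ (binomPoly_ne_zero _)) (binomPoly_ne_zero _)

theorem integralAt_blockPoly {ν h : ℕ} (hν : ∀ i, 1 ≤ i → i ≤ h → i ∣ ν) (s l r : ℕ)
    (hr : r ≤ h) : IntegralAt ν s (blockPoly h l r) :=
  ((integralAt_binomPoly hν s h le_rfl).pow l).mul (integralAt_binomPoly hν s r hr)

theorem norm_eval_blockPoly_le {h l r : ℕ} (hr : r ≤ h) (z : ℂ) :
    ‖(blockPoly h l r).eval z‖ ≤ Real.exp ((l + 1) * (‖z‖ + h)) := by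
  rw [blockPoly, Polynomial.eval_mul, Polynomial.eval_pow, norm_mul, norm_pow]
  have h1 := norm_eval_binomPoly_le h z
  have h2 : ‖(binomPoly r).eval z‖ ≤ Real.exp (‖z‖ + h) :=
    (norm_eval_binomPoly_le r z).trans (by gcongr)
  calc _ ≤ Real.exp (‖z‖ + h) ^ l * Real.exp (‖z‖ + h) := by gcongr
    _ = _ := by rw [← Real.exp_nat_mul, ← Real.exp_add]; ring_nf

theorem iteratedDeriv_polynomial_eval (Q : Polynomial ℂ) (a : ℕ) :
    iteratedDeriv a (fun w => Q.eval w) = fun w => (Polynomial.derivative^[a] Q).eval w := by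
  induction a with
  | zero => simp
  | succ a ih =>
    rw [iteratedDeriv_succ, ih, Function.iterate_succ_apply']
    ext w
    exact Polynomial.deriv _

/-- Cauchy's estimate for Hasse derivatives of polynomials, on circles of radius one. -/
theorem norm_eval_hasseDeriv_le (Q : Polynomial ℂ) (a : ℕ) (z : ℂ) {B : ℝ}
    (hB : ∀ w : ℂ, ‖w - z‖ = 1 → ‖Q.eval w‖ ≤ B) : ‖(Polynomial.hasseDeriv a Q).eval z‖ ≤ B := by
  have h := Complex.norm_iteratedDeriv_le_of_forall_mem_sphere_norm_le (n := a) (c := z) (R := 1)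
    (f := fun w => Q.eval w) one_pos Q.differentiable.diffContOnCl
    (C := B) (fun w hw => hB w (by simpa [dist_eq_norm] using hw))
  have h2 : iteratedDeriv a (fun w => Q.eval w) z =
      (a.factorial : ℂ) * (Polynomial.hasseDeriv a Q).eval z := by
    have := congrArg (Polynomial.eval z)
      (congrFun (Polynomial.factorial_smul_hasseDeriv (R := ℂ) a) Q)
    rw [iteratedDeriv_polynomial_eval]
    simpa using this.symm
  rw [h2, norm_mul] at h
  have : (0 : ℝ) < a.factorial := by positivity
  simp only [Complex.norm_natCast, one_pow, div_one] at h
  exact le_of_mul_le_mul_left h this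

theorem norm_eval_hasseDeriv_blockPoly_le {h l r a : ℕ} (hr : r ≤ h) (z : ℂ) :
    ‖(Polynomial.hasseDeriv a (blockPoly h l r)).eval z‖ ≤
      Real.exp ((l + 1) * (‖z‖ + 1 + h)) := by
  refine norm_eval_hasseDeriv_le _ _ _ fun w hw => ?_
  refine (norm_eval_blockPoly_le hr w).trans ?_
  have : ‖w‖ ≤ ‖z‖ + 1 := by
    calc ‖w‖ = ‖(w - z) + z‖ := by ring_nf
      _ ≤ _ := (norm_add_le _ _).trans (by rw [hw, add_comm])
  gcongr

open Polynomial in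
/-- An exponential polynomial `∑ Q i (s) * x i ^ s` of order at most `N` vanishing at
`0, …, N - 1` is trivial. -/
theorem expPoly_eq_zero {ι : Type*} [Fintype ι] {x : ι → ℂ} (hx : Function.Injective x)
    (hx0 : ∀ i, x i ≠ 0) (N : ℕ) (d : ι → ℕ) (hN : ∑ i, d i = N) (Q : ι → Polynomial ℂ)
    (hd : ∀ i, (Q i).degree < d i) (h0 : ∀ s < N, ∑ i, (Q i).eval (s : ℂ) * x i ^ s = 0) (i : ι) :
    Q i = 0 := by
  classical
  induction N generalizing d Q i with
  | zero =>
    have : d i = 0 := (Finset.sum_eq_zero_iff.mp hN) i (Finset.mem_univ i)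
    have h1 := hd i
    rw [this] at h1
    simpa using h1
  | succ N ih =>
    obtain ⟨μ, hμ⟩ : ∃ μ, 0 < d μ := by
      by_contra! h
      have : ∑ i, d i = 0 := Finset.sum_eq_zero fun i _ => Nat.le_zero.mp (h i)
      omega
    have hd1 : ∀ i, (taylor 1 (Q i)).degree = (Q i).degree := fun i => degree_taylor _ _
    have key := ih (Function.update d μ (d μ - 1)) (by
        have h1 := Finset.sum_update_of_mem (Finset.mem_univ μ) d (d μ - 1)
        have h2 := Finset.add_sum_erase Finset.univ d (Finset.mem_univ μ)
        rw [Finset.sdiff_singleton_eq_erase] at h1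
        omega)
      (fun i => C (x i) * taylor 1 (Q i) - C (x μ) * Q i) (fun i => by
        by_cases hi : i = μ
        · subst hi
          rw [Function.update_self, ← mul_sub]
          rw [degree_C_mul (hx0 i)]
          by_cases hQ : Q i = 0
          · simp [hQ]
          · have h1 : (taylor 1 (Q i) - Q i).degree < (Q i).degree := by
              have := degree_sub_lt_left (hd1 i) (by
                rw [Ne, ← degree_eq_bot, hd1, degree_eq_bot]; exact hQ) (by
                rw [leadingCoeff_taylor])
              rwa [hd1] at this
            have h2 := hd i
            rw [degree_eq_natDegree hQ] at h1 h2
            have h3 : (Q i).natDegree ≤ d i - 1 := by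
              have : (Q i).natDegree < d i := by exact_mod_cast h2
              omega
            exact h1.trans_le (by exact_mod_cast h3)
        · rw [Function.update_of_ne hi]
          refine (degree_sub_le _ _).trans_lt (max_lt ?_ ?_)
          · exact (degree_C_mul (hx0 _)).trans_lt ((hd1 i).trans_lt (hd i))
          · exact (degree_C_mul (hx0 _)).trans_lt (hd i))
      (fun s hs => by
        have h1 := h0 (s + 1) (by omega)
        have h2 := h0 s (by omega)
        calc _ = ∑ i, (Q i).eval ((s + 1 : ℕ) : ℂ) * x i ^ (s + 1) -
              x μ * ∑ i, (Q i).eval (s : ℂ) * x i ^ s := by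
              rw [Finset.mul_sum, ← Finset.sum_sub_distrib]
              refine Finset.sum_congr rfl fun i _ => ?_
              simp only [eval_sub, eval_mul, eval_C, taylor_eval]
              push_cast
              ring
          _ = 0 := by rw [h1, h2]; ring)
    have hne : ∀ i, i ≠ μ → Q i = 0 := by
      intro i hi
      by_contra hQ
      have h1 := congrArg (fun P => P.coeff (Q i).natDegree) (key i)
      have h2 : (taylor 1 (Q i)).coeff (Q i).natDegree = (Q i).leadingCoeff := by
        rw [← leadingCoeff_taylor 1 (Q i), leadingCoeff, natDegree_taylor]
      simp only [coeff_sub, coeff_C_mul, h2, coeff_natDegree, coeff_zero, ← sub_mul] at h1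
      rcases mul_eq_zero.mp h1 with h | h
      · exact hi (hx (sub_eq_zero.mp h))
      · exact hQ (leadingCoeff_eq_zero.mp h)
    by_cases hi : i = μ
    swap
    · exact hne i hi
    subst hi
    have h1 := key i
    rw [← mul_sub, mul_eq_zero, or_iff_right (C_ne_zero.mpr (hx0 i)), sub_eq_zero] at h1
    have h2 : (Q i).eval 0 = 0 := by
      have := h0 0 (by omega)
      rw [Finset.sum_eq_single i (fun j _ hj => by simp [hne j hj]) (by simp)] at this
      simpa using this
    have h3 : ∀ s : ℕ, (Q i).eval (s : ℂ) = 0 := by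
      intro s
      induction s with
      | zero => simpa using h2
      | succ s ihs =>
        have := congrArg (eval (s : ℂ)) h1
        rw [taylor_eval] at this
        push_cast
        rw [this, ihs]
    refine eq_zero_of_infinite_isRoot _ (Set.Infinite.mono ?_ (Set.infinite_range_of_injective
      (Nat.cast_injective (R := ℂ))))
    rintro _ ⟨s, rfl⟩
    exact h3 s

/-- Liouville's inequality for values at an algebraic number of integer polynomials. -/
theorem exists_liouville_bound {ζ : ℂ} (hζ : IsAlgebraic ℚ ζ) :
    ∃ D : ℕ, ∃ c : ℝ, 0 ≤ c ∧ ∀ (ι : Type) [Fintype ι] (g : ι → ℤ) (e : ι → ℕ) (m : ℕ) (A : ℝ),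
      (∀ i, e i ≤ m) → ∑ i, |(g i : ℝ)| ≤ A → 1 ≤ A → ∑ i, (g i : ℂ) * ζ ^ e i ≠ 0 →
      1 ≤ Real.exp (c * m) * A ^ D * ‖∑ i, (g i : ℂ) * ζ ^ e i‖ := by
  classical
  have hζint : IsIntegral ℚ ζ := hζ.isIntegral
  let K := IntermediateField.adjoin ℚ {ζ}
  have : FiniteDimensional ℚ K := IntermediateField.adjoin.finiteDimensional hζint
  let γ : K := IntermediateField.AdjoinSimple.gen ℚ ζ
  have hγ : (γ : ℂ) = ζ := IntermediateField.AdjoinSimple.coe_gen ℚ ζ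
  have halg : IsAlgebraic ℤ γ :=
    (IsFractionRing.isAlgebraic_iff ℤ ℚ K).mpr (IsAlgebraic.of_finite ℚ γ)
  obtain ⟨b, hb0, hb⟩ := halg.exists_integral_multiple
  let H : ℝ := ∑ σ : K →ₐ[ℚ] ℂ, (1 + ‖σ γ‖)
  let σ₀ : K →ₐ[ℚ] ℂ := IntermediateField.val K
  have hHσ : ∀ σ : K →ₐ[ℚ] ℂ, 1 + ‖σ γ‖ ≤ H := fun σ =>
    Finset.single_le_sum (f := fun σ : K →ₐ[ℚ] ℂ => 1 + ‖σ γ‖) (fun _ _ => by positivity)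
      (Finset.mem_univ σ)
  have hH : 1 ≤ H := le_trans (by simp) (hHσ σ₀)
  clear_value H
  have hb1 : (1 : ℝ) ≤ |(b : ℝ)| := by exact_mod_cast Int.one_le_abs hb0
  have hB : 1 ≤ |(b : ℝ)| * H := one_le_mul_of_one_le_of_one_le hb1 hH
  let D := Fintype.card (K →ₐ[ℚ] ℂ)
  refine ⟨D, Real.log ((|(b : ℝ)| * H) ^ (D + 1)), Real.log_nonneg (one_le_pow₀ hB), ?_⟩
  intro ι _ g e m A he hA hA1 hne
  let x : K := ∑ i, (g i : K) * ((b : K) ^ (m - e i) * ((b : K) * γ) ^ e i)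
  have hx : x = (b : K) ^ m * ∑ i, (g i : K) * γ ^ e i := by
    simp only [x, Finset.mul_sum]
    refine Finset.sum_congr rfl fun i _ => ?_
    rw [mul_pow, ← mul_assoc ((b : K) ^ _), ← pow_add, Nat.sub_add_cancel (he i)]
    ring
  have hxint : IsIntegral ℤ x := by
    have hb' : IsIntegral ℤ ((b : K) * γ) := by simpa [zsmul_eq_mul] using hb
    refine IsIntegral.sum _ fun i _ => ?_
    exact (isIntegral_algebraMap (R := ℤ) (x := g i)).mul
      (((isIntegral_algebraMap (R := ℤ) (x := b)).pow _).mul (hb'.pow _))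
  have hσx : ∀ σ : K →ₐ[ℚ] ℂ, σ x = (b : ℂ) ^ m * ∑ i, (g i : ℂ) * (σ γ) ^ e i := by
    intro σ
    rw [hx]
    simp
  have hσ₀γ : σ₀ γ = ζ := hγ
  have hx0 : x ≠ 0 := by
    intro h
    have := hσx σ₀
    rw [h, map_zero, hσ₀γ] at this
    exact (mul_ne_zero (pow_ne_zero _ (by exact_mod_cast hb0)) hne) this.symm
  obtain ⟨N, hN⟩ := IsIntegrallyClosed.isIntegral_iff.mp (Algebra.isIntegral_norm ℚ hxint)
  have hN0 : N ≠ 0 := by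
    rintro rfl
    rw [map_zero] at hN
    exact hx0 (Algebra.norm_eq_zero_iff.mp hN.symm)
  have hprod := Algebra.norm_eq_prod_embeddings ℚ ℂ x
  rw [← hN] at hprod
  have h1 : (1 : ℝ) ≤ ∏ σ : K →ₐ[ℚ] ℂ, ‖σ x‖ := by
    rw [← norm_prod, ← hprod]
    simp only [eq_intCast]
    have : (1 : ℝ) ≤ |(N : ℝ)| := by exact_mod_cast Int.one_le_abs hN0
    simpa using this
  have hbound : ∀ σ : K →ₐ[ℚ] ℂ, ‖σ x‖ ≤ (|(b : ℝ)| * H) ^ m * A := by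
    intro σ
    rw [hσx, norm_mul, norm_pow, Complex.norm_intCast, mul_pow, mul_assoc]
    refine mul_le_mul_of_nonneg_left ?_ (by positivity)
    calc ‖∑ i, (g i : ℂ) * (σ γ) ^ e i‖ ≤ ∑ i, |(g i : ℝ)| * H ^ m := by
          refine (norm_sum_le _ _).trans (Finset.sum_le_sum fun i _ => ?_)
          rw [norm_mul, norm_pow, Complex.norm_intCast]
          refine mul_le_mul_of_nonneg_left ?_ (abs_nonneg _)
          calc ‖σ γ‖ ^ e i ≤ H ^ e i :=
                pow_le_pow_left₀ (norm_nonneg _) (by linarith [hHσ σ]) _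
            _ ≤ H ^ m := pow_le_pow_right₀ hH (he i)
      _ = (∑ i, |(g i : ℝ)|) * H ^ m := by rw [Finset.sum_mul]
      _ ≤ H ^ m * A := by rw [mul_comm]; gcongr
  have hBA : 1 ≤ (|(b : ℝ)| * H) ^ m * A :=
    one_le_mul_of_one_le_of_one_le (one_le_pow₀ hB) hA1
  rw [← Finset.mul_prod_erase _ _ (Finset.mem_univ σ₀), hσx σ₀, hσ₀γ, norm_mul, norm_pow,
    Complex.norm_intCast] at h1
  have h2 : ∏ σ ∈ Finset.univ.erase σ₀, ‖σ x‖ ≤ ((|(b : ℝ)| * H) ^ m * A) ^ D := by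
    refine (Finset.prod_le_prod (fun _ _ => norm_nonneg _) (fun σ _ => hbound σ)).trans ?_
    rw [Finset.prod_const]
    exact pow_le_pow_right₀ hBA (Finset.card_le_univ _)
  have h3 : Real.exp (Real.log ((|(b : ℝ)| * H) ^ (D + 1)) * m) =
      (|(b : ℝ)| * H) ^ (m * (D + 1)) := by
    rw [mul_comm, Real.exp_nat_mul, Real.exp_log (pow_pos (one_pos.trans_le hB) _), ← pow_mul,
      mul_comm m]
  rw [h3]
  set V := ‖∑ i, (g i : ℂ) * ζ ^ e i‖
  calc (1 : ℝ) ≤ |(b : ℝ)| ^ m * V * ((|(b : ℝ)| * H) ^ m * A) ^ D :=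
        h1.trans (by gcongr)
    _ ≤ (|(b : ℝ)| * H) ^ m * V * ((|(b : ℝ)| * H) ^ m * A) ^ D := by
        gcongr
        exact le_mul_of_one_le_right (abs_nonneg _) hH
    _ = _ := by ring

theorem exists_pow_eq_sum {ω : ℂ} (hω : IsIntegral ℤ ω) :
    ∃ D : ℕ, 0 < D ∧ ∃ C : ℝ, 1 ≤ C ∧ ∀ j : ℕ, ∃ v : Fin D → ℤ,
      ω ^ j = ∑ i, (v i : ℂ) * ω ^ (i : ℕ) ∧ ∀ i, |(v i : ℝ)| ≤ C ^ j := by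
  obtain ⟨f, hf, hfω⟩ := hω
  have hD : f.natDegree ≠ 0 := by
    intro h
    rw [hf.natDegree_eq_zero.mp h] at hfω
    simp at hfω
  obtain ⟨d, hd⟩ := Nat.exists_eq_succ_of_ne_zero hD
  let F : ℝ := ∑ i ∈ Finset.range (d + 1), |(f.coeff i : ℝ)|
  have hF : 0 ≤ F := Finset.sum_nonneg fun _ _ => abs_nonneg _
  have hrel : ω ^ (d + 1) = ∑ i : Fin (d + 1), (-f.coeff i : ℂ) * ω ^ (i : ℕ) := by
    rw [Polynomial.eval₂_eq_sum_range, hd, Finset.sum_range_succ, ← Nat.succ_eq_add_one,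
      ← hd, hf.coeff_natDegree, hd] at hfω
    rw [Fin.sum_univ_eq_sum_range (fun i => (-f.coeff i : ℂ) * ω ^ i)]
    simp only [eq_intCast, Int.cast_one, one_mul] at hfω
    simp only [neg_mul, Finset.sum_neg_distrib, ← Nat.succ_eq_add_one]
    linear_combination hfω
  refine ⟨d + 1, d.succ_pos, 1 + F, by linarith, fun j => ?_⟩
  induction j with
  | zero =>
    refine ⟨fun i => if i = 0 then 1 else 0, ?_, fun i => ?_⟩
    · rw [Finset.sum_eq_single 0] <;> simp +contextual
    · dsimp only
      split_ifs <;> simp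
  | succ j ih =>
    obtain ⟨v, hv, hvb⟩ := ih
    refine ⟨fun i => (Fin.cons 0 (fun k : Fin d => v k.castSucc) : Fin (d + 1) → ℤ) i -
      v (Fin.last d) * f.coeff i, ?_, fun i => ?_⟩
    · have e1 : ω ^ (j + 1) = ∑ k : Fin d, (v k.castSucc : ℂ) * ω ^ (k + 1 : ℕ) +
          (v (Fin.last d) : ℂ) * ω ^ (d + 1) := by
        rw [pow_succ, hv, Fin.sum_univ_castSucc, add_mul, Finset.sum_mul]
        simp only [Fin.val_castSucc, Fin.val_last, pow_succ, mul_assoc]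
      rw [e1, hrel]
      simp only [Int.cast_sub, Int.cast_mul, sub_mul, Finset.sum_sub_distrib]
      rw [Fin.sum_univ_succ (fun i : Fin (d + 1) =>
        (((Fin.cons 0 (fun k : Fin d => v k.castSucc) : Fin (d + 1) → ℤ) i : ℤ) : ℂ) * ω ^ (i : ℕ))]
      simp only [Fin.cons_zero, Fin.cons_succ, Int.cast_zero, zero_mul, zero_add, Fin.val_succ,
        neg_mul, Finset.sum_neg_distrib, mul_neg, Finset.mul_sum, mul_assoc]
      ring
    · have h1 : |((Fin.cons 0 (fun k : Fin d => v k.castSucc) : Fin (d + 1) → ℤ) i : ℝ)| ≤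
          (1 + F) ^ j := by
        refine Fin.cases ?_ (fun k => ?_) i
        · simp; positivity
        · simpa using hvb k.castSucc
      have h2 : |(f.coeff i : ℝ)| ≤ F :=
        Finset.single_le_sum (f := fun i => |(f.coeff i : ℝ)|) (fun _ _ => abs_nonneg _)
          (Finset.mem_range.mpr i.isLt)
      push_cast
      calc _ ≤ _ := abs_sub _ _
        _ ≤ (1 + F) ^ j + (1 + F) ^ j * F := by
          rw [abs_mul]
          have := hvb (Fin.last d)
          gcongr
        _ = _ := by ring

theorem exists_siegel_bound {ζ : ℂ} (hζ : IsAlgebraic ℚ ζ) :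
    ∃ D : ℕ, 0 < D ∧ ∃ c : ℝ, 0 ≤ c ∧ ∀ (ι κ : Type) [Fintype ι] [Fintype κ]
      (a : ι → κ → ℤ) (e : ι → κ → ℕ) (m : ℕ) (A : ℝ),
      0 < Fintype.card ι → Fintype.card κ = 2 * (D * Fintype.card ι) →
      (∀ i j, e i j ≤ m) → (∀ i j, |(a i j : ℝ)| ≤ A) → 1 ≤ A →
      ∃ t : κ → ℤ, t ≠ 0 ∧ (∀ i, ∑ j, (t j : ℂ) * (a i j * ζ ^ e i j) = 0) ∧
        ∀ j, |(t j : ℝ)| ≤ Fintype.card κ * (A * Real.exp (c * m)) := by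
  classical
  obtain ⟨b, hb0, hb⟩ := ((IsFractionRing.isAlgebraic_iff ℤ ℚ ℂ).mpr hζ).exists_integral_multiple
  rw [zsmul_eq_mul] at hb
  obtain ⟨D, hD, C, hC, hv⟩ := exists_pow_eq_sum hb
  choose v hv hvb using hv
  have hb1 : (1 : ℝ) ≤ |(b : ℝ)| := by exact_mod_cast Int.one_le_abs hb0
  have hB : 1 ≤ |(b : ℝ)| * C := one_le_mul_of_one_le_of_one_le hb1 hC
  refine ⟨D, hD, Real.log (|(b : ℝ)| * C), Real.log_nonneg hB, ?_⟩
  intro ι κ _ _ a e m A hι hκ he ha hA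
  have hexp : Real.exp (Real.log (|(b : ℝ)| * C) * m) = (|(b : ℝ)| * C) ^ m := by
    rw [mul_comm, Real.exp_nat_mul, Real.exp_log (by positivity)]
  rw [hexp]
  let S : Matrix (ι × Fin D) κ ℤ :=
    Matrix.of fun i j => a i.1 j * (b ^ (m - e i.1 j) * v (e i.1 j) i.2)
  have hcard : Fintype.card (ι × Fin D) = D * Fintype.card ι := by
    simp [mul_comm]
  have hpos : 0 < D * Fintype.card ι := Nat.mul_pos hD hι
  obtain ⟨t, ht0, ht, htb⟩ := Int.Matrix.exists_ne_zero_int_vec_norm_le S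
    (by rw [hcard, hκ]; omega) (by rw [hcard]; exact hpos)
  refine ⟨t, ht0, fun i => ?_, fun j => ?_⟩
  · have h1 : (b : ℂ) ^ m * ∑ j, (t j : ℂ) * (a i j * ζ ^ e i j) =
        ∑ k : Fin D, ((S.mulVec t (i, k) : ℤ) : ℂ) * ((b : ℂ) * ζ) ^ (k : ℕ) := by
      have h2 : ∀ j, (b : ℂ) ^ m * ζ ^ e i j =
          ∑ k : Fin D, (b : ℂ) ^ (m - e i j) * (v (e i j) k : ℂ) * ((b : ℂ) * ζ) ^ (k : ℕ) := by
        intro j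
        simp only [mul_assoc]
        rw [← Finset.mul_sum, ← hv, mul_pow, ← mul_assoc, ← pow_add, Nat.sub_add_cancel (he i j)]
      simp only [Matrix.mulVec, dotProduct, S, Matrix.of_apply, Int.cast_sum, Finset.sum_mul]
      rw [Finset.sum_comm, Finset.mul_sum]
      refine Finset.sum_congr rfl fun j _ => ?_
      rw [mul_left_comm, mul_left_comm ((b : ℂ) ^ m), h2, Finset.mul_sum, Finset.mul_sum]
      refine Finset.sum_congr rfl fun k _ => ?_
      push_cast
      ring
    have h3 : (b : ℂ) ^ m ≠ 0 := pow_ne_zero _ (by exact_mod_cast hb0)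
    refine (mul_eq_zero.mp (h1.trans ?_)).resolve_left h3
    simp [ht]
  · let : SeminormedAddCommGroup (Matrix (ι × Fin D) κ ℤ) := Matrix.seminormedAddCommGroup
    have hS : ‖S‖ ≤ A * (|(b : ℝ)| * C) ^ m := by
      refine (Matrix.norm_le_iff (by positivity)).mpr fun i j => ?_
      rw [Int.norm_eq_abs]
      simp only [S, Matrix.of_apply, Int.cast_mul, Int.cast_pow, abs_mul, abs_pow]
      refine mul_le_mul (ha _ _) ?_ (by positivity) (by positivity)
      rw [mul_pow]
      refine mul_le_mul (pow_le_pow_right₀ hb1 (Nat.sub_le _ _))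
        ((hvb _ _).trans (pow_le_pow_right₀ hC (he _ _))) (abs_nonneg _) (by positivity)
    have h4 : ‖t‖ ≤ Fintype.card κ * (A * (|(b : ℝ)| * C) ^ m) := by
      refine htb.trans ?_
      have h5 : ((Fintype.card (ι × Fin D) : ℝ) /
          (Fintype.card κ - Fintype.card (ι × Fin D))) = 1 := by
        rw [hcard, hκ]
        have : (0 : ℝ) < (D * Fintype.card ι : ℕ) := by exact_mod_cast hpos
        push_cast at this ⊢
        rw [div_eq_one_iff_eq (by linarith)]
        ring
      rw [h5, Real.rpow_one]
      gcongr
      exact max_le (one_le_mul_of_one_le_of_one_le hA (one_le_pow₀ hB)) hS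
    calc |(t j : ℝ)| = ‖t j‖ := (Int.norm_eq_abs _).symm
      _ ≤ ‖t‖ := norm_le_pi_norm t j
      _ ≤ _ := h4

theorem norm_sin_le_exp (z : ℂ) : ‖Complex.sin z‖ ≤ Real.exp ‖z‖ := by
  have h1 : ‖Complex.exp (-z * Complex.I)‖ ≤ Real.exp ‖z‖ := by
    simpa using Complex.norm_exp_le_exp_norm (-z * Complex.I)
  have h2 : ‖Complex.exp (z * Complex.I)‖ ≤ Real.exp ‖z‖ := by
    simpa using Complex.norm_exp_le_exp_norm (z * Complex.I)
  rw [Complex.sin, norm_div, norm_mul, Complex.norm_I, mul_one, Complex.norm_ofNat,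
    div_le_iff₀ two_pos]
  exact (norm_sub_le _ _).trans (by linarith)

theorem norm_cos_le_exp (z : ℂ) : ‖Complex.cos z‖ ≤ Real.exp ‖z‖ := by
  have h1 : ‖Complex.exp (-z * Complex.I)‖ ≤ Real.exp ‖z‖ := by
    simpa using Complex.norm_exp_le_exp_norm (-z * Complex.I)
  have h2 : ‖Complex.exp (z * Complex.I)‖ ≤ Real.exp ‖z‖ := by
    simpa using Complex.norm_exp_le_exp_norm (z * Complex.I)
  rw [Complex.cos, norm_div, Complex.norm_ofNat, div_le_iff₀ two_pos]
  exact (norm_add_le _ _).trans (by linarith)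

theorem exists_staircase_aux (m : ℕ) : ∃ (φ : ℂ → ℂ) (k : ℂ) (C : ℝ), 0 ≤ C ∧
    (∀ z, HasDerivAt φ (k * Complex.sin (Real.pi * z) ^ (2 * m)) z) ∧
    (∀ z, φ (z + 1) = φ z + 1) ∧ φ 0 = 0 ∧ ∀ z, ‖φ z‖ ≤ C * Real.exp (C * ‖z‖) := by
  induction m with
  | zero =>
    refine ⟨id, 1, 1, zero_le_one, fun z => by simpa using hasDerivAt_id z, fun z => rfl, rfl,
      fun z => ?_⟩
    simpa using (by linarith [Real.add_one_le_exp ‖z‖] : ‖z‖ ≤ Real.exp ‖z‖)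
  | succ m ih =>
    obtain ⟨φ, k, C, hC, hd, hp, h0, hb⟩ := ih
    have hπ : (Real.pi : ℂ) ≠ 0 := by exact_mod_cast Real.pi_ne_zero
    have hm : (2 * (m : ℂ) + 1) ≠ 0 := by exact_mod_cast (2 * m).succ_ne_zero
    set a : ℂ := k / (Real.pi * (2 * m + 1)) with ha
    refine ⟨fun z => φ z - a * (Complex.sin (Real.pi * z) ^ (2 * m + 1) *
      Complex.cos (Real.pi * z)), k * (2 * m + 2) / (2 * m + 1),
      C + ‖a‖ + Real.pi * (2 * m + 2), by positivity, fun z => ?_, fun z => ?_, ?_, fun z => ?_⟩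
    · have hlin : HasDerivAt (fun z : ℂ => (Real.pi : ℂ) * z) (Real.pi : ℂ) z := by
        simpa using (hasDerivAt_id z).const_mul (Real.pi : ℂ)
      have h1 := (hd z).sub (((hlin.csin.pow (2 * m + 1)).mul hlin.ccos).const_mul a)
      refine HasDerivAt.congr_deriv h1 ?_
      rw [Pi.pow_apply]
      have hsq := Complex.sin_sq_add_cos_sq ((Real.pi : ℂ) * z)
      simp only [Nat.add_sub_cancel, ha]
      push_cast
      generalize Complex.sin (Real.pi * z) = s at *
      have hc : Complex.cos (Real.pi * z) ^ 2 = 1 - s ^ 2 := by linear_combination hsq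
      field_simp
      rw [show 2 * (m + 1) = 2 * m + 2 by ring]
      simp only [pow_succ] at hc ⊢
      linear_combination -k * (2 * (m : ℂ) + 1) * s ^ (2 * m) * hc
    · simp only [hp, mul_add, mul_one, Complex.sin_add_pi, Complex.cos_add_pi]
      rw [(by exact ⟨m, rfl⟩ : Odd (2 * m + 1)).neg_pow]
      ring
    · simp [h0]
    · have h1 : ‖a * (Complex.sin (Real.pi * z) ^ (2 * m + 1) * Complex.cos (Real.pi * z))‖ ≤
          ‖a‖ * Real.exp (Real.pi * (2 * m + 2) * ‖z‖) := by
        rw [norm_mul, norm_mul, norm_pow]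
        have e : Real.exp (Real.pi * (2 * m + 2) * ‖z‖) =
            Real.exp ‖(Real.pi : ℂ) * z‖ ^ (2 * m + 1) * Real.exp ‖(Real.pi : ℂ) * z‖ := by
          rw [← pow_succ, ← Real.exp_nat_mul]
          congr 1
          rw [norm_mul, Complex.norm_real, Real.norm_of_nonneg Real.pi_pos.le]
          push_cast
          ring
        rw [e]
        gcongr
        · exact norm_sin_le_exp _
        · exact norm_cos_le_exp _
      have hpos : 0 ≤ Real.pi * (2 * m + 2) := by positivity
      have h2 : C * Real.exp (C * ‖z‖) ≤
          C * Real.exp ((C + ‖a‖ + Real.pi * (2 * m + 2)) * ‖z‖) := by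
        gcongr
        linarith [norm_nonneg a]
      have h3 : ‖a‖ * Real.exp (Real.pi * (2 * m + 2) * ‖z‖) ≤
          ‖a‖ * Real.exp ((C + ‖a‖ + Real.pi * (2 * m + 2)) * ‖z‖) := by
        gcongr
        linarith [norm_nonneg a]
      have h4 : 0 ≤ Real.pi * (2 * m + 2) *
        Real.exp ((C + ‖a‖ + Real.pi * (2 * m + 2)) * ‖z‖) := by positivity
      refine (norm_sub_le _ _).trans ?_
      linarith [hb z]

open Asymptotics Filter Topology in
/-- An entire function that commutes with integer translations and is locally constant to high
order at the integers. -/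
theorem exists_staircase (T : ℕ) : ∃ (φ : ℂ → ℂ) (C : ℝ), 0 ≤ C ∧ Differentiable ℂ φ ∧
    (∀ (s : ℕ) z, φ (s + z) = s + φ z) ∧ φ 0 = 0 ∧ (φ =O[𝓝 0] fun w => w ^ T) ∧
    ∀ z, ‖φ z‖ ≤ C * Real.exp (C * ‖z‖) := by
  obtain ⟨φ, k, C, hC, hd, hp, h0, hb⟩ := exists_staircase_aux T
  refine ⟨φ, C, hC, fun z => (hd z).differentiableAt, fun s z => ?_, h0, ?_, hb⟩
  · induction s with
    | zero => simp
    | succ s ih =>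
      have : ((s + 1 : ℕ) : ℂ) + z = s + z + 1 := by push_cast; ring
      rw [this, hp, ih]
      push_cast
      ring
  · have h1 : (fun w : ℂ => k * Complex.sin (Real.pi * w) ^ (2 * T)) =O[𝓝 0]
        fun w => w ^ (2 * T) := by
      have h2 : (fun w : ℂ => Complex.sin (Real.pi * w)) =O[𝓝 0] fun w => w := by
        have : DifferentiableAt ℂ (fun w : ℂ => Complex.sin (Real.pi * w)) 0 := by fun_prop
        simpa using this.isBigO_sub
      exact (h2.pow _).const_mul_left _
    obtain ⟨M, hM⟩ := h1.bound
    obtain ⟨ε, hε, hball⟩ := Metric.eventually_nhds_iff_ball.mp hM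
    have h3 : ∀ w ∈ Metric.ball (0 : ℂ) (min ε 1), ‖φ w‖ ≤ |M| * ‖w ^ T‖ := by
      intro w hw
      have hw1 : ‖w‖ < ε ∧ ‖w‖ < 1 := by simpa using hw
      have h4 := (convex_closedBall (0 : ℂ) ‖w‖).norm_image_sub_le_of_norm_hasDerivWithin_le
        (f := φ) (C := |M| * ‖w‖ ^ (2 * T)) (fun x _ => (hd x).hasDerivWithinAt)
        (fun x hx => by
          have hx' : ‖x‖ ≤ ‖w‖ := by simpa using hx
          refine (hball x (by simpa using hx'.trans_lt hw1.1)).trans ?_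
          rw [norm_pow]
          have := le_abs_self M
          gcongr) (Metric.mem_closedBall_self (norm_nonneg w)) (show w ∈ _ by simp)
      rw [h0, sub_zero, sub_zero] at h4
      refine h4.trans ?_
      rw [mul_assoc, ← pow_succ, norm_pow]
      gcongr ?_ * ?_
      exact pow_le_pow_of_le_one (norm_nonneg _) hw1.2.le (by omega)
    exact IsBigO.of_bound _ (Metric.eventually_nhds_iff_ball.mpr ⟨_, lt_min hε one_pos, h3⟩)

section

open Asymptotics Filter Topology

theorem exists_eq_sub_pow_mul {G : ℂ → ℂ} (hG : Differentiable ℂ G) (a : ℂ) (T : ℕ)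
    (h : G =O[𝓝 a] fun z => (z - a) ^ T) :
    ∃ H : ℂ → ℂ, Differentiable ℂ H ∧ ∀ z, G z = (z - a) ^ T * H z := by
  induction T generalizing G with
  | zero => exact ⟨G, hG, fun z => by simp⟩
  | succ T ih =>
    have h0 : G a = 0 := by
      have := h.eq_zero_imp
      have := this.self_of_nhds
      simpa using this
    have hD : Differentiable ℂ (dslope G a) := by
      have := (Complex.differentiableOn_dslope (f := G) (c := a) univ_mem).mpr hG.differentiableOn
      exact differentiableOn_univ.mp this
    have hGd : ∀ z, G z = (z - a) * dslope G a z := fun z => by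
      have := sub_smul_dslope G a z
      rw [h0, sub_zero, smul_eq_mul] at this
      exact this.symm
    have hne : (dslope G a) =O[𝓝[≠] a] fun z => (z - a) ^ T := by
      obtain ⟨M, hM⟩ := (h.mono (nhdsWithin_le_nhds (s := {a}ᶜ))).bound
      refine IsBigO.of_bound M ?_
      filter_upwards [hM, self_mem_nhdsWithin] with z hz hza
      have hpos : 0 < ‖z - a‖ := norm_pos_iff.mpr (sub_ne_zero.mpr hza)
      rw [hGd z, pow_succ', norm_mul, norm_mul] at hz
      refine le_of_mul_le_mul_left (hz.trans_eq ?_) hpos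
      ring
    have hO : (dslope G a) =O[𝓝 a] fun z => (z - a) ^ T := by
      rcases T with _ | T
      · simpa using (hD a).continuousAt.norm.isBoundedUnder_le.isBigO_one ℝ
      · have hT : dslope G a a = 0 := by
          have h1 : Tendsto (dslope G a) (𝓝[≠] a) (𝓝 0) := by
            refine hne.trans_tendsto ?_
            have : Tendsto (fun z : ℂ => (z - a) ^ (T + 1)) (𝓝 a) (𝓝 ((a - a) ^ (T + 1))) :=
              Continuous.tendsto (by fun_prop) a
            simp only [sub_self, ne_eq, Nat.add_eq_zero_iff, one_ne_zero, and_false,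
              not_false_eq_true, zero_pow] at this
            exact this.mono_left nhdsWithin_le_nhds
          exact tendsto_nhds_unique ((hD a).continuousAt.tendsto.mono_left nhdsWithin_le_nhds) h1
        obtain ⟨M, hM⟩ := hne.bound
        refine IsBigO.of_bound M ?_
        filter_upwards [eventually_nhdsWithin_iff.mp hM] with z hz
        by_cases hza : z = a
        · subst hza
          simp only [hT]
          simp
        · exact hz hza
    obtain ⟨H, hH, hH'⟩ := ih hD hO
    exact ⟨H, hH, fun z => by rw [hGd z, hH' z, pow_succ']; ring⟩

theorem exists_eq_prod_mul {G : ℂ → ℂ} (hG : Differentiable ℂ G) (T S : ℕ)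
    (h : ∀ s < S, G =O[𝓝 (s : ℂ)] fun z => (z - s) ^ T) :
    ∃ H : ℂ → ℂ, Differentiable ℂ H ∧
      ∀ z, G z = (∏ s ∈ Finset.range S, (z - s) ^ T) * H z := by
  induction S with
  | zero => exact ⟨G, hG, fun z => by simp⟩
  | succ S ih =>
    obtain ⟨H, hH, hGH⟩ := ih fun s hs => h s (by omega)
    have hO : H =O[𝓝 (S : ℂ)] fun z => (z - S) ^ T := by
      have hne : (∏ s ∈ Finset.range S, ((S : ℂ) - s) ^ T) ≠ 0 := by
        refine Finset.prod_ne_zero_iff.mpr fun s hs => pow_ne_zero _ (sub_ne_zero.mpr ?_)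
        exact_mod_cast (Finset.mem_range.mp hs).ne'
      have hcont : ContinuousAt (fun z : ℂ => (∏ s ∈ Finset.range S, (z - s) ^ T)⁻¹) (S : ℂ) :=
        ContinuousAt.inv₀ (by fun_prop) hne
      have h1 : (fun z : ℂ => (∏ s ∈ Finset.range S, (z - s) ^ T)⁻¹) =O[𝓝 (S : ℂ)]
          fun _ => (1 : ℂ) := hcont.isBigO_one ℂ
      have h2 := h1.mul (h S (by omega))
      refine (h2.congr' ?_ ?_)
      · have : ∀ᶠ z : ℂ in 𝓝 (S : ℂ), (∏ s ∈ Finset.range S, (z - s) ^ T) ≠ 0 := by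
          have hc : ContinuousAt (fun z : ℂ => ∏ s ∈ Finset.range S, (z - s) ^ T) (S : ℂ) := by
            fun_prop
          exact ContinuousAt.eventually_ne hc hne
        filter_upwards [this] with z hz
        rw [hGH z, inv_mul_cancel_left₀ hz]
      · exact Eventually.of_forall fun z => one_mul _
    obtain ⟨H', hH', hHH'⟩ := exists_eq_sub_pow_mul hH (S : ℂ) T hO
    exact ⟨H', hH', fun z => by rw [hGH z, hHH' z, Finset.prod_range_succ]; ring⟩

/-- Schwarz's lemma for an entire function with zeros of order `T` at `0, …, S - 1`. -/
theorem norm_le_of_zeros {G : ℂ → ℂ} (hG : Differentiable ℂ G) {T S S' : ℕ}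
    (h : ∀ s < S, G =O[𝓝 (s : ℂ)] fun z => (z - s) ^ T) (hS : S ≤ S') {B : ℝ}
    (hB : ∀ z, ‖z‖ = 4 * S' → ‖G z‖ ≤ B) {s' : ℕ} (hs' : s' < S') :
    ‖G s'‖ ≤ B * Real.exp (-(T * S)) := by
  obtain ⟨H, hH, hGH⟩ := exists_eq_prod_mul hG T S h
  have hS'0 : (0 : ℝ) < S' := by exact_mod_cast (Nat.zero_le _).trans_lt hs'
  have hcard : ∀ c : ℝ, ∏ _s ∈ Finset.range S, c ^ T = c ^ (T * S) := fun c => by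
    rw [Finset.prod_const, Finset.card_range, ← pow_mul]
  have hbd : ∀ z ∈ frontier (Metric.ball (0 : ℂ) (4 * S')), ‖H z‖ ≤ B / (3 * S') ^ (T * S) := by
    intro z hz
    rw [frontier_ball _ (by positivity)] at hz
    have hz' : ‖z‖ = 4 * S' := by simpa using hz
    have h1 : (3 * S' : ℝ) ^ (T * S) ≤ ‖∏ s ∈ Finset.range S, (z - s) ^ T‖ := by
      rw [norm_prod, ← hcard]
      refine Finset.prod_le_prod (fun _ _ => by positivity) fun s hs => ?_
      rw [norm_pow]
      refine pow_le_pow_left₀ (by positivity) ?_ _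
      have h2 : ‖z‖ - ‖(s : ℂ)‖ ≤ ‖z - s‖ := norm_sub_norm_le _ _
      have h3 : (s : ℝ) ≤ S' := by exact_mod_cast ((Finset.mem_range.mp hs).le.trans hS)
      rw [Complex.norm_natCast] at h2
      linarith
    rw [le_div_iff₀ (by positivity)]
    calc ‖H z‖ * (3 * S') ^ (T * S) ≤ ‖H z‖ * ‖∏ s ∈ Finset.range S, (z - s) ^ T‖ := by gcongr
      _ = ‖G z‖ := by rw [hGH z, norm_mul, mul_comm]
      _ ≤ B := hB z hz'
  have hHs := Complex.norm_le_of_forall_mem_frontier_norm_le Metric.isBounded_ball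
    hH.diffContOnCl hbd (z := (s' : ℂ)) (subset_closure (by
      have : (s' : ℝ) < S' := by exact_mod_cast hs'
      simp
      linarith))
  have hB0 : 0 ≤ B := (norm_nonneg _).trans (hB ((4 * S' : ℝ) : ℂ) (by simp))
  have h1 : ‖∏ s ∈ Finset.range S, ((s' : ℂ) - s) ^ T‖ ≤ (S' : ℝ) ^ (T * S) := by
    rw [norm_prod, ← hcard]
    refine Finset.prod_le_prod (fun _ _ => norm_nonneg _) fun s hs => ?_
    rw [norm_pow]
    refine pow_le_pow_left₀ (norm_nonneg _) ?_ _
    have h2 : ((s' : ℂ) - s) = ((s' - s : ℝ) : ℂ) := by push_cast; ring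
    rw [h2, Complex.norm_real, Real.norm_eq_abs, abs_le]
    have h3 : (s : ℝ) ≤ S' := by exact_mod_cast ((Finset.mem_range.mp hs).le.trans hS)
    have h4 : (s' : ℝ) ≤ S' := by exact_mod_cast hs'.le
    constructor <;> linarith [Nat.cast_nonneg (α := ℝ) s, Nat.cast_nonneg (α := ℝ) s']
  have h3 : Real.exp 1 ≤ 3 := by linarith [Real.exp_one_lt_d9]
  calc ‖G s'‖ ≤ (S' : ℝ) ^ (T * S) * (B / (3 * S') ^ (T * S)) := by
        rw [hGH, norm_mul]; gcongr
    _ = B * (3 ^ (T * S))⁻¹ := by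
        rw [mul_pow]
        field_simp
    _ ≤ B * (Real.exp 1 ^ (T * S))⁻¹ := by gcongr
    _ = B * Real.exp (-(T * S)) := by
        rw [← Real.exp_nat_mul, ← Real.exp_neg]
        push_cast
        ring_nf

end

open Polynomial in
theorem sum_C_mul_eq_zero {N : ℕ} {P : ℕ → ℂ[X]} (hP : ∀ k, (P k).degree = k) {c : Fin N → ℂ}
    (h : ∑ k : Fin N, C (c k) * P k = 0) (k : Fin N) : c k = 0 := by
  have h1 := (Polynomial.Sequence.linearIndependent ⟨P, hP⟩).comp (Fin.val : Fin N → ℕ)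
    Fin.val_injective
  refine Fintype.linearIndependent_iff.mp h1 c ?_ k
  simpa [smul_eq_C_mul] using h

/-- The frequency, scaled by `q`, of the term of index `j` in Baker's auxiliary function. -/
def weight {N L : ℕ} (p : ℤ) (q : ℕ) (j : Fin N × Fin L × Fin L) : ℤ :=
  ((j.2.1 : ℕ) : ℤ) * p + ((j.2.2 : ℕ) : ℤ) * q

open Polynomial in
/-- The divided derivatives of Baker's auxiliary function at the integer `s`. -/
noncomputable def auxSum (P : ℕ → ℂ[X]) {N L : ℕ} (t : Fin N × Fin L × Fin L → ℤ) (p : ℤ) (q : ℕ)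
    (ζ : ℂ) (a b s : ℕ) : ℂ :=
  ∑ j, (t j : ℂ) * (hasseDeriv a (P j.1)).eval (s : ℂ) * (weight p q j : ℂ) ^ b *
    ζ ^ ((j.2.1 : ℕ) * s)

open Polynomial in
/-- Enough vanishing of the auxiliary function forces its coefficients to vanish. -/
theorem eq_zero_of_auxSum {P : ℕ → ℂ[X]} (hP : ∀ k, (P k).degree = k) {N L : ℕ}
    {t : Fin N × Fin L × Fin L → ℤ} {p : ℤ} {q : ℕ} (hq : 0 < q) {ζ : ℂ} (hζ0 : ζ ≠ 0)
    (hζ : Function.Injective fun i : ℕ => ζ ^ i)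
    (h : ∀ b < L, ∀ s < L * N, auxSum P t p q ζ 0 b s = 0) : t = 0 := by
  funext ⟨k, l, m⟩
  have key : ∀ b < L, ∑ k : Fin N, C (∑ m : Fin L, (t (k, l, m) : ℂ) *
      (weight p q (k, l, m) : ℂ) ^ b) * P k = 0 := by
    intro b hb
    refine expPoly_eq_zero (ι := Fin L) (x := fun l => ζ ^ (l : ℕ))
      (fun i j hij => Fin.ext (hζ hij)) (fun i => pow_ne_zero _ hζ0) (L * N) (fun _ => N)
      (by simp) (fun l => ∑ k : Fin N, C (∑ m : Fin L, (t (k, l, m) : ℂ) *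
        (weight p q (k, l, m) : ℂ) ^ b) * P k) (fun l => ?_) (fun s hs => ?_) l
    · refine (degree_sum_le _ _).trans_lt ?_
      rw [Finset.sup_lt_iff (WithBot.bot_lt_coe _)]
      intro k _
      refine ((degree_mul_le _ _).trans (add_le_add_left degree_C_le _)).trans_lt ?_
      rw [zero_add, hP]
      exact_mod_cast k.2
    · rw [← h b hb s hs, auxSum]
      simp only [eval_finsetSum, eval_mul, eval_C, Fintype.sum_prod_type, Finset.sum_mul,
        hasseDeriv_zero, LinearMap.id_apply]
      rw [Finset.sum_comm]
      refine Finset.sum_congr rfl fun k _ => Finset.sum_congr rfl fun l _ =>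
        Finset.sum_congr rfl fun m _ => ?_
      rw [pow_mul]
      ring
  have h2 := Matrix.eq_zero_of_forall_pow_sum_mul_pow_eq_zero
    (f := fun m : Fin L => (weight p q (k, l, m) : ℂ)) (v := fun m => (t (k, l, m) : ℂ))
    (fun m m' hm => by
      beta_reduce at hm
      have h3 : weight p q (k, l, m) = weight p q (k, l, m') := by exact_mod_cast hm
      simp only [weight, add_right_inj] at h3
      have h4 := mul_right_cancel₀ (by exact_mod_cast hq.ne') h3
      exact Fin.ext (by exact_mod_cast h4))
    (fun b => sum_C_mul_eq_zero hP (key b b.2) k)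
  have h5 := congr_fun h2 m
  simpa using h5

theorem isBigO_pow_pow {T n : ℕ} (h : T ≤ n) :
    (fun w : ℂ => w ^ n) =O[nhds 0] fun w => w ^ T := by
  refine Asymptotics.IsBigO.of_bound 1 ?_
  filter_upwards [Metric.ball_mem_nhds (0 : ℂ) one_pos] with w hw
  have hw1 : ‖w‖ ≤ 1 := by simpa using (Metric.mem_ball.mp hw).le
  rw [one_mul, norm_pow, norm_pow]
  exact pow_le_pow_of_le_one (norm_nonneg _) hw1 h

open Polynomial in
theorem norm_sub_taylor_isBigO (Q : ℂ[X]) (s : ℂ) (T : ℕ) :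
    (fun w : ℂ => Q.eval (s + w) - ∑ a ∈ Finset.range T, (hasseDeriv a Q).eval s * w ^ a)
      =O[nhds 0] fun w => w ^ T := by
  have h2 : ∀ w : ℂ, Q.eval (s + w) - ∑ a ∈ Finset.range T, (hasseDeriv a Q).eval s * w ^ a =
      ∑ a ∈ Finset.range (Q.natDegree + 1), (hasseDeriv (T + a) Q).eval s * w ^ (T + a) := by
    intro w
    have h1 : Q.eval (s + w) = (taylor s Q).eval w := by rw [taylor_eval, add_comm]
    rw [h1, eval_eq_sum_range' (n := T + (Q.natDegree + 1)) (by rw [natDegree_taylor]; omega),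
      Finset.sum_range_add]
    simp [taylor_coeff]
  simp_rw [h2]
  exact Asymptotics.IsBigO.fun_sum fun a _ =>
    (isBigO_pow_pow (Nat.le_add_right T a)).const_mul_left _

open Polynomial in
/-- An entire function interpolating `auxSum`, whose Taylor coefficients at integers are governed
by `auxSum`. -/
noncomputable def auxFn (P : ℕ → ℂ[X]) {N L : ℕ} (t : Fin N × Fin L × Fin L → ℤ) (p : ℤ) (q : ℕ)
    (δ : ℝ) (φ : ℂ → ℂ) (a b : ℕ) (z : ℂ) : ℂ :=
  ∑ j, (t j : ℂ) * (hasseDeriv a (P j.1)).eval z * (weight p q j : ℂ) ^ b *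
    Complex.exp (2 * Real.pi * Complex.I * (weight p q j / q * z + (j.2.1 : ℕ) * δ * φ z))

open Polynomial in
theorem differentiable_auxFn (P : ℕ → ℂ[X]) {N L : ℕ} (t : Fin N × Fin L × Fin L → ℤ) (p : ℤ)
    (q : ℕ) (δ : ℝ) {φ : ℂ → ℂ} (hφ : Differentiable ℂ φ) (a b : ℕ) :
    Differentiable ℂ (auxFn P t p q δ φ a b) := by
  unfold auxFn
  fun_prop

theorem exp_weight_eq {N L : ℕ} (p : ℤ) {q : ℕ} (hq : 0 < q) {θ δ : ℝ} (hδ : θ = p / q + δ)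
    (j : Fin N × Fin L × Fin L) (s : ℕ) (y v : ℂ) :
    Complex.exp (2 * Real.pi * Complex.I *
      (weight p q j / q * (s + y) + (j.2.1 : ℕ) * δ * (s + v))) =
    Complex.exp (2 * Real.pi * Complex.I * θ) ^ ((j.2.1 : ℕ) * s) *
      Complex.exp (weight p q j * (2 * Real.pi * Complex.I / q) * y) *
      Complex.exp (2 * Real.pi * Complex.I * (j.2.1 : ℕ) * δ * v) := by
  have hq' : (q : ℂ) ≠ 0 := by exact_mod_cast hq.ne'
  rw [← Complex.exp_nat_mul, ← Complex.exp_add, ← Complex.exp_add,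
    Complex.exp_eq_exp_iff_exists_int]
  refine ⟨(j.2.2 : ℕ) * s, ?_⟩
  rw [hδ]
  simp only [weight]
  push_cast
  field_simp
  ring

open Polynomial in
theorem auxFn_natCast (P : ℕ → ℂ[X]) {N L : ℕ} (t : Fin N × Fin L × Fin L → ℤ) (p : ℤ)
    {q : ℕ} (hq : 0 < q) {θ δ : ℝ} (hδ : θ = p / q + δ) {φ : ℂ → ℂ}
    (hφ : ∀ (s : ℕ) z, φ (s + z) = s + φ z) (hφ0 : φ 0 = 0) (a b s : ℕ) :
    auxFn P t p q δ φ a b s =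
      auxSum P t p q (Complex.exp (2 * Real.pi * Complex.I * θ)) a b s := by
  refine Finset.sum_congr rfl fun j _ => ?_
  have h1 := hφ s 0
  have h2 := exp_weight_eq p hq hδ j s 0 0
  rw [add_zero, hφ0] at h1
  simp only [mul_zero, Complex.exp_zero, mul_one] at h2
  rw [h1]
  simp only [add_zero] at h2 ⊢
  rw [h2]

open Polynomial Asymptotics Filter Topology in
theorem auxFn_isBigO (P : ℕ → ℂ[X]) {N L : ℕ} (t : Fin N × Fin L × Fin L → ℤ) (p : ℤ)
    {q : ℕ} (hq : 0 < q) {θ δ : ℝ} (hδ : θ = p / q + δ) {φ : ℂ → ℂ}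
    (hφ : ∀ (s : ℕ) z, φ (s + z) = s + φ z) {T : ℕ} (hφ0 : φ =O[𝓝 0] fun w => w ^ T)
    (hφc : ContinuousAt φ 0) (hφ00 : φ 0 = 0) (a b s : ℕ)
    (h : ∀ a' b', a' + b' < T →
      auxSum P t p q (Complex.exp (2 * Real.pi * Complex.I * θ)) (a + a') (b + b') s = 0) :
    auxFn P t p q δ φ a b =O[𝓝 (s : ℂ)] fun z => (z - s) ^ T := by
  set ζ := Complex.exp (2 * Real.pi * Complex.I * θ) with hζ
  set c : ℂ := 2 * Real.pi * Complex.I / q with hc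
  -- it suffices to work near zero
  suffices H : (fun w => auxFn P t p q δ φ a b (s + w)) =O[𝓝 0] fun w : ℂ => w ^ T by
    have ht : Tendsto (fun z : ℂ => z - s) (𝓝 (s : ℂ)) (𝓝 0) := by
      have : Continuous fun z : ℂ => z - s := by fun_prop
      simpa using this.tendsto (s : ℂ)
    have := H.comp_tendsto ht
    refine this.congr_left fun z => ?_
    simp
  -- Taylor polynomials of the three factors
  let Q : Fin N × Fin L × Fin L → ℂ[X] := fun j => hasseDeriv a (P j.1)
  let u : Fin N × Fin L × Fin L → ℂ := fun j => weight p q j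
  let A : Fin N × Fin L × Fin L → ℂ → ℂ := fun j w =>
    ∑ a' ∈ Finset.range T, (hasseDeriv a' (Q j)).eval (s : ℂ) * w ^ a'
  let E : Fin N × Fin L × Fin L → ℂ → ℂ := fun j w =>
    ∑ b' ∈ Finset.range T, (u j * c * w) ^ b' / (b'.factorial : ℂ)
  have hA : ∀ j, (fun w : ℂ => (Q j).eval (s + w) - A j w) =O[𝓝 0] fun w => w ^ T := fun j =>
    norm_sub_taylor_isBigO _ _ _
  have hE : ∀ j, (fun w : ℂ => Complex.exp (u j * c * w) - E j w) =O[𝓝 0] fun w => w ^ T := by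
    intro j
    have ht : Tendsto (fun w : ℂ => u j * c * w) (𝓝 0) (𝓝 0) := by
      have : Continuous fun w : ℂ => u j * c * w := by fun_prop
      simpa using this.tendsto 0
    have h1 := (Complex.exp_sub_sum_range_isBigO_pow T).comp_tendsto ht
    refine h1.trans ?_
    simp only [Function.comp_def, mul_pow]
    exact (isBigO_refl _ _).const_mul_left _
  have hF : ∀ j : Fin N × Fin L × Fin L, (fun w : ℂ =>
      Complex.exp (2 * Real.pi * Complex.I * (j.2.1 : ℕ) * δ * φ w) - 1) =O[𝓝 0]
      fun w => w ^ T := by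
    intro j
    have ht : Tendsto (fun w : ℂ => 2 * Real.pi * Complex.I * (j.2.1 : ℕ) * δ * φ w)
        (𝓝 0) (𝓝 0) := by
      have : ContinuousAt (fun w : ℂ => 2 * Real.pi * Complex.I * (j.2.1 : ℕ) * δ * φ w) 0 := by
        fun_prop
      simpa [ContinuousAt, hφ00] using this
    have h1 := (Complex.exp_sub_sum_range_isBigO_pow 1).comp_tendsto ht
    simp only [Finset.range_one, Finset.sum_singleton, pow_zero, Nat.factorial_zero, Nat.cast_one,
      div_one, pow_one] at h1
    exact h1.trans (hφ0.const_mul_left _)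
  have hb1 : ∀ f : ℂ → ℂ, Continuous f → f =O[𝓝 0] fun _ => (1 : ℂ) := fun f hf =>
    hf.continuousAt.isBigO_one ℂ
  have hprod : ∀ j : Fin N × Fin L × Fin L, (fun w : ℂ => (t j : ℂ) * (Q j).eval (s + w) *
      u j ^ b * Complex.exp (2 * Real.pi * Complex.I *
        (u j / q * (s + w) + (j.2.1 : ℕ) * δ * φ (s + w))) -
      (t j : ℂ) * u j ^ b * ζ ^ ((j.2.1 : ℕ) * s) * (A j w * E j w)) =O[𝓝 0]
      fun w => w ^ T := by
    intro j
    have e : ∀ w : ℂ, (t j : ℂ) * (Q j).eval (s + w) *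
      u j ^ b * Complex.exp (2 * Real.pi * Complex.I *
        (u j / q * (s + w) + (j.2.1 : ℕ) * δ * φ (s + w))) -
      (t j : ℂ) * u j ^ b * ζ ^ ((j.2.1 : ℕ) * s) * (A j w * E j w) =
      ((t j : ℂ) * u j ^ b * ζ ^ ((j.2.1 : ℕ) * s)) *
      ((Q j).eval (s + w) * Complex.exp (u j * c * w) *
        (Complex.exp (2 * Real.pi * Complex.I * (j.2.1 : ℕ) * δ * φ w) - 1) +
       (Q j).eval (s + w) * (Complex.exp (u j * c * w) - E j w) +
       E j w * ((Q j).eval (s + w) - A j w)) := by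
      intro w
      rw [hφ, exp_weight_eq p hq hδ j s w (φ w)]
      ring
    simp_rw [e]
    have hQc : (fun w : ℂ => (Q j).eval (s + w)) =O[𝓝 0] fun _ => (1 : ℂ) :=
      hb1 _ (by fun_prop)
    have hexpc : (fun w : ℂ => Complex.exp (u j * c * w)) =O[𝓝 0] fun _ => (1 : ℂ) :=
      hb1 _ (by fun_prop)
    have hEc : (fun w : ℂ => E j w) =O[𝓝 0] fun _ => (1 : ℂ) := hb1 _ (by fun_prop)
    refine IsBigO.const_mul_left ((IsBigO.add ?_ ?_).add ?_) _
    · simpa using (hQc.mul hexpc).mul (hF j)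
    · simpa using hQc.mul (hE j)
    · simpa using hEc.mul (hA j)
  have hsum := IsBigO.fun_sum (s := Finset.univ) fun j _ => hprod j
  have hmain : (fun w : ℂ => ∑ j, (t j : ℂ) * u j ^ b * ζ ^ ((j.2.1 : ℕ) * s) *
      (A j w * E j w)) =O[𝓝 0] fun w => w ^ T := by
    have e : ∀ w : ℂ, ∑ j, (t j : ℂ) * u j ^ b * ζ ^ ((j.2.1 : ℕ) * s) * (A j w * E j w) =
        ∑ a' ∈ Finset.range T, ∑ b' ∈ Finset.range T,
          (c ^ b' / (b'.factorial : ℂ) * ((a + a').choose a' : ℂ) *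
            auxSum P t p q ζ (a + a') (b + b') s) * w ^ (a' + b') := by
      intro w
      simp only [A, E, Finset.sum_mul_sum]
      simp only [auxSum, Finset.mul_sum, Finset.sum_mul]
      rw [Finset.sum_comm]
      refine Finset.sum_congr rfl fun a' _ => ?_
      rw [Finset.sum_comm]
      refine Finset.sum_congr rfl fun b' _ => Finset.sum_congr rfl fun j _ => ?_
      have h1 : hasseDeriv a' (Q j) = ((a + a').choose a') • hasseDeriv (a + a') (P j.1) := by
        have := congrArg (fun f => f (P j.1)) (hasseDeriv_comp (R := ℂ) a' a)
        simpa [add_comm] using this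
      rw [h1, eval_smul, nsmul_eq_mul]
      simp only [u]
      ring
    simp_rw [e]
    refine IsBigO.fun_sum fun a' _ => IsBigO.fun_sum fun b' _ => ?_
    by_cases hab : a' + b' < T
    · simp only [h a' b' hab, mul_zero, zero_mul]
      exact isBigO_zero _ _
    · exact (isBigO_pow_pow (by omega)).const_mul_left _
  refine (hsum.add hmain).congr_left fun w => ?_
  rw [← Finset.sum_add_distrib]
  refine Finset.sum_congr rfl fun j _ => ?_
  simp only [u, Q]
  ring

/-- A sequence of integer-valued polynomials, one of each degree, with controlled denominators of
their divided derivatives. -/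
noncomputable def stdPoly (h k : ℕ) : Polynomial ℂ := blockPoly h (k / h) (k % h)

theorem degree_stdPoly (h k : ℕ) : (stdPoly h k).degree = k := by
  rw [stdPoly, Polynomial.degree_eq_natDegree (blockPoly_ne_zero _ _ _), natDegree_blockPoly,
    mul_comm, Nat.div_add_mod]

theorem exists_int_stdPoly {ν h : ℕ} (hh : 0 < h) (hν : ∀ i, 1 ≤ i → i ≤ h → i ∣ ν) (k a s : ℕ) :
    ∃ m : ℤ, (m : ℂ) = (ν : ℂ) ^ a * (Polynomial.hasseDeriv a (stdPoly h k)).eval (s : ℂ) :=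
  (integralAt_blockPoly hν s _ _ (Nat.mod_lt _ hh).le).exists_int a

theorem norm_eval_hasseDeriv_stdPoly_le {h M k : ℕ} (hh : 0 < h) (hk : k < h * M) (a : ℕ) (z : ℂ) :
    ‖(Polynomial.hasseDeriv a (stdPoly h k)).eval z‖ ≤ Real.exp (M * (‖z‖ + 1 + h)) := by
  refine (norm_eval_hasseDeriv_blockPoly_le (Nat.mod_lt _ hh).le z).trans ?_
  have : ((k / h : ℕ) : ℝ) + 1 ≤ M := by exact_mod_cast Nat.div_lt_of_lt_mul hk
  gcongr

theorem abs_int_stdPoly_le {h M k ν : ℕ} (hh : 0 < h) (hk : k < h * M) {a s : ℕ} {m : ℤ}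
    (hm : (m : ℂ) = (ν : ℂ) ^ a * (Polynomial.hasseDeriv a (stdPoly h k)).eval (s : ℂ))
    {W : ℝ} (hW : (ν : ℝ) ≤ Real.exp W) :
    |(m : ℝ)| ≤ Real.exp (W * a + M * (s + 1 + h)) := by
  have h1 : |(m : ℝ)| = ‖(m : ℂ)‖ := by rw [Complex.norm_intCast]
  rw [h1, hm, norm_mul, norm_pow, Complex.norm_natCast, Real.exp_add, mul_comm W, Real.exp_nat_mul]
  have h2 := norm_eval_hasseDeriv_stdPoly_le hh hk a (s : ℂ)
  rw [Complex.norm_natCast] at h2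
  gcongr

theorem nu_pow_mul_auxSum {h ν N L : ℕ} (t : Fin N × Fin L × Fin L → ℤ) (p : ℤ) (q : ℕ) (ζ : ℂ)
    (a b s : ℕ) {m : ℕ → ℤ}
    (hm : ∀ k, (m k : ℂ) = (ν : ℂ) ^ a * (Polynomial.hasseDeriv a (stdPoly h k)).eval (s : ℂ)) :
    (ν : ℂ) ^ a * auxSum (stdPoly h) t p q ζ a b s =
      ∑ j, (t j : ℂ) * ((m j.1 * weight p q j ^ b : ℤ) * ζ ^ ((j.2.1 : ℕ) * s)) := by
  rw [auxSum, Finset.mul_sum]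
  refine Finset.sum_congr rfl fun j _ => ?_
  push_cast
  rw [hm]
  ring

theorem exists_auxSum_eq_zero {ζ : ℂ} {D : ℕ} {c : ℝ}
    (hS : ∀ (ι κ : Type) [Fintype ι] [Fintype κ] (a : ι → κ → ℤ) (e : ι → κ → ℕ) (m : ℕ) (A : ℝ),
      0 < Fintype.card ι → Fintype.card κ = 2 * (D * Fintype.card ι) →
      (∀ i j, e i j ≤ m) → (∀ i j, |(a i j : ℝ)| ≤ A) → 1 ≤ A →
      ∃ t : κ → ℤ, t ≠ 0 ∧ (∀ i, ∑ j, (t j : ℂ) * (a i j * ζ ^ e i j) = 0) ∧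
        ∀ j, |(t j : ℝ)| ≤ Fintype.card κ * (A * Real.exp (c * m)))
    {h M L T S ν q : ℕ} {p : ℤ} {W V : ℝ} (hh : 0 < h) (hT : 0 < T) (hS0 : 0 < S)
    (hν0 : 0 < ν) (hν : ∀ i, 1 ≤ i → i ≤ h → i ∣ ν) (hW : (ν : ℝ) ≤ Real.exp W) (hW0 : 0 ≤ W)
    (hV0 : 0 ≤ V) (hV : ∀ j : Fin (h * M) × Fin L × Fin L, |(weight p q j : ℝ)| ≤ Real.exp V)
    (hcard : h * M * (L * L) = 2 * (D * (T * (T * S)))) :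
    ∃ t : Fin (h * M) × Fin L × Fin L → ℤ, t ≠ 0 ∧
      (∀ a b s, a < T → b < T → s < S → auxSum (stdPoly h) t p q ζ a b s = 0) ∧
      ∀ j, |(t j : ℝ)| ≤ (h * M * (L * L) : ℕ) *
        (Real.exp (W * T + M * (S + 1 + h) + V * T) * Real.exp (c * (L * S : ℕ))) := by
  choose m hm using fun a s k => exists_int_stdPoly hh hν k a s
  obtain ⟨t, ht0, ht, htb⟩ := hS (Fin T × Fin T × Fin S) (Fin (h * M) × Fin L × Fin L)
    (fun i j => m i.1 i.2.2 j.1 * weight p q j ^ (i.2.1 : ℕ)) (fun i j => (j.2.1 : ℕ) * i.2.2)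
    (L * S) (Real.exp (W * T + M * (S + 1 + h) + V * T))
    (by simp [hT, hS0]) (by simpa using hcard)
    (fun i j => Nat.mul_le_mul j.2.1.2.le i.2.2.2.le)
    (fun i j => by
      have h1 := abs_int_stdPoly_le hh j.1.2 (hm i.1 i.2.2 j.1) hW
      push_cast
      rw [abs_mul, abs_pow, Real.exp_add]
      have h2 : |(weight p q j : ℝ)| ^ (i.2.1 : ℕ) ≤ Real.exp (V * T) := by
        refine (pow_le_pow_left₀ (abs_nonneg _) (hV j) _).trans ?_
        rw [← Real.exp_nat_mul, mul_comm]
        have : ((i.2.1 : ℕ) : ℝ) ≤ T := by exact_mod_cast i.2.1.2.le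
        gcongr
      have h3 : ((i.1 : ℕ) : ℝ) ≤ T := by exact_mod_cast i.1.2.le
      have h4 : ((i.2.2 : ℕ) : ℝ) ≤ S := by exact_mod_cast i.2.2.2.le
      have h5 : Real.exp (W * (i.1 : ℕ) + M * ((i.2.2 : ℕ) + 1 + h)) ≤
          Real.exp (W * T + M * (S + 1 + h)) := by gcongr
      exact mul_le_mul (h1.trans h5) h2 (by positivity) (by positivity))
    (Real.one_le_exp (by positivity))
  refine ⟨t, ht0, fun a b s ha hb hs => ?_, fun j => by simpa using htb j⟩
  have h1 := ht (⟨a, ha⟩, ⟨b, hb⟩, ⟨s, hs⟩)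
  have h2 := nu_pow_mul_auxSum t p q ζ a b s (hm a s)
  beta_reduce at h1
  rw [← h2] at h1
  exact (mul_eq_zero.mp h1).resolve_left (pow_ne_zero _ (by exact_mod_cast hν0.ne'))

theorem norm_auxFn_le {h M L q : ℕ} {p : ℤ} {t : Fin (h * M) × Fin L × Fin L → ℤ}
    {δ H K V U : ℝ} {φ : ℂ → ℂ} {a b T : ℕ} {z : ℂ} (hh : 0 < h)
    (hV0 : 0 ≤ V) (hV : ∀ j : Fin (h * M) × Fin L × Fin L, |(weight p q j : ℝ)| ≤ Real.exp V)
    (hU : ∀ j : Fin (h * M) × Fin L × Fin L, |(weight p q j : ℝ)| / q ≤ U)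
    (ht : ∀ j, |(t j : ℝ)| ≤ Real.exp H) (hK : ((h * M * (L * L) : ℕ) : ℝ) ≤ Real.exp K)
    (hb : b ≤ T) (hφ : 2 * Real.pi * L * |δ| * ‖φ z‖ ≤ 1) :
    ‖auxFn (stdPoly h) t p q δ φ a b z‖ ≤
      Real.exp (K + H + M * (‖z‖ + 1 + h) + V * T + (2 * Real.pi * U * ‖z‖ + 1)) := by
  have hterm : ∀ j : Fin (h * M) × Fin L × Fin L,
      ‖(t j : ℂ) * (Polynomial.hasseDeriv a (stdPoly h j.1)).eval z * (weight p q j : ℂ) ^ b *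
        Complex.exp (2 * Real.pi * Complex.I * (weight p q j / q * z + (j.2.1 : ℕ) * δ * φ z))‖ ≤
      Real.exp (H + M * (‖z‖ + 1 + h) + V * T + (2 * Real.pi * U * ‖z‖ + 1)) := by
    intro j
    rw [norm_mul, norm_mul, norm_mul, norm_pow, Complex.norm_intCast, Complex.norm_intCast]
    have h1 := norm_eval_hasseDeriv_stdPoly_le hh j.1.2 a z
    have h2 : |(weight p q j : ℝ)| ^ b ≤ Real.exp (V * T) := by
      refine (pow_le_pow_left₀ (abs_nonneg _) (hV j) _).trans ?_
      rw [← Real.exp_nat_mul, mul_comm]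
      gcongr
    have h3 : ‖2 * Real.pi * Complex.I * (weight p q j / q * z + (j.2.1 : ℕ) * δ * φ z)‖ ≤
        2 * Real.pi * U * ‖z‖ + 1 := by
      have h4 : ‖(weight p q j : ℂ) / q * z + (j.2.1 : ℕ) * δ * φ z‖ ≤
          |(weight p q j : ℝ)| / q * ‖z‖ + (j.2.1 : ℕ) * |δ| * ‖φ z‖ := by
        refine (norm_add_le _ _).trans_eq ?_
        simp [Complex.norm_real, Complex.norm_intCast]
      have h5 : ((j.2.1 : ℕ) : ℝ) ≤ L := by exact_mod_cast j.2.1.2.le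
      have h6 : ‖(2 * Real.pi * Complex.I : ℂ)‖ = 2 * Real.pi := by
        simp [abs_of_pos Real.pi_pos]
      rw [norm_mul, h6]
      calc 2 * Real.pi * ‖(weight p q j : ℂ) / q * z + (j.2.1 : ℕ) * δ * φ z‖
          ≤ 2 * Real.pi * (U * ‖z‖ + L * |δ| * ‖φ z‖) := by
            gcongr
            refine h4.trans ?_
            gcongr
            exact hU j
        _ ≤ _ := by linarith
    have h7 := (Complex.norm_exp_le_exp_norm _).trans (Real.exp_le_exp.mpr h3)
    rw [Real.exp_add, Real.exp_add, Real.exp_add]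
    have h8 := ht j
    gcongr
  calc _ ≤ ∑ _j : Fin (h * M) × Fin L × Fin L,
        Real.exp (H + M * (‖z‖ + 1 + h) + V * T + (2 * Real.pi * U * ‖z‖ + 1)) :=
        norm_sum_le_of_le _ fun j _ => hterm j
    _ = ((h * M * (L * L) : ℕ) : ℝ) *
        Real.exp (H + M * (‖z‖ + 1 + h) + V * T + (2 * Real.pi * U * ‖z‖ + 1)) := by
        simp
    _ ≤ Real.exp K * Real.exp (H + M * (‖z‖ + 1 + h) + V * T + (2 * Real.pi * U * ‖z‖ + 1)) := by
        gcongr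
    _ = _ := by
        rw [← Real.exp_add]
        ring_nf

open Asymptotics Topology in
theorem auxSum_eq_zero_of_lt {θ δ : ℝ} {D : ℕ} {c : ℝ}
    (hLiou : ∀ (ι : Type) [Fintype ι] (g : ι → ℤ) (e : ι → ℕ) (m : ℕ) (A : ℝ),
      (∀ i, e i ≤ m) → ∑ i, |(g i : ℝ)| ≤ A → 1 ≤ A →
      ∑ i, (g i : ℂ) * Complex.exp (2 * Real.pi * Complex.I * θ) ^ e i ≠ 0 →
      1 ≤ Real.exp (c * m) * A ^ D *
        ‖∑ i, (g i : ℂ) * Complex.exp (2 * Real.pi * Complex.I * θ) ^ e i‖)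
    {h M L q ν : ℕ} {p : ℤ} {t : Fin (h * M) × Fin L × Fin L → ℤ}
    {H K V U W : ℝ} {φ : ℂ → ℂ} {a b T T' S S' s' : ℕ} (hh : 0 < h) (hq : 0 < q)
    (hδ : θ = p / q + δ)
    (hν0 : 0 < ν) (hν : ∀ i, 1 ≤ i → i ≤ h → i ∣ ν) (hW : (ν : ℝ) ≤ Real.exp W) (hW0 : 0 ≤ W)
    (hV0 : 0 ≤ V) (hV : ∀ j : Fin (h * M) × Fin L × Fin L, |(weight p q j : ℝ)| ≤ Real.exp V)
    (hU : ∀ j : Fin (h * M) × Fin L × Fin L, |(weight p q j : ℝ)| / q ≤ U)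
    (hH0 : 0 ≤ H) (ht : ∀ j, |(t j : ℝ)| ≤ Real.exp H)
    (hK0 : 0 ≤ K) (hK : ((h * M * (L * L) : ℕ) : ℝ) ≤ Real.exp K)
    (ha : a ≤ T) (hb : b ≤ T) (hφd : Differentiable ℂ φ)
    (hφs : ∀ (s : ℕ) z, φ (s + z) = s + φ z) (hφ0 : φ 0 = 0) (hφO : φ =O[𝓝 0] fun w => w ^ T')
    (hφ : ∀ z : ℂ, ‖z‖ = 4 * S' → 2 * Real.pi * L * |δ| * ‖φ z‖ ≤ 1) (hSS' : S ≤ S')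
    (hzero : ∀ a' b' s, a' + b' < T' → s < S → auxSum (stdPoly h) t p q
      (Complex.exp (2 * Real.pi * Complex.I * θ)) (a + a') (b + b') s = 0)
    (hlt : c * (L * S' : ℕ) + D * (K + H + W * T + M * (S' + 1 + h) + V * T) +
      (W * T + (K + H + M * (4 * S' + 1 + h) + V * T + (2 * Real.pi * U * (4 * S') + 1))) < T' * S)
    (hs' : s' < S') :
    auxSum (stdPoly h) t p q (Complex.exp (2 * Real.pi * Complex.I * θ)) a b s' = 0 := by
  set ζ := Complex.exp (2 * Real.pi * Complex.I * θ) with hζ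
  by_contra hne
  have hupper := norm_le_of_zeros (differentiable_auxFn (stdPoly h) t p q δ hφd a b)
    (T := T') (S := S) (S' := S') (fun s hs => auxFn_isBigO _ t p hq hδ hφs hφO
      hφd.continuous.continuousAt hφ0 a b s fun a' b' hab => hzero a' b' s hab hs) hSS'
    (B := Real.exp (K + H + M * (4 * S' + 1 + h) + V * T + (2 * Real.pi * U * (4 * S') + 1)))
    (fun z hz => by
      have := norm_auxFn_le (a := a) (T := T) hh hV0 hV hU ht hK hb (hφ z hz)
      rwa [hz] at this) hs'
  rw [auxFn_natCast _ t p hq hδ hφs hφ0, ← hζ, ← Real.exp_add] at hupper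
  choose m hm using fun k => exists_int_stdPoly hh hν k a s'
  have hsum : (ν : ℂ) ^ a * auxSum (stdPoly h) t p q ζ a b s' =
      ∑ j, ((t j * (m j.1 * weight p q j ^ b) : ℤ) : ℂ) * ζ ^ ((j.2.1 : ℕ) * s') := by
    rw [nu_pow_mul_auxSum t p q ζ a b s' hm]
    refine Finset.sum_congr rfl fun j _ => ?_
    push_cast
    ring
  have hνne : (ν : ℂ) ^ a ≠ 0 := pow_ne_zero _ (by exact_mod_cast hν0.ne')
  have hterm : ∀ j : Fin (h * M) × Fin L × Fin L,
      |((t j * (m j.1 * weight p q j ^ b) : ℤ) : ℝ)| ≤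
        Real.exp (H + (W * T + M * (S' + 1 + h)) + V * T) := by
    intro j
    have h1 := abs_int_stdPoly_le hh j.1.2 (hm j.1) hW
    push_cast
    rw [abs_mul, abs_mul, abs_pow, Real.exp_add, Real.exp_add, mul_assoc]
    have h2 : |(weight p q j : ℝ)| ^ b ≤ Real.exp (V * T) := by
      refine (pow_le_pow_left₀ (abs_nonneg _) (hV j) _).trans ?_
      rw [← Real.exp_nat_mul, mul_comm]
      gcongr
    have h3 : (a : ℝ) ≤ T := by exact_mod_cast ha
    have h4 : (s' : ℝ) ≤ S' := by exact_mod_cast hs'.le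
    have h5 : Real.exp (W * a + M * (s' + 1 + h)) ≤ Real.exp (W * T + M * (S' + 1 + h)) := by
      gcongr
    have h6 := ht j
    have h7 := h1.trans h5
    gcongr
  have hA : ∑ j : Fin (h * M) × Fin L × Fin L, |((t j * (m j.1 * weight p q j ^ b) : ℤ) : ℝ)| ≤
      Real.exp (K + H + W * T + M * (S' + 1 + h) + V * T) := by
    calc _ ≤ ∑ _j : Fin (h * M) × Fin L × Fin L,
          Real.exp (H + (W * T + M * (S' + 1 + h)) + V * T) := Finset.sum_le_sum fun j _ => hterm j
      _ = ((h * M * (L * L) : ℕ) : ℝ) * Real.exp (H + (W * T + M * (S' + 1 + h)) + V * T) := by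
          simp
      _ ≤ Real.exp K * Real.exp (H + (W * T + M * (S' + 1 + h)) + V * T) := by gcongr
      _ = _ := by
          rw [← Real.exp_add]
          ring_nf
  have hlow := hLiou _ (fun j : Fin (h * M) × Fin L × Fin L => t j * (m j.1 * weight p q j ^ b))
    (fun j => (j.2.1 : ℕ) * s') (L * S') _ (fun j => Nat.mul_le_mul j.2.1.2.le hs'.le) hA
    (Real.one_le_exp (by positivity)) (by rw [← hsum]; exact mul_ne_zero hνne hne)
  rw [← hsum, norm_mul, norm_pow, Complex.norm_natCast, ← Real.exp_nat_mul, ← Real.exp_add] at hlow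
  have hνa : (ν : ℝ) ^ a ≤ Real.exp (W * T) := by
    refine (pow_le_pow_left₀ (by positivity) hW _).trans ?_
    rw [← Real.exp_nat_mul, mul_comm]
    gcongr
  have hfinal : (1 : ℝ) ≤ Real.exp (c * (L * S' : ℕ) +
      D * (K + H + W * T + M * (S' + 1 + h) + V * T)) * (Real.exp (W * T) *
      Real.exp (K + H + M * (4 * S' + 1 + h) + V * T + (2 * Real.pi * U * (4 * S') + 1) +
        -(T' * S))) := hlow.trans (by gcongr)
  rw [← Real.exp_add, ← Real.exp_add, Real.one_le_exp_iff] at hfinal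
  linarith

theorem lcmUpto_le_exp (X : ℕ) : (Nat.lcmUpto X : ℝ) ≤ Real.exp (6 * X) := by
  have h1 := Chebyshev.psi_le_const_mul_self (Nat.cast_nonneg (α := ℝ) X)
  rw [Chebyshev.psi_eq_log_lcmUpto] at h1
  have h2 : Real.log 4 = 2 * Real.log 2 := by
    rw [show (4 : ℝ) = 2 ^ 2 by norm_num, Real.log_pow]
    norm_num
  rw [← Real.log_le_iff_le_exp (by exact_mod_cast Nat.lcmUpto_pos X)]
  refine h1.trans ?_
  have := Real.log_two_lt_d9
  gcongr
  linarith

theorem injective_exp_pow {θ : ℝ} (hθ : Irrational θ) :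
    Function.Injective fun i : ℕ => Complex.exp (2 * Real.pi * Complex.I * θ) ^ i := by
  intro i j hij
  beta_reduce at hij
  rw [← Complex.exp_nat_mul, ← Complex.exp_nat_mul, Complex.exp_eq_exp_iff_exists_int] at hij
  obtain ⟨n, hn⟩ := hij
  by_contra hne
  have hne' : ((i : ℝ) - j) ≠ 0 := sub_ne_zero.mpr (by exact_mod_cast hne)
  have h1 : (2 * Real.pi * Complex.I : ℂ) * ((i - j) * θ - n) = 0 := by linear_combination hn
  have h2 : ((i - j) * θ - n : ℂ) = 0 :=
    (mul_eq_zero.mp h1).resolve_left Complex.two_pi_I_ne_zero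
  have h3 : ((i : ℝ) - j) * θ - n = 0 := by exact_mod_cast h2
  refine hθ ⟨(n : ℚ) / ((i : ℚ) - j), ?_⟩
  push_cast
  rw [div_eq_iff hne']
  linarith

theorem siegel_parameter_le {D g Y x c : ℝ} (hD : 1 ≤ D) (hg : 1 ≤ g) (hx : 1 ≤ x)
    (hY : 216 * D * g ^ 2 ≤ Y) (hYc : c * g ≤ Y) :
    2 * x + (6 * x * (6 * Y ^ 3) + 72 * D * g * Y ^ 2 * (g * x + 1 + x) + 2 * x * (6 * Y ^ 3)) +
      c * (Y ^ 2 * (g * x)) ≤ 52 * x * Y ^ 3 := by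
  have hY1 : 1 ≤ Y := by nlinarith [one_le_mul_of_one_le_of_one_le hD (one_le_pow₀ hg (n := 2))]
  have h0 : 0 ≤ x * Y ^ 2 := by positivity
  have h1 : 2 * x ≤ 2 * x * Y ^ 3 := le_mul_of_one_le_right (by linarith) (one_le_pow₀ hY1)
  have h2 : 72 * D * g * Y ^ 2 * (g * x + 1 + x) ≤ 72 * D * g * Y ^ 2 * (3 * (g * x)) := by
    gcongr
    nlinarith
  have h3 := mul_le_mul_of_nonneg_left hY h0
  have h4 := mul_le_mul_of_nonneg_left hYc h0
  nlinarith

theorem step_parameter_lt {D E g C κ x S c u : ℝ} (hD : 1 ≤ D) (hE : 0 ≤ E) (hg : 1030 ≤ g)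
    (hgE : 1020 * E ≤ g) (hx : 1 ≤ x) (hκ : 1 ≤ κ) (hS : g * x ≤ S) (hC : 1 ≤ C)
    (hCc : 10 * c ≤ C) (hCE : 2160 * D * g * E ≤ C) (hCD : 4320 * D * g ≤ C)
    (hCu : 10 * (8 * Real.pi * u) ≤ C) :
    c * ((C * κ) ^ 2 * (κ * S)) + E * (2 * x + 52 * x * (C * κ) ^ 3 + 6 * x * (6 * (C * κ) ^ 3) +
      72 * D * g * (C * κ) ^ 2 * (κ * S + 1 + x) + 2 * x * (6 * (C * κ) ^ 3)) +
      (6 * x * (6 * (C * κ) ^ 3) + (2 * x + 52 * x * (C * κ) ^ 3 +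
        72 * D * g * (C * κ) ^ 2 * (4 * (κ * S) + 1 + x) + 2 * x * (6 * (C * κ) ^ 3) +
        (2 * Real.pi * ((C * κ) ^ 2 * u) * (4 * (κ * S)) + 1))) < (C * κ) ^ 3 * S := by
  set Y := C * κ with hY
  have hY1 : 1 ≤ Y := one_le_mul_of_one_le_of_one_le hC hκ
  have hxS : x ≤ S := by nlinarith
  have hSS' : S ≤ κ * S := le_mul_of_one_le_left (by linarith) hκ
  have hY3 : 1 ≤ Y ^ 3 := one_le_pow₀ hY1
  have hA0 : 0 ≤ Y ^ 2 * (κ * S) := by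
    have : 0 ≤ κ * S := by linarith
    positivity
  have hCA : C * (Y ^ 2 * (κ * S)) = Y ^ 3 * S := by rw [hY]; ring
  have hG0 : 1 ≤ x * Y ^ 3 := one_le_mul_of_one_le_of_one_le hx hY3
  have hgG : g * (x * Y ^ 3) ≤ Y ^ 3 * S := by
    have := mul_le_mul_of_nonneg_left hS (by linarith : 0 ≤ Y ^ 3)
    linarith
  have hx3 : x ≤ x * Y ^ 3 := le_mul_of_one_le_right (by linarith) hY3
  have hM1 : 72 * D * g * Y ^ 2 * (κ * S + 1 + x) ≤ 72 * D * g * Y ^ 2 * (3 * (κ * S)) := by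
    gcongr
    linarith
  have hM2 : 72 * D * g * Y ^ 2 * (4 * (κ * S) + 1 + x) ≤ 72 * D * g * Y ^ 2 * (6 * (κ * S)) := by
    gcongr
    linarith
  have e1 := mul_le_mul_of_nonneg_right hCc hA0
  have e2 := mul_le_mul_of_nonneg_right hCE hA0
  have e3 := mul_le_mul_of_nonneg_right hCD hA0
  have e4 := mul_le_mul_of_nonneg_right hCu hA0
  have e5 := mul_le_mul_of_nonneg_right hg (by linarith : 0 ≤ x * Y ^ 3)
  have e6 := mul_le_mul_of_nonneg_right hgE (by linarith : 0 ≤ x * Y ^ 3)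
  rw [hCA] at e1 e2 e3 e4
  have f1 : E * (2 * x + 52 * x * Y ^ 3 + 6 * x * (6 * Y ^ 3) +
      72 * D * g * Y ^ 2 * (κ * S + 1 + x) + 2 * x * (6 * Y ^ 3)) ≤
      E * (102 * (x * Y ^ 3) + 72 * D * g * Y ^ 2 * (3 * (κ * S))) :=
    mul_le_mul_of_nonneg_left (by linarith) hE
  have f2 : c * (Y ^ 2 * (κ * S)) ≤ Y ^ 3 * S / 10 := by linarith
  have f3 : E * (102 * (x * Y ^ 3) + 72 * D * g * Y ^ 2 * (3 * (κ * S))) ≤ Y ^ 3 * S / 5 := by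
    linarith
  have f4 : 72 * D * g * Y ^ 2 * (6 * (κ * S)) ≤ Y ^ 3 * S / 10 := by linarith
  have f5 : 2 * Real.pi * (Y ^ 2 * u) * (4 * (κ * S)) ≤ Y ^ 3 * S / 10 := by linarith
  have f6 : 103 * (x * Y ^ 3) ≤ Y ^ 3 * S / 10 := by linarith
  linarith

theorem dvd_lcmUpto {i n : ℕ} (h1 : 1 ≤ i) (hn : i ≤ n) : i ∣ Nat.lcmUpto n :=
  Finset.dvd_lcm (f := id) (Finset.mem_Icc.mpr ⟨h1, hn⟩)

/-- The induction at the heart of Baker's method: once the growth parameters `g`, `C`, `κ`, `X`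
are large enough, there is no good approximation. -/
theorem false_of_good_approximation {θ : ℝ} (hirr : Irrational θ)
    {D E : ℕ} {c₁ c₂ : ℝ} (hD : 0 < D)
    (hSieg : ∀ (ι κ : Type) [Fintype ι] [Fintype κ] (a : ι → κ → ℤ) (e : ι → κ → ℕ) (m : ℕ) (A : ℝ),
      0 < Fintype.card ι → Fintype.card κ = 2 * (D * Fintype.card ι) →
      (∀ i j, e i j ≤ m) → (∀ i j, |(a i j : ℝ)| ≤ A) → 1 ≤ A →
      ∃ t : κ → ℤ, t ≠ 0 ∧ (∀ i, ∑ j, (t j : ℂ) *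
        (a i j * Complex.exp (2 * Real.pi * Complex.I * θ) ^ e i j) = 0) ∧
        ∀ j, |(t j : ℝ)| ≤ Fintype.card κ * (A * Real.exp (c₁ * m)))
    (hLiou : ∀ (ι : Type) [Fintype ι] (g : ι → ℤ) (e : ι → ℕ) (m : ℕ) (A : ℝ),
      (∀ i, e i ≤ m) → ∑ i, |(g i : ℝ)| ≤ A → 1 ≤ A →
      ∑ i, (g i : ℂ) * Complex.exp (2 * Real.pi * Complex.I * θ) ^ e i ≠ 0 →
      1 ≤ Real.exp (c₂ * m) * A ^ E *
        ‖∑ i, (g i : ℂ) * Complex.exp (2 * Real.pi * Complex.I * θ) ^ e i‖)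
    {g C κ : ℕ} {Cφ : ℝ} {φ : ℂ → ℂ} (hκ : κ = 72 * D * C ^ 4) (hg : 1030 ≤ g)
    (hgE : 1020 * E ≤ g) (hC : 1 ≤ C) (hCg : 216 * D * g ^ 2 ≤ C) (hCc₁ : c₁ * g ≤ C)
    (hCc₂ : 10 * c₂ ≤ C) (hCE : 2160 * D * g * E ≤ C) (hCD : 4320 * D * g ≤ C)
    (hCu : 10 * (8 * Real.pi * (|θ| + 2)) ≤ C)
    (hCφ : 0 ≤ Cφ) (hφd : Differentiable ℂ φ)
    (hφs : ∀ (s : ℕ) z, φ (s + z) = s + φ z) (hφ0 : φ 0 = 0)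
    (hφO : φ =O[nhds 0] fun w => w ^ ((C * κ) ^ 3))
    (hφ : ∀ z, ‖φ z‖ ≤ Cφ * Real.exp (Cφ * ‖z‖))
    {X q : ℕ} {p : ℤ} (hX1 : 1 ≤ X) (hq : 0 < q) (hqX : (q : ℝ) ≤ Real.exp X)
    (hXK : ((72 * D * g * (C * κ) ^ 2 * ((C * κ) ^ 2 * (C * κ) ^ 2) : ℕ) : ℝ) ≤ X)
    (hXV : (C * κ) ^ 2 * (|θ| + 2) ≤ X)
    (hδ1 : |θ - p / q| ≤ 1)
    (hδ : |θ - p / q| ≤ Real.exp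
      (-((2 * Real.pi * (C * κ) ^ 2 * Cφ + 4 * Cφ * (g * κ ^ 5)) * X))) : False := by
  set ζ := Complex.exp (2 * Real.pi * Complex.I * θ) with hζ
  set δ := θ - p / q with hδdef
  set Y := C * κ with hY
  set M := 72 * D * g * Y ^ 2 with hM
  have hκ1 : 1 ≤ κ := by rw [hκ]; exact Nat.mul_pos (by positivity) (by positivity)
  have hCY : C ≤ Y := Nat.le_mul_of_pos_right _ hκ1
  have hY1 : 1 ≤ Y := hC.trans hCY
  have hq0 : (0 : ℝ) < q := by exact_mod_cast hq
  have hpq : |(p : ℝ)| ≤ (|θ| + 1) * q := by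
    have h1 : (p : ℝ) = (θ - δ) * q := by rw [hδdef]; field_simp; ring
    rw [h1, abs_mul, abs_of_pos hq0]
    gcongr
    exact (abs_sub _ _).trans (by linarith)
  have hw : ∀ j : Fin (X * M) × Fin (Y ^ 2) × Fin (Y ^ 2),
      |(weight p q j : ℝ)| ≤ Y ^ 2 * (|θ| + 2) * q := by
    intro j
    have h1 : ((j.2.1 : ℕ) : ℝ) ≤ (Y : ℝ) ^ 2 := by exact_mod_cast j.2.1.2.le
    have h2 : ((j.2.2 : ℕ) : ℝ) ≤ (Y : ℝ) ^ 2 := by exact_mod_cast j.2.2.2.le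
    rw [weight]
    push_cast
    refine (abs_add_le _ _).trans ?_
    rw [abs_mul, abs_mul, abs_of_pos hq0, Nat.abs_cast, Nat.abs_cast]
    calc ((j.2.1 : ℕ) : ℝ) * |(p : ℝ)| + (j.2.2 : ℕ) * q
        ≤ (Y : ℝ) ^ 2 * ((|θ| + 1) * q) + Y ^ 2 * q := by gcongr
      _ = _ := by ring
  have hx1 : (1 : ℝ) ≤ X := by exact_mod_cast hX1
  have hxexp : (X : ℝ) ≤ Real.exp X := by linarith [Real.add_one_le_exp (X : ℝ)]
  have hV : ∀ j : Fin (X * M) × Fin (Y ^ 2) × Fin (Y ^ 2),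
      |(weight p q j : ℝ)| ≤ Real.exp (2 * X) := by
    intro j
    refine (hw j).trans ?_
    rw [two_mul, Real.exp_add]
    refine mul_le_mul ?_ hqX hq0.le (Real.exp_pos _).le
    refine le_trans ?_ (hXV.trans hxexp)
    rw [hY]
    push_cast
    exact le_rfl
  have hU : ∀ j : Fin (X * M) × Fin (Y ^ 2) × Fin (Y ^ 2),
      |(weight p q j : ℝ)| / q ≤ Y ^ 2 * (|θ| + 2) := fun j => (div_le_iff₀ hq0).mpr (hw j)
  have hK : ((X * M * (Y ^ 2 * Y ^ 2) : ℕ) : ℝ) ≤ Real.exp (2 * X) := by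
    rw [two_mul, Real.exp_add, mul_assoc, Nat.cast_mul]
    exact mul_le_mul hxexp (hXK.trans hxexp) (by positivity) (by positivity)
  have hYr : (C : ℝ) ≤ Y := by exact_mod_cast hCY
  have hgr : (1 : ℝ) ≤ g := by exact_mod_cast (by omega : 1 ≤ g)
  have hDr : (1 : ℝ) ≤ D := by exact_mod_cast hD
  have hCgr : 216 * (D : ℝ) * g ^ 2 ≤ C := by exact_mod_cast hCg
  have hS0 : 0 < g * X := by positivity
  obtain ⟨t, ht0, ht, htb⟩ := exists_auxSum_eq_zero (p := p) (q := q) (h := X) (M := M) (L := Y ^ 2)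
    (T := 6 * Y ^ 3) (S := g * X) (ν := Nat.lcmUpto X) (W := 6 * X) (V := 2 * X) hSieg
    hX1 (by positivity) hS0 (Nat.lcmUpto_pos X) (fun i => dvd_lcmUpto) (lcmUpto_le_exp X)
    (by positivity) (by positivity) hV (by rw [hM]; ring)
  have htb' : ∀ j, |(t j : ℝ)| ≤ Real.exp (52 * X * Y ^ 3) := by
    intro j
    refine (htb j).trans ?_
    calc _ ≤ Real.exp (2 * X) * (Real.exp (6 * X * (6 * Y ^ 3 : ℕ) +
          M * ((g * X : ℕ) + 1 + X) + 2 * X * (6 * Y ^ 3 : ℕ)) *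
          Real.exp (c₁ * (Y ^ 2 * (g * X) : ℕ))) := by gcongr
      _ ≤ _ := by
        rw [← Real.exp_add, ← Real.exp_add, Real.exp_le_exp, hM]
        have := siegel_parameter_le hDr hgr hx1 (hCgr.trans hYr) (hCc₁.trans hYr)
        push_cast
        linarith
  have hind : ∀ i ≤ 5, ∀ a b s, a + b < (6 - i) * Y ^ 3 → s < g * κ ^ i * X →
      auxSum (stdPoly X) t p q ζ a b s = 0 := by
    intro i
    induction i with
    | zero =>
      intro _ a b s hab hs
      exact ht a b s (by omega) (by omega) (by simpa using hs)
    | succ i ih =>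
      intro hi a b s hab hs
      have ih := ih (by omega)
      have hsplit : (6 - i) * Y ^ 3 = (6 - (i + 1)) * Y ^ 3 + Y ^ 3 := by
        rw [show 6 - i = 6 - (i + 1) + 1 by omega, add_one_mul]
      have hle6 : (6 - (i + 1)) * Y ^ 3 ≤ 6 * Y ^ 3 := Nat.mul_le_mul_right _ (by omega)
      have hSeq : g * κ ^ (i + 1) * X = κ * (g * κ ^ i * X) := by ring
      have hκS : g * κ ^ i * X ≤ κ * (g * κ ^ i * X) := Nat.le_mul_of_pos_left _ hκ1
      refine auxSum_eq_zero_of_lt (T := 6 * Y ^ 3) (T' := Y ^ 3) (S := g * κ ^ i * X)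
        (S' := κ * (g * κ ^ i * X)) (ν := Nat.lcmUpto X) (W := 6 * X) (V := 2 * X)
        (K := 2 * X) (H := 52 * X * Y ^ 3) (U := Y ^ 2 * (|θ| + 2)) (δ := δ) (φ := φ) (θ := θ)
        hLiou hX1 hq (by rw [hδdef]; ring)
        (Nat.lcmUpto_pos X) (fun i => dvd_lcmUpto) (lcmUpto_le_exp X)
        (by positivity) (by positivity) hV hU (by positivity) htb' (by positivity) hK
        (by omega) (by omega) hφd hφs hφ0 hφO (fun z hz => ?_) hκS
        (fun a' b' s hab' hs' => ih _ _ s (by omega) hs') ?_ (by rwa [← hSeq])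
      · have hS5 : ((κ * (g * κ ^ i * X) : ℕ) : ℝ) ≤ g * κ ^ 5 * X := by
          rw [← hSeq]
          have : g * κ ^ (i + 1) * X ≤ g * κ ^ 5 * X := by gcongr
          exact_mod_cast this
        have h1 : ‖φ z‖ ≤ Cφ * Real.exp (4 * Cφ * (g * κ ^ 5) * X) := by
          refine (hφ z).trans ?_
          rw [hz]
          refine mul_le_mul_of_nonneg_left (Real.exp_le_exp.mpr ?_) hCφ
          have := mul_le_mul_of_nonneg_left hS5 hCφ
          linarith
        have h2 : 2 * Real.pi * (Y : ℝ) ^ 2 * Cφ ≤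
            Real.exp (2 * Real.pi * (Y : ℝ) ^ 2 * Cφ * X) := by
          have h3 : 0 ≤ 2 * Real.pi * (Y : ℝ) ^ 2 * Cφ := by positivity
          refine le_trans ?_ (Real.add_one_le_exp _)
          nlinarith
        have h4 : |δ| ≤ Real.exp
            (-((2 * Real.pi * (Y : ℝ) ^ 2 * Cφ + 4 * Cφ * (g * κ ^ 5)) * X)) := by
          rw [hY]
          push_cast
          exact hδ
        calc 2 * Real.pi * (Y ^ 2 : ℕ) * |δ| * ‖φ z‖
            ≤ 2 * Real.pi * (Y ^ 2 : ℕ) * Real.exp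
              (-((2 * Real.pi * (Y : ℝ) ^ 2 * Cφ + 4 * Cφ * (g * κ ^ 5)) * X)) *
              (Cφ * Real.exp (4 * Cφ * (g * κ ^ 5) * X)) := by gcongr
          _ = 2 * Real.pi * (Y : ℝ) ^ 2 * Cφ * (Real.exp
              (-((2 * Real.pi * (Y : ℝ) ^ 2 * Cφ + 4 * Cφ * (g * κ ^ 5)) * X)) *
              Real.exp (4 * Cφ * (g * κ ^ 5) * X)) := by push_cast; ring
          _ ≤ Real.exp (2 * Real.pi * (Y : ℝ) ^ 2 * Cφ * X) * (Real.exp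
              (-((2 * Real.pi * (Y : ℝ) ^ 2 * Cφ + 4 * Cφ * (g * κ ^ 5)) * X)) *
              Real.exp (4 * Cφ * (g * κ ^ 5) * X)) := by gcongr
          _ = 1 := by
              rw [← Real.exp_add, ← Real.exp_add, Real.exp_eq_one_iff]
              ring
      · have hgS : (g : ℝ) * X ≤ (g * κ ^ i * X : ℕ) := by
          have : g * X ≤ g * κ ^ i * X := by
            rw [mul_right_comm]
            exact Nat.le_mul_of_pos_right _ (by positivity)
          exact_mod_cast this
        have := step_parameter_lt (S := (g * κ ^ i * X : ℕ)) hDr (Nat.cast_nonneg E)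
          (by exact_mod_cast hg) (by exact_mod_cast hgE) hx1 (κ := κ) (by exact_mod_cast hκ1) hgS
          (C := C) (by exact_mod_cast hC) hCc₂ (by exact_mod_cast hCE) (by exact_mod_cast hCD) hCu
        rw [hM, hY]
        push_cast at this ⊢
        linarith
  refine ht0 (eq_zero_of_auxSum (degree_stdPoly X) hq (Complex.exp_ne_zero _)
    (injective_exp_pow hirr) fun b hb s hs => hind 5 le_rfl 0 b s ?_ ?_)
  · have : Y ^ 2 ≤ Y ^ 3 := Nat.pow_le_pow_right hY1 (by norm_num)
    omega
  · have : Y ^ 2 * (X * M) = g * κ ^ 5 * X := by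
      calc Y ^ 2 * (X * M) = g * κ ^ 4 * (72 * D * C ^ 4) * X := by rw [hM, hY]; ring
        _ = g * κ ^ 4 * κ * X := congrArg (fun k => g * κ ^ 4 * k * X) hκ.symm
        _ = g * κ ^ 5 * X := by ring
    omega

theorem exists_diophantine_bound {θ : ℝ} (hirr : Irrational θ)
    (halg : IsAlgebraic ℚ (Complex.exp (2 * Real.pi * Complex.I * θ))) :
    ∃ Z : ℝ, 0 ≤ Z ∧ ∃ X₀ : ℕ, ∀ (X q : ℕ) (p : ℤ), X₀ ≤ X → 0 < q → (q : ℝ) ≤ Real.exp X →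
      Real.exp (-(Z * X)) < |θ - p / q| := by
  obtain ⟨D, hD, c₁, hc₁, hSieg⟩ := exists_siegel_bound halg
  obtain ⟨E, c₂, hc₂, hLiou⟩ := exists_liouville_bound halg
  let g := 1030 * (E + 1)
  obtain ⟨n, hn⟩ := exists_nat_ge (c₁ * g + 10 * c₂ + 10 * (8 * Real.pi * (|θ| + 2)))
  let C := n + 1 + 216 * D * g ^ 2 + 2160 * D * g * E + 4320 * D * g
  let κ := 72 * D * C ^ 4
  obtain ⟨φ, Cφ, hCφ, hφd, hφs, hφ0, hφO, hφ⟩ := exists_staircase ((C * κ) ^ 3)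
  obtain ⟨X₁, hX₁⟩ := exists_nat_ge (((C : ℝ) * κ) ^ 2 * (|θ| + 2))
  have hnC : (n : ℝ) ≤ C := by
    have : n ≤ C := by simp only [C]; omega
    exact_mod_cast this
  have h1 : 0 ≤ c₁ * g := by positivity
  have h2 : 0 ≤ 10 * (8 * Real.pi * (|θ| + 2)) := by positivity
  refine ⟨2 * Real.pi * (C * κ) ^ 2 * Cφ + 4 * Cφ * (g * κ ^ 5), by positivity,
    X₁ + 1 + 72 * D * g * (C * κ) ^ 2 * ((C * κ) ^ 2 * (C * κ) ^ 2), fun X q p hX hq hqX => ?_⟩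
  by_contra! hle
  refine false_of_good_approximation hirr (D := D) (E := E) (g := g) (C := C) (κ := κ) hD hSieg
    hLiou rfl (by simp only [g]; omega) (by simp only [g]; omega) (by simp only [C]; omega)
    (by simp only [C]; omega) (by linarith) (by linarith)
    (by
      have : 2160 * D * g * E ≤ C := by simp only [C]; omega
      exact_mod_cast this)
    (by
      have : 4320 * D * g ≤ C := by simp only [C]; omega
      exact_mod_cast this) (by linarith) hCφ hφd hφs hφ0 hφO hφ (X := X) (q := q) (p := p)
      (by omega) hq hqX (by exact_mod_cast (by omega)) (hX₁.trans (by exact_mod_cast (by omega)))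
      (hle.trans (by rw [Real.exp_le_one_iff, neg_nonpos]; positivity)) hle

/-- An irrational `θ` with `exp (2 * π * I * θ)` algebraic is Diophantine. -/
theorem diophantine_of_isAlgebraic_exp {θ : ℝ} (hirr : Irrational θ)
    (halg : IsAlgebraic ℚ (Complex.exp (2 * Real.pi * Complex.I * θ))) :
    ∃ c : ℝ, 0 < c ∧ ∃ τ : ℝ, ∀ (p : ℤ) (q : ℕ), 0 < q →
      |θ - (p : ℝ) / (q : ℝ)| ≥ c / (q : ℝ) ^ τ := by
  obtain ⟨Z, hZ, X₀, h⟩ := exists_diophantine_bound hirr halg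
  obtain ⟨N, hN⟩ := exists_nat_ge (Real.exp X₀)
  have hN0 : (0 : ℝ) < N := (Real.exp_pos _).trans_le hN
  refine ⟨Real.exp (-Z) / (N : ℝ) ^ Z, by positivity, Z, fun p q hq => ?_⟩
  have hq0 : (0 : ℝ) < q := by exact_mod_cast hq
  have hq1 : (1 : ℝ) ≤ q := by exact_mod_cast hq
  have hlog : (X₀ : ℝ) ≤ Real.log (q * N) := by
    rw [Real.le_log_iff_exp_le (by positivity)]
    nlinarith
  have hX := h ⌈Real.log (q * N)⌉₊ (q * N) (p * N) (by exact_mod_cast hlog.trans (Nat.le_ceil _))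
    (Nat.mul_pos hq (by exact_mod_cast hN0)) (by
      push_cast
      rw [← Real.log_le_iff_le_exp (by positivity)]
      exact Nat.le_ceil _)
  have e : ((p * N : ℤ) : ℝ) / ((q * N : ℕ) : ℝ) = p / q := by
    push_cast
    rw [mul_div_mul_right _ _ hN0.ne']
  rw [e] at hX
  refine le_trans ?_ hX.le
  rw [div_div, ← Real.mul_rpow hN0.le hq0.le, mul_comm (N : ℝ),
    Real.rpow_def_of_pos (by positivity), ← Real.exp_sub, Real.exp_le_exp]
  have := (Nat.ceil_lt_add_one (a := Real.log (q * N)) ((Nat.cast_nonneg X₀).trans hlog)).le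
  nlinarith

open Polynomial in
/-- The integer polynomial whose values at `exp (2 * I * y)` detect `n tan y = tan (ny)`. -/
noncomputable def tanPoly (n : ℕ) : ℤ[X] :=
  C (n : ℤ) * (X - 1) * (X ^ n + 1) - (X + 1) * (X ^ n - 1)

theorem aeval_tanPoly (n : ℕ) (z : ℂ) :
    Polynomial.aeval z (tanPoly n) = n * (z - 1) * (z ^ n + 1) - (z + 1) * (z ^ n - 1) := by
  simp [tanPoly]

theorem tanPoly_ne_zero {n : ℕ} (hn : 2 ≤ n) : tanPoly n ≠ 0 := by
  intro h
  have h0 := congrArg (Polynomial.eval 0) h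
  have : n ≠ 0 := by omega
  simp [tanPoly, this] at h0
  omega

theorem aeval_tanPoly_exp_eq_zero_iff (n : ℕ) (y : ℝ) :
    Polynomial.aeval (Complex.exp (2 * y * Complex.I)) (tanPoly n) = 0 ↔
      n * Real.sin y * Real.cos (n * y) = Real.cos y * Real.sin (n * y) := by
  have key : ∀ x : ℝ, Complex.exp (2 * x * Complex.I) - 1 =
        Complex.exp (x * Complex.I) * (2 * Complex.I * Real.sin x) ∧
      Complex.exp (2 * x * Complex.I) + 1 =
        Complex.exp (x * Complex.I) * (2 * Real.cos x) := by
    intro x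
    have h1 : Complex.exp (2 * x * Complex.I) = Complex.exp (x * Complex.I) ^ 2 := by
      rw [← Complex.exp_nat_mul]
      congr 1
      push_cast
      ring
    have h2 := Complex.sin_sq_add_cos_sq (x : ℂ)
    rw [h1, Complex.exp_mul_I, Complex.ofReal_sin, Complex.ofReal_cos]
    constructor
    · linear_combination h2 - Complex.sin x ^ 2 * Complex.I_sq
    · linear_combination -h2 + Complex.sin x ^ 2 * Complex.I_sq
  have hpow : Complex.exp (2 * y * Complex.I) ^ n =
      Complex.exp (2 * ((n * y : ℝ) : ℂ) * Complex.I) := by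
    rw [← Complex.exp_nat_mul]
    congr 1
    push_cast
    ring
  have e : Polynomial.aeval (Complex.exp (2 * y * Complex.I)) (tanPoly n) =
      Complex.exp (y * Complex.I) * Complex.exp ((n * y : ℝ) * Complex.I) * (4 * Complex.I) *
        ((n * Real.sin y * Real.cos (n * y) - Real.cos y * Real.sin (n * y) : ℝ) : ℂ) := by
    rw [aeval_tanPoly, hpow, (key y).1, (key y).2, (key (n * y)).1, (key (n * y)).2]
    push_cast
    ring
  rw [e]
  simp [Complex.exp_ne_zero, sub_eq_zero, -Complex.ofReal_sub, -Complex.ofReal_mul,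
    -Complex.ofReal_sin, -Complex.ofReal_cos]

theorem sin_le_sin_of_le_of_le_pi_sub {a b : ℝ} (hb : 0 ≤ b) (hab : b ≤ a)
    (ha : a ≤ Real.pi - b) : Real.sin b ≤ Real.sin a := by
  have h1 : 0 ≤ Real.sin ((a - b) / 2) :=
    Real.sin_nonneg_of_nonneg_of_le_pi (by linarith) (by linarith)
  have h2 : 0 ≤ Real.cos ((a + b) / 2) :=
    Real.cos_nonneg_of_neg_pi_div_two_le_of_le (by linarith) (by linarith)
  have := Real.sin_sub_sin a b
  nlinarith [mul_nonneg h1 h2]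

/-- Among the nonzero values `|sin (kπ/L)|`, the smallest is `sin (π/L)`. -/
theorem sin_pi_div_le_abs_sin {L : ℕ} (hL : 0 < L) (k : ℤ)
    (hk : Real.sin (k * (Real.pi / L)) ≠ 0) :
    Real.sin (Real.pi / L) ≤ |Real.sin (k * (Real.pi / L))| := by
  have hL0 : (0 : ℝ) < L := by exact_mod_cast hL
  have hLz : (0 : ℤ) < L := by exact_mod_cast hL
  have hpos : 0 < Real.pi / L := by positivity
  have hLpi : L * (Real.pi / L) = Real.pi := by field_simp
  have hkr : (k : ℝ) * (Real.pi / L) = (k % L : ℤ) * (Real.pi / L) + (k / L : ℤ) * Real.pi := by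
    have : (k : ℝ) = (k % L : ℤ) + L * (k / L : ℤ) := by
      exact_mod_cast (Int.emod_add_mul_ediv k L).symm
    rw [this]
    linear_combination ((k / L : ℤ) : ℝ) * hLpi
  have habs : |Real.sin (k * (Real.pi / L))| = |Real.sin ((k % L : ℤ) * (Real.pi / L))| := by
    rw [hkr, Real.sin_add_int_mul_pi, abs_mul, abs_zpow, abs_neg, abs_one, one_zpow, one_mul]
  have hr0 : k % L ≠ 0 := by
    intro h
    rw [← abs_ne_zero, habs, h] at hk
    simp at hk
  have hr1 : (1 : ℝ) ≤ (k % L : ℤ) := by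
    have := Int.emod_nonneg k hLz.ne'
    exact_mod_cast (by omega : 1 ≤ k % L)
  have hr2 : ((k % L : ℤ) : ℝ) + 1 ≤ L := by
    have := Int.emod_lt_of_pos k hLz
    exact_mod_cast (by omega : k % L + 1 ≤ L)
  rw [habs]
  refine le_trans (sin_le_sin_of_le_of_le_pi_sub hpos.le ?_ ?_) (le_abs_self _)
  · nlinarith
  · nlinarith

theorem abs_cos_le_cos_of_sin_le {a b : ℝ} (hb : 0 ≤ Real.sin b) (hb' : 0 ≤ Real.cos b)
    (h : Real.sin b ≤ |Real.sin a|) : |Real.cos a| ≤ Real.cos b := by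
  refine abs_le_of_sq_le_sq ?_ hb'
  have := pow_le_pow_left₀ hb h 2
  rw [sq_abs] at this
  linarith [Real.sin_sq_add_cos_sq a, Real.sin_sq_add_cos_sq b]

theorem pi_div_le_pi_div_three {M : ℕ} (hM : 3 ≤ M) : Real.pi / M ≤ Real.pi / 3 := by
  have : (3 : ℝ) ≤ M := by exact_mod_cast hM
  gcongr

theorem mul_cos_mul_sin_ne {n M : ℕ} (hn : 2 ≤ n) (hM : 3 ≤ M) :
    (n : ℝ) * Real.cos (Real.pi / M) * Real.sin (n * (Real.pi / M)) ≠
      Real.sin (Real.pi / M) * Real.cos (n * (Real.pi / M)) := by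
  intro h
  have hx3 := pi_div_le_pi_div_three hM
  have hx0 : 0 < Real.pi / M := by positivity
  have hn' : (2 : ℝ) ≤ n := by exact_mod_cast hn
  have hpi := Real.pi_pos
  have hs : 0 < Real.sin (Real.pi / M) := Real.sin_pos_of_pos_of_lt_pi hx0 (by linarith)
  have hc : 0 < Real.cos (Real.pi / M) := Real.cos_pos_of_mem_Ioo ⟨by linarith, by linarith⟩
  have hne : Real.sin (n * (Real.pi / M)) ≠ 0 := by
    intro h0
    rw [h0, mul_zero, eq_comm, mul_eq_zero, or_iff_right hs.ne'] at h
    have := Real.sin_sq_add_cos_sq (n * (Real.pi / M))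
    rw [h0, h] at this
    norm_num at this
  have h1 := sin_pi_div_le_abs_sin (L := M) (by omega) n (by exact_mod_cast hne)
  rw [Int.cast_natCast] at h1
  have h2 := abs_cos_le_cos_of_sin_le hs.le hc.le h1
  have h3 := congrArg abs h
  rw [abs_mul, abs_mul, abs_mul, Nat.abs_cast, abs_of_pos hs, abs_of_pos hc] at h3
  have h4 := mul_le_mul_of_nonneg_left h2 hs.le
  have h5 := mul_le_mul_of_nonneg_left h1 hc.le
  have h6 := mul_pos hc hs
  nlinarith

theorem mul_cos_mul_cos_ne {n M : ℕ} (hn : 4 ≤ n) (hM : 3 ≤ M) :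
    (n : ℝ) * Real.cos (Real.pi / M) * Real.cos (n * (Real.pi / M)) ≠
      -(Real.sin (Real.pi / M) * Real.sin (n * (Real.pi / M))) := by
  intro h
  have hx3 := pi_div_le_pi_div_three hM
  have hx0 : 0 < Real.pi / M := by positivity
  have hn' : (4 : ℝ) ≤ n := by exact_mod_cast hn
  have hpi := Real.pi_pos
  have hM0 : (M : ℝ) ≠ 0 := by
    have : M ≠ 0 := by omega
    exact_mod_cast this
  have hs : 0 < Real.sin (Real.pi / M) := Real.sin_pos_of_pos_of_lt_pi hx0 (by linarith)
  have hc : 1 / 2 ≤ Real.cos (Real.pi / M) := by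
    rw [← Real.cos_pi_div_three]
    exact Real.cos_le_cos_of_nonneg_of_le_pi hx0.le (by linarith) hx3
  have hhalf : Real.pi / (2 * M : ℕ) = Real.pi / M / 2 := by
    push_cast
    field_simp
  have hs' : 0 < Real.sin (Real.pi / M / 2) :=
    Real.sin_pos_of_pos_of_lt_pi (by linarith) (by linarith)
  have hc' : 0 < Real.cos (Real.pi / M / 2) :=
    Real.cos_pos_of_mem_Ioo ⟨by linarith, by linarith⟩
  have hdouble : Real.sin (Real.pi / M) =
      2 * Real.sin (Real.pi / M / 2) * Real.cos (Real.pi / M / 2) := by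
    rw [← Real.sin_two_mul]
    congr 1
    ring
  have hdouble' : Real.cos (Real.pi / M) = 2 * Real.cos (Real.pi / M / 2) ^ 2 - 1 := by
    rw [← Real.cos_two_mul]
    congr 1
    ring
  have hne : Real.cos (n * (Real.pi / M)) ≠ 0 := by
    intro h0
    rw [h0, mul_zero, eq_comm, neg_eq_zero, mul_eq_zero, or_iff_right hs.ne'] at h
    have := Real.sin_sq_add_cos_sq (n * (Real.pi / M))
    rw [h0, h] at this
    norm_num at this
  have harg : (((M : ℤ) - 2 * n : ℤ) : ℝ) * (Real.pi / (2 * M : ℕ)) =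
      Real.pi / 2 - n * (Real.pi / M) := by
    push_cast
    field_simp
  have h1 := sin_pi_div_le_abs_sin (L := 2 * M) (by omega) (M - 2 * n)
    (by rwa [harg, Real.sin_pi_div_two_sub])
  have h2 : |Real.cos (Real.pi / 2 - n * (Real.pi / M))| ≤ Real.cos (Real.pi / M / 2) :=
    abs_cos_le_cos_of_sin_le hs'.le hc'.le (by rwa [harg, hhalf] at h1)
  rw [harg, Real.sin_pi_div_two_sub, hhalf] at h1
  rw [Real.cos_pi_div_two_sub] at h2
  have h3 := congrArg abs h
  rw [abs_neg, abs_mul, abs_mul, abs_mul, Nat.abs_cast, abs_of_pos hs,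
    abs_of_pos (by linarith : 0 < Real.cos (Real.pi / M))] at h3
  have h4 := mul_le_mul_of_nonneg_left h2 hs.le
  have h5 := mul_le_mul_of_nonneg_left h1 (by positivity : (0 : ℝ) ≤ n * Real.cos (Real.pi / M))
  have h6 : n * Real.cos (Real.pi / M) * Real.sin (Real.pi / M / 2) ≤
      (1 + Real.cos (Real.pi / M)) * Real.sin (Real.pi / M / 2) := by
    rw [hdouble', add_sub_cancel]
    rw [hdouble] at h4 h3
    rw [hdouble'] at h5 h3
    nlinarith
  have h7 := le_of_mul_le_mul_right h6 hs'
  nlinarith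

/-- If the negative of a root of unity `u` is a root of `tanPoly n`, so are the negatives of the
conjugates of `u`. -/
theorem aeval_tanPoly_conj {n M : ℕ} {u : ℂ} (hM : 0 < M) (hu : IsPrimitiveRoot u M)
    (h : Polynomial.aeval (-u) (tanPoly n) = 0) :
    Polynomial.aeval (-Complex.exp (2 * Real.pi * Complex.I / M)) (tanPoly n) = 0 := by
  have hw := Complex.isPrimitiveRoot_exp M hM.ne'
  have : NeZero M := ⟨hM.ne'⟩
  obtain ⟨k, -, hk, hkw⟩ := hu.isPrimitiveRoot_iff.mp hw
  have haeval : ∀ v : ℂ, Polynomial.aeval v ((tanPoly n).comp (-Polynomial.X)) =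
      Polynomial.aeval (-v) (tanPoly n) := fun v => by simp [Polynomial.aeval_comp]
  rw [← haeval] at h ⊢
  have hdvd := minpoly.isIntegrallyClosed_dvd (hu.isIntegral hM) h
  rw [hu.minpoly_eq_pow_coprime hk, hkw] at hdvd
  exact Polynomial.aeval_eq_zero_of_dvd_aeval_eq_zero hdvd (minpoly.aeval _ _)

theorem irrational_of_mul_tan_eq_tan {n : ℕ} (hn : 2 ≤ n) {α : ℝ}
    (hα : α ∈ Set.Ioo 0 (Real.pi / 2))
    (heq : n * Real.sin α * Real.cos (n * α) = Real.cos α * Real.sin (n * α)) :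
    Irrational (α / (2 * Real.pi)) := by
  rintro ⟨r, hr⟩
  have hpi := Real.pi_pos
  have hs : 0 < Real.sin α := Real.sin_pos_of_pos_of_lt_pi hα.1 (by linarith [hα.2])
  have hc : 0 < Real.cos α := Real.cos_pos_of_mem_Ioo ⟨by linarith [hα.1], hα.2⟩
  set u : ℂ := -Complex.exp (2 * α * Complex.I) with hu
  have hu2 : u ^ 2 ≠ 1 := by
    rw [hu, neg_sq, ← Complex.exp_nat_mul, Ne, Complex.exp_eq_one_iff]
    rintro ⟨m, hm⟩
    have h1 : 2 * α = m * Real.pi := by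
      have h2 : ((2 * α : ℝ) : ℂ) * (2 * Complex.I) =
          ((m * Real.pi : ℝ) : ℂ) * (2 * Complex.I) := by
        push_cast at hm ⊢
        linear_combination hm
      exact_mod_cast mul_right_cancel₀ (by simp) h2
    have h3 : Real.sin (2 * α) = 0 := by rw [h1, Real.sin_int_mul_pi]
    rw [Real.sin_two_mul] at h3
    have := mul_pos hs hc
    linarith
  have hfin : u ^ (2 * r.den) = 1 := by
    have hα' : α = 2 * Real.pi * r := by
      rw [hr]
      field_simp
    have hrd : (r : ℂ) * r.den = r.num := by exact_mod_cast Rat.mul_den_eq_num r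
    rw [hu, pow_mul, neg_sq, ← pow_mul, ← Complex.exp_nat_mul, Complex.exp_eq_one_iff]
    refine ⟨4 * r.num, ?_⟩
    rw [hα']
    push_cast
    linear_combination 8 * Real.pi * Complex.I * hrd
  have hpos : 0 < orderOf u :=
    orderOf_pos_iff.mpr (isOfFinOrder_iff_pow_eq_one.mpr
      ⟨_, Nat.mul_pos two_pos r.den_pos, hfin⟩)
  have hprim := IsPrimitiveRoot.orderOf u
  generalize orderOf u = M at hpos hprim
  have hM : 3 ≤ M := by
    by_contra! hlt
    refine hu2 ((hprim.pow_eq_one_iff_dvd 2).mpr ?_)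
    interval_cases M <;> norm_num
  have h0 := aeval_tanPoly_conj hpos hprim (n := n)
    (by rw [hu, neg_neg]; exact (aeval_tanPoly_exp_eq_zero_iff n α).mpr heq)
  have hconj : -Complex.exp (2 * Real.pi * Complex.I / M) =
      Complex.exp (2 * ((Real.pi / M + Real.pi / 2 : ℝ) : ℂ) * Complex.I) := by
    rw [neg_eq_neg_one_mul, ← Complex.exp_pi_mul_I, ← Complex.exp_add]
    congr 1
    push_cast
    ring
  rw [hconj, aeval_tanPoly_exp_eq_zero_iff, Real.sin_add_pi_div_two, Real.cos_add_pi_div_two] at h0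
  obtain ⟨m, rfl | rfl⟩ := Nat.even_or_odd' n
  · have harg : ((2 * m : ℕ) : ℝ) * (Real.pi / M + Real.pi / 2) =
        (2 * m : ℕ) * (Real.pi / M) + m * Real.pi := by
      push_cast
      ring
    rw [harg, Real.cos_add_nat_mul_pi, Real.sin_add_nat_mul_pi] at h0
    rcases eq_or_ne m 1 with rfl | hm
    · norm_num [Real.cos_two_mul', Real.sin_two_mul] at heq
      have : Real.sin α * (Real.sin α ^ 2) = 0 := by linear_combination (-1 / 2) * heq
      have h3 : 0 < Real.sin α * Real.sin α ^ 2 := by positivity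
      exact h3.ne' this
    · refine mul_cos_mul_cos_ne (n := 2 * m) (by omega) hM
        (mul_left_cancel₀ (pow_ne_zero m (by norm_num : (-1 : ℝ) ≠ 0)) ?_)
      linear_combination h0
  · have harg : ((2 * m + 1 : ℕ) : ℝ) * (Real.pi / M + Real.pi / 2) =
        (2 * m + 1 : ℕ) * (Real.pi / M) + Real.pi / 2 + m * Real.pi := by
      push_cast
      ring
    rw [harg, Real.cos_add_nat_mul_pi, Real.sin_add_nat_mul_pi, Real.sin_add_pi_div_two,
      Real.cos_add_pi_div_two] at h0
    refine mul_cos_mul_sin_ne hn hM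
      (mul_left_cancel₀ (pow_ne_zero m (by norm_num : (-1 : ℝ) ≠ 0)) ?_)
    linear_combination -h0

theorem isAlgebraic_exp_of_mul_tan_eq_tan {n : ℕ} (hn : 2 ≤ n) {α : ℝ}
    (heq : n * Real.sin α * Real.cos (n * α) = Real.cos α * Real.sin (n * α)) :
    IsAlgebraic ℚ (Complex.exp (2 * Real.pi * Complex.I * (α / (2 * Real.pi) : ℝ))) := by
  refine IsAlgebraic.of_pow two_pos ?_
  have e : Complex.exp (2 * Real.pi * Complex.I * (α / (2 * Real.pi) : ℝ)) ^ 2 =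
      Complex.exp (2 * α * Complex.I) := by
    have : (Real.pi : ℂ) ≠ 0 := by exact_mod_cast Real.pi_ne_zero
    rw [← Complex.exp_nat_mul]
    congr 1
    push_cast
    field_simp
  rw [e]
  have : IsAlgebraic ℤ (Complex.exp (2 * α * Complex.I)) :=
    ⟨tanPoly n, tanPoly_ne_zero hn, (aeval_tanPoly_exp_eq_zero_iff n α).mpr heq⟩
  exact this.extendScalars (algebraMap ℤ ℚ).injective_int

/-- If `n ≥ 2` is an integer and `α ∈ (0, π/2)` satisfies `n·tan α = tan(nα)`,
then `α/(2π)` is a Diophantine number. -/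
theorem stmt_1 (n : ℕ) (hn : 2 ≤ n) (α : ℝ) (hα : α ∈ Set.Ioo 0 (Real.pi / 2))
    (hcos : Real.cos (n * α) ≠ 0) (heq : (n : ℝ) * Real.tan α = Real.tan (n * α)) :
    ∃ c : ℝ, 0 < c ∧ ∃ τ : ℝ, ∀ (p : ℤ) (q : ℕ), 0 < q →
      |α / (2 * Real.pi) - (p : ℝ) / (q : ℝ)| ≥ c / (q : ℝ) ^ τ := by
  have hc : Real.cos α ≠ 0 :=
    (Real.cos_pos_of_mem_Ioo ⟨by linarith [hα.1, Real.pi_pos], hα.2⟩).ne'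
  have heq' : n * Real.sin α * Real.cos (n * α) = Real.cos α * Real.sin (n * α) := by
    rw [Real.tan_eq_sin_div_cos, Real.tan_eq_sin_div_cos, mul_div_assoc', div_eq_div_iff hc hcos]
      at heq
    linarith
  exact diophantine_of_isAlgebraic_exp (irrational_of_mul_tan_eq_tan hn hα heq')
    (isAlgebraic_exp_of_mul_tan_eq_tan hn heq')
end

section
/- Let n ≥ 2 be an integer and let α ∈ (0, π/2) be a real number with cos(nα) ≠ 0 satisfying n·tan α = tan(nα). Then α/(2π) is transcendental, i.e., α/(2π) is not a root of any nonzero polynomial with rational coefficients. -/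
open NumberField in
/-- Siegel's lemma over a number field, for twice as many unknowns as equations. -/
theorem NumberField.exists_ne_zero_isIntegral_house_le (K : Type*) [Field K] [NumberField K] :
    ∃ C : ℝ, 1 ≤ C ∧ ∀ (ι κ : Type) [Fintype ι] [Fintype κ] (A : κ → ι → K) (H : ℝ),
      0 < Fintype.card κ → Fintype.card ι = 2 * Fintype.card κ → 1 ≤ H →
      (∀ k i, IsIntegral ℤ (A k i)) → (∀ k i, house (A k i) ≤ H) →
      ∃ c : ι → K, c ≠ 0 ∧ (∀ i, IsIntegral ℤ (c i)) ∧ (∀ k, ∑ i, A k i * c i = 0) ∧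
        ∀ i, house (c i) ≤ C * Fintype.card ι * H := by
  classical
  obtain ⟨C, hC⟩ : ∃ C : ℝ, ∀ (ι κ : Type) [Fintype ι] [Fintype κ] (a : Matrix κ ι (𝓞 K)) (H : ℝ),
      a ≠ 0 → 0 < Fintype.card κ → Fintype.card ι = 2 * Fintype.card κ →
      (∀ k i, house ((algebraMap (𝓞 K) K) (a k i)) ≤ H) →
      ∃ ξ : ι → 𝓞 K, ξ ≠ 0 ∧ a.mulVec ξ = 0 ∧ ∀ i, house (ξ i : K) ≤
        C * (C * (Fintype.card ι : ℕ) * H) ^ (((Fintype.card κ : ℕ) : ℝ) /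
          (((Fintype.card ι : ℕ) : ℝ) - ((Fintype.card κ : ℕ) : ℝ))) := by
    exact ⟨_, fun ι κ _ _ a H ha hκ hι hH ↦
      house.exists_ne_zero_int_vec_house_le K a ha hκ (by omega) rfl hH rfl⟩
  refine ⟨max 1 (C * C), le_max_left _ _, fun ι κ _ _ A H hκ hι hH hint hA ↦ ?_⟩
  have hbound : 1 ≤ max 1 (C * C) * Fintype.card ι * H := by
    have h1 : (1 : ℝ) ≤ Fintype.card ι := by exact_mod_cast (by omega : 1 ≤ Fintype.card ι)
    exact one_le_mul_of_one_le_of_one_le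
      (one_le_mul_of_one_le_of_one_le (le_max_left _ _) h1) hH
  set a : Matrix κ ι (𝓞 K) := fun k i ↦ ⟨A k i, hint k i⟩ with ha_def
  have ha_coe : ∀ k i, ((a k i : 𝓞 K) : K) = A k i := fun k i ↦ rfl
  by_cases ha : a = 0
  · have hA0 : ∀ k i, A k i = 0 := fun k i ↦ by rw [← ha_coe, ha]; simp
    have : Nonempty ι := Fintype.card_pos_iff.mp (by omega)
    refine ⟨1, one_ne_zero, fun i ↦ isIntegral_one, fun k ↦ by simp [hA0], fun i ↦ ?_⟩
    have : house (1 : K) = 1 := by simpa using house_intCast (K := K) 1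
    simpa [this] using hbound
  · obtain ⟨ξ, h0, hmul, hξ⟩ := hC ι κ a H ha hκ hι hA
    refine ⟨fun i ↦ ξ i, fun h ↦ h0 ?_, fun i ↦ (ξ i).isIntegral_coe, fun k ↦ ?_, fun i ↦ ?_⟩
    · funext i
      exact RingOfIntegers.ext (by simpa using congrFun h i)
    · have := congrArg (algebraMap (𝓞 K) K) (congrFun hmul k)
      simpa [Matrix.mulVec, dotProduct, ha_coe] using this
    · have hexp : ((Fintype.card κ : ℕ) : ℝ) /
          (((Fintype.card ι : ℕ) : ℝ) - ((Fintype.card κ : ℕ) : ℝ)) = 1 := by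
        have : ((Fintype.card κ : ℕ) : ℝ) ≠ 0 := by exact_mod_cast hκ.ne'
        rw [hι]; push_cast
        rw [two_mul, add_sub_cancel_right, div_self this]
      have := hξ i
      rw [hexp, Real.rpow_one] at this
      calc _ ≤ _ := this
        _ = C * C * Fintype.card ι * H := by ring
        _ ≤ _ := by gcongr; exact le_max_right _ _

open NumberField in
/-- Liouville's inequality: a nonzero algebraic number is bounded below in terms of its
house and a denominator. -/
theorem NumberField.one_le_pow_mul_norm_mul_house_pow {K : Type*} [Field K] [NumberField K]
    (φ : K →+* ℂ) {x : K} (hx : x ≠ 0) (D : ℕ) (hD : D ≠ 0) (hint : IsIntegral ℤ (D * x)) :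
    1 ≤ (D : ℝ) ^ Module.finrank ℚ K * (‖φ x‖ * house x ^ (Module.finrank ℚ K - 1)) := by
  obtain ⟨y, hy⟩ := IsIntegrallyClosed.isIntegral_iff.mp (Algebra.isIntegral_norm ℚ hint)
  have hDx : (D : K) * x ≠ 0 := mul_ne_zero (Nat.cast_ne_zero.mpr hD) hx
  have hy0 : y ≠ 0 := by
    rintro rfl
    rw [map_zero] at hy
    exact hDx (Algebra.norm_eq_zero_iff.mp hy.symm)
  have h1 : 1 ≤ ‖Algebra.norm ℚ ((D : K) * x)‖ := by
    rw [← hy]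
    simpa [Int.norm_eq_abs] using (by exact_mod_cast Int.one_le_abs hy0 : (1 : ℝ) ≤ |(y : ℝ)|)
  have h2 : Algebra.norm ℚ (D : K) = (D : ℚ) ^ Module.finrank ℚ K := by
    simpa using Algebra.norm_algebraMap (S := K) (D : ℚ)
  have h3 : ‖(D : ℚ)‖ = D := by rw [← Rat.norm_cast_real]; simp
  rw [map_mul, h2, norm_mul, norm_pow, h3] at h1
  exact h1.trans (by gcongr; exact norm_norm_le_norm_mul_house_pow x φ)

/-- An entire function vanishing to order at least `r` at a point is divisible by the `r`-th power
of the corresponding linear polynomial. -/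
theorem Differentiable.exists_eq_sub_pow_mul {f : ℂ → ℂ} (hf : Differentiable ℂ f) (c : ℂ) (r : ℕ)
    (hr : (r : ℕ∞) ≤ analyticOrderAt f c) :
    ∃ g : ℂ → ℂ, Differentiable ℂ g ∧ ∀ z, f z = (z - c) ^ r * g z := by
  induction r with
  | zero => exact ⟨f, hf, fun z ↦ by simp⟩
  | succ r ih =>
    obtain ⟨g, hg, hfg⟩ := ih (le_trans (by exact_mod_cast r.le_succ) hr)
    have hgc : g c = 0 := by
      by_contra hgc
      have : analyticOrderAt f c = r :=
        (hf.analyticAt c).analyticOrderAt_eq_natCast.mpr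
          ⟨g, hg.analyticAt c, hgc, Filter.Eventually.of_forall hfg⟩
      rw [this] at hr
      exact absurd (by exact_mod_cast hr : r + 1 ≤ r) (by omega)
    refine ⟨dslope g c, ?_, fun z ↦ ?_⟩
    · rw [← differentiableOn_univ] at hg ⊢
      exact (Complex.differentiableOn_dslope Filter.univ_mem).mpr hg
    · rw [hfg, pow_succ, mul_assoc, ← smul_eq_mul (z - c), sub_smul_dslope, hgc, sub_zero]

theorem Differentiable.exists_eq_prod_sub_pow_mul {f : ℂ → ℂ} (hf : Differentiable ℂ f)
    (s : Finset ℂ) (r : ℕ) (hr : ∀ c ∈ s, (r : ℕ∞) ≤ analyticOrderAt f c) :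
    ∃ g : ℂ → ℂ, Differentiable ℂ g ∧ ∀ z, f z = (∏ c ∈ s, (z - c) ^ r) * g z := by
  classical
  induction s using Finset.induction_on generalizing f with
  | empty => exact ⟨f, hf, fun z ↦ by simp⟩
  | insert c s hcs ih =>
    obtain ⟨g, hg, hfg⟩ := hf.exists_eq_sub_pow_mul c r (hr c (Finset.mem_insert_self _ _))
    obtain ⟨k, hk, hgk⟩ := ih hg fun d hd ↦ by
      have hdc : d ≠ c := fun h ↦ hcs (h ▸ hd)
      have hp : AnalyticAt ℂ (fun z : ℂ ↦ (z - c) ^ r) d := by fun_prop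
      have h0 : analyticOrderAt (fun z : ℂ ↦ (z - c) ^ r) d = 0 :=
        hp.analyticOrderAt_eq_zero.mpr (pow_ne_zero _ (sub_ne_zero.mpr hdc))
      have : analyticOrderAt f d = analyticOrderAt g d := by
        rw [show f = (fun z : ℂ ↦ (z - c) ^ r) * g from funext hfg,
          analyticOrderAt_mul hp (hg.analyticAt d), h0, zero_add]
      exact this ▸ hr d (Finset.mem_insert_of_mem hd)
    exact ⟨k, hk, fun z ↦ by rw [hfg, hgk, Finset.prod_insert hcs, mul_assoc]⟩

/-- Schwarz lemma for an entire function with zeros of order at least `r` at `0, 1, …, M - 1`. -/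
theorem Complex.norm_iteratedDeriv_le_of_iteratedDeriv_eq_zero {f : ℂ → ℂ}
    (hf : Differentiable ℂ f) (M r : ℕ) (hr : ∀ l < M, ∀ k < r, iteratedDeriv k f (l : ℂ) = 0)
    {R B : ℝ} (hR : 2 * (M : ℝ) ≤ R) (hB : ∀ z : ℂ, ‖z‖ ≤ R → ‖f z‖ ≤ B) {l : ℕ} (hl : l < M) :
    ‖iteratedDeriv r f (l : ℂ)‖ ≤ r.factorial * ((2 * M / R) ^ (M * r) * B) := by
  have hM1 : (1 : ℝ) ≤ M := by exact_mod_cast (by omega : 1 ≤ M)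
  have hR0 : 0 < R := by linarith
  obtain ⟨g, hg, hfg⟩ := hf.exists_eq_prod_sub_pow_mul
    ((Finset.range M).image (Nat.cast : ℕ → ℂ)) r fun c hc ↦ by
      obtain ⟨l, hl, rfl⟩ := Finset.mem_image.mp hc
      exact (natCast_le_analyticOrderAt_iff_iteratedDeriv_eq_zero (hf.analyticAt _)).mpr
        (hr l (Finset.mem_range.mp hl))
  replace hfg : ∀ z, f z = (∏ l ∈ Finset.range M, (z - l) ^ r) * g z := fun z ↦ by
    rw [hfg, Finset.prod_image (by intro a _ b _ h; exact_mod_cast h)]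
  have hB0 : 0 ≤ B := (norm_nonneg _).trans (hB 0 (by simpa using hR0.le))
  have hgR : ∀ z : ℂ, ‖z‖ ≤ R → ‖g z‖ ≤ (2 / R) ^ (M * r) * B := by
    intro z hz
    refine Complex.norm_le_of_forall_mem_frontier_norm_le (U := Metric.ball 0 R)
      Metric.isBounded_ball hg.diffContOnCl (fun w hw ↦ ?_) ?_
    · rw [frontier_ball _ hR0.ne', mem_sphere_zero_iff_norm] at hw
      have hprod : (R / 2) ^ (M * r) ≤ ‖∏ l ∈ Finset.range M, (w - l) ^ r‖ := by
        rw [norm_prod]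
        calc (R / 2) ^ (M * r) = ∏ l ∈ Finset.range M, (R / 2) ^ r := by
              rw [Finset.prod_const, Finset.card_range, ← pow_mul, mul_comm]
          _ ≤ _ := by
              refine Finset.prod_le_prod (fun _ _ ↦ by positivity) fun l hl ↦ ?_
              rw [norm_pow]
              gcongr
              have h1 : (l : ℝ) ≤ M := by exact_mod_cast (Finset.mem_range.mp hl).le
              have h2 := norm_sub_norm_le w (l : ℂ)
              rw [hw, Complex.norm_natCast] at h2
              linarith
      have h := hB w hw.le
      rw [hfg, norm_mul] at h
      have h3 : (R / 2) ^ (M * r) * ‖g w‖ ≤ B :=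
        (mul_le_mul_of_nonneg_right hprod (norm_nonneg _)).trans h
      calc ‖g w‖ = (2 / R) ^ (M * r) * ((R / 2) ^ (M * r) * ‖g w‖) := by
            rw [← mul_assoc, ← mul_pow]
            field_simp
            simp
        _ ≤ _ := by gcongr
    · rw [closure_ball _ hR0.ne']
      simpa using hz
  have hsphere : ∀ z ∈ Metric.sphere (l : ℂ) 1, ‖f z‖ ≤ (2 * M / R) ^ (M * r) * B := by
    intro z hz
    rw [mem_sphere_iff_norm] at hz
    have hl1 : (l : ℝ) + 1 ≤ M := by exact_mod_cast hl
    have hzR : ‖z‖ ≤ R := by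
      have := norm_sub_norm_le z (l : ℂ)
      rw [hz, Complex.norm_natCast] at this
      linarith
    rw [hfg, norm_mul, norm_prod]
    calc _ ≤ (∏ l ∈ Finset.range M, (M : ℝ) ^ r) * ((2 / R) ^ (M * r) * B) := by
          gcongr with j hj
          · rw [norm_pow]
            gcongr
            have hj1 : (j : ℝ) + 1 ≤ M := by exact_mod_cast Finset.mem_range.mp hj
            have h1 : ‖(l : ℂ) - j‖ ≤ M - 1 := by
              rw [show (l : ℂ) - j = ((l - j : ℝ) : ℂ) by push_cast; ring, Complex.norm_real,
                Real.norm_eq_abs, abs_le]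
              constructor <;> linarith [(Nat.cast_nonneg l : (0 : ℝ) ≤ l),
                (Nat.cast_nonneg j : (0 : ℝ) ≤ j)]
            calc ‖z - j‖ = ‖(z - l) + (l - j)‖ := by ring_nf
              _ ≤ ‖z - l‖ + ‖(l : ℂ) - j‖ := norm_add_le _ _
              _ ≤ M := by rw [hz]; linarith
          · exact hgR z hzR
      _ = _ := by
          rw [Finset.prod_const, Finset.card_range, ← pow_mul, mul_comm r M, ← mul_assoc, ← mul_pow]
          ring_nf
  simpa using Complex.norm_iteratedDeriv_le_of_forall_mem_sphere_norm_le r one_pos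
    hf.diffContOnCl hsphere

/-- Power sums with distinct nodes determine their weights. -/
theorem eq_zero_of_forall_sum_mul_pow_eq_zero {R ι : Type*} [CommRing R] [IsDomain R] [Fintype ι]
    {w v : ι → R} (hw : Function.Injective w) (h : ∀ k : ℕ, ∑ i, v i * w i ^ k = 0) : v = 0 := by
  let e := Fintype.equivFin ι
  have := Matrix.eq_zero_of_forall_pow_sum_mul_pow_eq_zero (f := w ∘ e.symm) (v := v ∘ e.symm)
    (hw.comp e.symm.injective) fun k ↦ by
      rw [← h k]
      exact Equiv.sum_comp e.symm fun i ↦ v i * w i ^ (k : ℕ)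
  funext i
  simpa using congrFun this (e i)

open NumberField in
/-- The auxiliary function of Gelfond's method: an exponential polynomial with algebraic data, with
many zeros of high order, yields a nonzero algebraic number of controlled house and denominator
which is small at one place. -/
theorem NumberField.exists_gelfond_auxiliary (K : Type*) [Field K] [NumberField K] (φ : K →+* ℂ) :
    ∃ C : ℝ, 1 ≤ C ∧ ∀ (ι : Type) [Fintype ι] (ω e : ι → K) (s : ℂ) (M N D D' : ℕ) (W E : ℝ),
      Function.Injective ω → (∀ i, Complex.exp (s * φ (ω i)) = φ (e i)) →
      0 < M → 0 < N → Fintype.card ι = 2 * (M * N) → D ≠ 0 → D' ≠ 0 → 1 ≤ W → 1 ≤ E →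
      (∀ i, IsIntegral ℤ (D * ω i)) → (∀ i, IsIntegral ℤ (D' * e i)) →
      (∀ i, house (ω i) ≤ W) → (∀ i, house (e i) ≤ E) →
      ∃ (r : ℕ) (x : K) (B : ℝ), N ≤ r ∧ x ≠ 0 ∧ IsIntegral ℤ (((D ^ r * D' ^ M : ℕ) : K) * x) ∧
        B = C * Fintype.card ι * ((D : ℝ) ^ N * D' ^ M * (W ^ N * E ^ M)) ∧
        house x ≤ Fintype.card ι * (B * (W ^ r * E ^ M)) ∧
        ∀ R : ℝ, 2 * (M : ℝ) ≤ R → ‖s‖ ^ r * ‖φ x‖ ≤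
          r.factorial * ((2 * M / R) ^ (M * r) *
            (Fintype.card ι * (B * Real.exp (‖s‖ * W * R)))) := by
  obtain ⟨C, hC1, hC⟩ := exists_ne_zero_isIntegral_house_le K
  refine ⟨C, hC1, ?_⟩
  intro ι _ ω e s M N D D' W E hω hexp hM hN hcard hD hD' hW hE hωint heint hωW heE
  have key : ∀ i (m k n l : ℕ), k ≤ m → l ≤ n →
      IsIntegral ℤ ((D : K) ^ m * D' ^ n * (ω i ^ k * e i ^ l)) := by
    intro i m k n l hk hl
    obtain ⟨m', rfl⟩ := Nat.exists_eq_add_of_le hk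
    obtain ⟨n', rfl⟩ := Nat.exists_eq_add_of_le hl
    rw [show (D : K) ^ (k + m') * D' ^ (l + n') * (ω i ^ k * e i ^ l)
      = (D : K) ^ m' * D' ^ n' * ((D * ω i) ^ k * (D' * e i) ^ l) by ring]
    have hnat (n : ℕ) : IsIntegral ℤ (n : K) := by
      simpa using isIntegral_algebraMap (R := ℤ) (A := K) (x := (n : ℤ))
    exact (((hnat D).pow _).mul ((hnat D').pow _)).mul
      (((hωint i).pow _).mul ((heint i).pow _))
  have hhouse : ∀ i (k l : ℕ), l ≤ M → house (ω i ^ k * e i ^ l) ≤ W ^ k * E ^ M := by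
    intro i k l hl
    have h0 := house_nonneg (ω i)
    have h1 := house_nonneg (e i)
    calc _ ≤ house (ω i ^ k) * house (e i ^ l) := house_mul_le _ _
      _ ≤ house (ω i) ^ k * house (e i) ^ l :=
          mul_le_mul (house_pow_le _ _) (house_pow_le _ _) (house_nonneg _) (by positivity)
      _ ≤ W ^ k * E ^ l := by gcongr <;> solve_by_elim
      _ ≤ W ^ k * E ^ M := by gcongr
  obtain ⟨c, hc0, hcint, hczero, hcB⟩ := hC ι (Fin M × Fin N)
    (fun p i ↦ (D : K) ^ N * D' ^ M * (ω i ^ (p.2 : ℕ) * e i ^ (p.1 : ℕ)))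
    ((D : ℝ) ^ N * D' ^ M * (W ^ N * E ^ M)) (by simp; omega) (by simpa using hcard)
    (by
      have hD1 : (1 : ℝ) ≤ D := by exact_mod_cast Nat.one_le_iff_ne_zero.mpr hD
      have hD1' : (1 : ℝ) ≤ D' := by exact_mod_cast Nat.one_le_iff_ne_zero.mpr hD'
      exact one_le_mul_of_one_le_of_one_le
        (one_le_mul_of_one_le_of_one_le (one_le_pow₀ hD1) (one_le_pow₀ hD1'))
        (one_le_mul_of_one_le_of_one_le (one_le_pow₀ hW) (one_le_pow₀ hE)))
    (fun p i ↦ key i _ _ _ _ p.2.2.le p.1.2.le)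
    (fun p i ↦ by
      rw [show (D : K) ^ N * D' ^ M * (ω i ^ (p.2 : ℕ) * e i ^ (p.1 : ℕ)) =
        ((D ^ N * D' ^ M : ℕ) : K) * (ω i ^ (p.2 : ℕ) * e i ^ (p.1 : ℕ)) by push_cast; ring,
        house_nat_mul]
      push_cast
      gcongr
      refine (hhouse i _ _ p.1.2.le).trans ?_
      gcongr
      exact p.2.2.le)
  set B : ℝ := C * Fintype.card ι * ((D : ℝ) ^ N * D' ^ M * (W ^ N * E ^ M)) with hB
  have hB0 : 0 ≤ B := by positivity
  let S : ℕ → ℕ → K := fun k l ↦ ∑ i, c i * (ω i ^ k * e i ^ l)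
  let F : ℂ → ℂ := fun z ↦ ∑ i, φ (c i) * Complex.exp (s * φ (ω i) * z)
  have hF : Differentiable ℂ F := by fun_prop
  have hderiv : ∀ k l : ℕ, iteratedDeriv k F (l : ℂ) = s ^ k * φ (S k l) := by
    intro k l
    simp only [F, S]
    rw [iteratedDeriv_fun_sum fun i _ ↦ by fun_prop, map_sum, Finset.mul_sum]
    refine Finset.sum_congr rfl fun i _ ↦ ?_
    rw [iteratedDeriv_const_mul_field, iteratedDeriv_cexp_const_mul]
    beta_reduce
    rw [mul_comm (s * φ (ω i)) (l : ℂ), Complex.exp_nat_mul, hexp]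
    simp only [map_mul, map_pow]
    ring
  have hex : ∃ k, ∃ l < M, S k l ≠ 0 := by
    by_contra! h
    refine hc0 (eq_zero_of_forall_sum_mul_pow_eq_zero hω fun k ↦ ?_)
    simpa [S] using h k 0 hM
  classical
  set r := Nat.find hex with hr
  obtain ⟨l, hlM, hne⟩ := Nat.find_spec hex
  have hmin : ∀ k < r, ∀ l < M, S k l = 0 := by
    intro k hk l hl
    by_contra h
    exact Nat.find_min hex hk ⟨l, hl, h⟩
  have hNr : N ≤ r := by
    by_contra! hlt
    apply hne
    have hz := hczero (⟨l, hlM⟩, ⟨r, hlt⟩)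
    have h0 : (D : K) ^ N * D' ^ M ≠ 0 := by simp [hD, hD']
    have : (D : K) ^ N * D' ^ M * S r l = 0 := by
      rw [← hz, Finset.mul_sum]
      exact Finset.sum_congr rfl fun i _ ↦ by ring
    exact (mul_eq_zero.mp this).resolve_left h0
  refine ⟨r, S r l, B, hNr, hne, ?_, rfl, ?_, fun R hR ↦ ?_⟩
  · rw [Finset.mul_sum]
    refine IsIntegral.sum _ fun i _ ↦ ?_
    have := (hcint i).mul (key i r r M l le_rfl hlM.le)
    convert this using 1
    push_cast
    ring
  · calc house (S r l) ≤ ∑ i, house (c i * (ω i ^ r * e i ^ l)) := house_sum_le_sum_house _ _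
      _ ≤ ∑ _i : ι, B * (W ^ r * E ^ M) := by
          refine Finset.sum_le_sum fun i _ ↦ (house_mul_le _ _).trans ?_
          exact mul_le_mul (hcB i) (hhouse i r l hlM.le) (house_nonneg _) hB0
      _ = _ := by simp
  · have hbound : ∀ z : ℂ, ‖z‖ ≤ R →
        ‖F z‖ ≤ Fintype.card ι * (B * Real.exp (‖s‖ * W * R)) := by
      intro z hz
      calc ‖F z‖ ≤ ∑ i, ‖φ (c i) * Complex.exp (s * φ (ω i) * z)‖ := norm_sum_le _ _
        _ ≤ ∑ _i : ι, B * Real.exp (‖s‖ * W * R) := by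
            refine Finset.sum_le_sum fun i _ ↦ ?_
            rw [norm_mul]
            refine mul_le_mul ((norm_embedding_le_house _ φ).trans (hcB i)) ?_
              (norm_nonneg _) hB0
            refine (Complex.norm_exp_le_exp_norm _).trans (Real.exp_le_exp.mpr ?_)
            rw [norm_mul, norm_mul]
            have := (norm_embedding_le_house (ω i) φ).trans (hωW i)
            gcongr
        _ = _ := by simp
    have := Complex.norm_iteratedDeriv_le_of_iteratedDeriv_eq_zero hF M r
      (fun l hl k hk ↦ by rw [hderiv, hmin k hk l hl]; simp) hR hbound hlM
    rwa [hderiv, norm_mul, norm_pow] at this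

/-- The parameter comparison concluding Gelfond's method. -/
theorem Real.le_of_gelfond_bounds {c X H Q : ℝ} {h r : ℕ} (hc : 1 ≤ c) (hr : 0 < r) (hQ : 0 < Q)
    (hH0 : 0 ≤ H) (hXH : 1 ≤ (c ^ (3 * r)) ^ (h + 1) * (X * H ^ h))
    (hH : H ≤ (64 * c ^ 10 * Q ^ 2) ^ r)
    (hX : X ≤ (c * r * (2 * (2 * h + 4) * Q / r) ^ (2 * h + 4) *
      (32 * c ^ 7 * Q * Real.exp (2 * c ^ 2))) ^ r)
    (hQr : Q ^ 2 ≤ 2 * (2 * h + 4) * r) :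
    Q ≤ (2 * (2 * h + 4)) ^ (2 * h + 3) * (c ^ (3 * (h + 1)) * (64 * c ^ 10) ^ h * c *
      (2 * (2 * h + 4)) ^ (2 * h + 4) * (32 * c ^ 7 * Real.exp (2 * c ^ 2))) := by
  have hr' : (0 : ℝ) < r := by exact_mod_cast hr
  set m : ℝ := 2 * (2 * h + 4) with hm
  set P := c ^ (3 * (h + 1)) * (64 * c ^ 10) ^ h * c * m ^ (2 * h + 4) *
    (32 * c ^ 7 * Real.exp (2 * c ^ 2)) with hP
  have hm0 : 0 < m := by positivity
  have h1 : 1 ≤ P * Q ^ (4 * h + 5) / (r : ℝ) ^ (2 * h + 3) := by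
    rw [← one_le_pow_iff_of_nonneg (by positivity) hr.ne']
    calc (1 : ℝ) ≤ (c ^ (3 * r)) ^ (h + 1) * (X * H ^ h) := hXH
      _ ≤ (c ^ (3 * r)) ^ (h + 1) * ((c * r * (m * Q / r) ^ (2 * h + 4) *
          (32 * c ^ 7 * Q * Real.exp (2 * c ^ 2))) ^ r * ((64 * c ^ 10 * Q ^ 2) ^ r) ^ h) := by
          gcongr
      _ = (c ^ (3 * (h + 1)) * ((c * r * (m * Q / r) ^ (2 * h + 4) *
          (32 * c ^ 7 * Q * Real.exp (2 * c ^ 2))) * (64 * c ^ 10 * Q ^ 2) ^ h)) ^ r := by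
          simp only [mul_pow, ← pow_mul]
          ring_nf
      _ = _ := by
          congr 1
          rw [hP, div_pow, mul_pow _ (Q ^ 2), mul_pow m, show 2 * h + 4 = (2 * h + 3) + 1 by ring,
            pow_succ (r : ℝ)]
          field_simp
          ring
  rw [one_le_div (by positivity)] at h1
  have h2 : Q * Q ^ (4 * h + 5) ≤ m ^ (2 * h + 3) * P * Q ^ (4 * h + 5) := by
    calc Q * Q ^ (4 * h + 5) = (Q ^ 2) ^ (2 * h + 3) := by ring
      _ ≤ (m * r) ^ (2 * h + 3) := by gcongr
      _ = m ^ (2 * h + 3) * (r : ℝ) ^ (2 * h + 3) := mul_pow _ _ _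
      _ ≤ m ^ (2 * h + 3) * (P * Q ^ (4 * h + 5)) := by gcongr
      _ = _ := by ring
  exact le_of_mul_le_mul_right h2 (by positivity)

open NumberField in
theorem NumberField.not_exists_exp_eq {K : Type*} [Field K] [NumberField K] (φ : K →+* ℂ)
    (u b v : K) (s : ℂ) (hs : s ≠ 0) (hb : ∀ q : ℚ, b ≠ q) (hu : Complex.exp s = φ u)
    (hv : Complex.exp (s * φ b) = φ v) : False := by
  obtain ⟨C, hC1, hC⟩ := exists_gelfond_auxiliary K φ
  have hnat (n : ℕ) : IsIntegral ℤ (n : K) := by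
    simpa using isIntegral_algebraMap (R := ℤ) (A := K) (x := (n : ℤ))
  obtain ⟨D, hD, hDu, hDb, hDv⟩ : ∃ D : ℕ, D ≠ 0 ∧ IsIntegral ℤ (D * u) ∧
      IsIntegral ℤ (D * b) ∧ IsIntegral ℤ (D * v) := by
    have hden : ∀ x : K, ∃ d : ℕ, d ≠ 0 ∧ IsIntegral ℤ (d * x) := by
      intro x
      obtain ⟨y, hy, hint⟩ := ((IsFractionRing.isAlgebraic_iff ℤ ℚ K).mpr
        (Algebra.IsAlgebraic.isAlgebraic x)).exists_integral_multiple
      refine ⟨y.natAbs, Int.natAbs_ne_zero.mpr hy, ?_⟩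
      rcases Int.natAbs_eq y with h | h
      · rw [h] at hint
        simpa using hint
      · rw [h] at hint
        simpa using hint.neg
    obtain ⟨d₁, h₁, i₁⟩ := hden u
    obtain ⟨d₂, h₂, i₂⟩ := hden b
    obtain ⟨d₃, h₃, i₃⟩ := hden v
    refine ⟨d₁ * d₂ * d₃, by simp [h₁, h₂, h₃], ?_, ?_, ?_⟩
    · rw [show ((d₁ * d₂ * d₃ : ℕ) : K) * u = ((d₂ * d₃ : ℕ) : K) * (d₁ * u) by push_cast; ring]
      exact (hnat _).mul i₁
    · rw [show ((d₁ * d₂ * d₃ : ℕ) : K) * b = ((d₁ * d₃ : ℕ) : K) * (d₂ * b) by push_cast; ring]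
      exact (hnat _).mul i₂
    · rw [show ((d₁ * d₂ * d₃ : ℕ) : K) * v = ((d₁ * d₂ : ℕ) : K) * (d₃ * v) by push_cast; ring]
      exact (hnat _).mul i₃
  obtain ⟨c, hc1, hcC, hcD, hcs, hcs', hcu, hcb, hcv⟩ : ∃ c : ℝ, 1 ≤ c ∧ C ≤ c ∧ (D : ℝ) ≤ c ∧
      ‖s‖ ≤ c ∧ ‖s‖⁻¹ ≤ c ∧ house u ≤ c ∧ house b ≤ c ∧ house v ≤ c := by
    have h1 := house_nonneg u
    have h2 := house_nonneg b
    have h3 := house_nonneg v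
    have h4 := norm_nonneg s
    have h5 := inv_nonneg.mpr h4
    have h6 : (0 : ℝ) ≤ D := Nat.cast_nonneg D
    exact ⟨C + D + ‖s‖ + ‖s‖⁻¹ + house u + house b + house v, by linarith, by linarith,
      by linarith, by linarith, by linarith, by linarith, by linarith, by linarith⟩
  obtain ⟨h, hh⟩ : ∃ h, Module.finrank ℚ K = h + 1 :=
    Nat.exists_eq_succ_of_ne_zero Module.finrank_pos.ne'
  set M : ℕ := 2 * h + 4 with hM
  obtain ⟨t, ht⟩ := exists_nat_gt (max (2 * (M : ℝ)) ((2 * (2 * h + 4)) ^ (2 * h + 3) *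
    (c ^ (3 * (h + 1)) * (64 * c ^ 10) ^ h * c *
      (2 * (2 * h + 4)) ^ (2 * h + 4) * (32 * c ^ 7 * Real.exp (2 * c ^ 2)))))
  rw [max_lt_iff] at ht
  obtain ⟨htM, htP⟩ := ht
  replace htM : 2 * M < t := by exact_mod_cast htM
  set Q : ℕ := 2 * M * t with hQ
  set N : ℕ := 2 * M * t ^ 2 with hN
  have hc0 : 0 < c := by linarith
  have hMpos : 0 < M := by omega
  have htpos : 0 < t := by omega
  have hQpos : 0 < Q := by positivity
  have hQ1 : (1 : ℝ) ≤ Q := by exact_mod_cast hQpos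
  have hD1 : (1 : ℝ) ≤ D := by exact_mod_cast Nat.one_le_iff_ne_zero.mpr hD
  have hQM : Q * M ≤ N := by
    rw [hQ, hN, pow_two, ← mul_assoc]
    exact Nat.mul_le_mul_left _ (by omega)
  have hQN : Q ≤ N := (Nat.le_mul_of_pos_right Q hMpos).trans hQM
  let ω : Fin Q × Fin Q → K := fun p ↦ (p.1 : ℕ) + (p.2 : ℕ) * b
  let e : Fin Q × Fin Q → K := fun p ↦ u ^ (p.1 : ℕ) * v ^ (p.2 : ℕ)
  have hω : Function.Injective ω := by
    rintro ⟨i, j⟩ ⟨i', j'⟩ hp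
    simp only [ω] at hp
    have hj : (j : ℕ) = j' := by
      by_contra hne
      have hne' : ((j : ℕ) : K) - (j' : ℕ) ≠ 0 := by
        rw [sub_ne_zero]; exact_mod_cast hne
      refine hb ((((i' : ℕ) : ℚ) - (i : ℕ)) / (((j : ℕ) : ℚ) - (j' : ℕ))) ?_
      push_cast
      rw [eq_div_iff hne']
      linear_combination hp
    have hi : (i : ℕ) = i' := by
      rw [hj] at hp
      exact_mod_cast add_right_cancel hp
    rw [Fin.ext hi, Fin.ext hj]
  have hexp : ∀ p, Complex.exp (s * φ (ω p)) = φ (e p) := by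
    intro p
    simp only [ω, e, map_add, map_mul, map_pow, map_natCast, ← hu, ← hv, ← Complex.exp_nat_mul,
      ← Complex.exp_add]
    congr 1
    ring
  obtain ⟨r, x, B, hNr, hx0, hxint, hB, hxB, hxs⟩ := hC (Fin Q × Fin Q) ω e s M N D (D ^ (2 * Q))
    (2 * c * Q) (c ^ (2 * Q)) hω hexp hMpos (by positivity)
    (by simp only [Fintype.card_prod, Fintype.card_fin, hQ, hN]; ring) hD (pow_ne_zero _ hD)
    (by nlinarith) (one_le_pow₀ hc1)
    (fun p ↦ by
      rw [show (D : K) * ω p = ((D * (p.1 : ℕ) : ℕ) : K) + ((p.2 : ℕ) : K) * (D * b) by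
        simp only [ω]; push_cast; ring]
      exact (hnat _).add ((hnat _).mul hDb))
    (fun p ↦ by
      obtain ⟨k, hk⟩ := Nat.exists_eq_add_of_le
        (show (p.1 : ℕ) + (p.2 : ℕ) ≤ 2 * Q by omega)
      rw [show ((D ^ (2 * Q) : ℕ) : K) * e p =
        ((D ^ k : ℕ) : K) * ((D * u) ^ (p.1 : ℕ) * (D * v) ^ (p.2 : ℕ)) by
        simp only [e]; rw [hk]; push_cast; ring]
      exact (hnat _).mul ((hDu.pow _).mul (hDv.pow _)))
    (fun p ↦ by
      have h1 : ((p.1 : ℕ) : ℝ) ≤ Q := by exact_mod_cast p.1.2.le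
      have h2 : ((p.2 : ℕ) : ℝ) ≤ Q := by exact_mod_cast p.2.2.le
      calc house (ω p) ≤ house (((p.1 : ℕ) : K)) + house (((p.2 : ℕ) : K) * b) := house_add_le _ _
        _ = (p.1 : ℕ) + (p.2 : ℕ) * house b := by
          rw [house_nat_mul]
          congr 1
          simpa using house_intCast (K := K) ((p.1 : ℕ) : ℤ)
        _ ≤ Q + Q * c := by
          gcongr
          exact house_nonneg b
        _ ≤ 2 * c * Q := by nlinarith)
    (fun p ↦ by
      have h1 := house_nonneg u
      have h2 := house_nonneg v
      calc house (e p) ≤ house (u ^ (p.1 : ℕ)) * house (v ^ (p.2 : ℕ)) := house_mul_le _ _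
        _ ≤ house u ^ (p.1 : ℕ) * house v ^ (p.2 : ℕ) :=
          mul_le_mul (house_pow_le _ _) (house_pow_le _ _) (house_nonneg _) (by positivity)
        _ ≤ c ^ (p.1 : ℕ) * c ^ (p.2 : ℕ) := by gcongr
        _ = c ^ ((p.1 : ℕ) + (p.2 : ℕ)) := (pow_add _ _ _).symm
        _ ≤ c ^ (2 * Q) := pow_le_pow_right₀ hc1 (by omega))
  have hrpos : 0 < r := lt_of_lt_of_le (by positivity) hNr
  have hr0 : (0 : ℝ) < r := by exact_mod_cast hrpos
  have hW1 : 1 ≤ 2 * c * Q := by nlinarith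
  have hcard : (Fintype.card (Fin Q × Fin Q) : ℝ) ≤ 4 ^ r := by
    have h1 : Q ≤ 2 ^ r := (hQN.trans hNr).trans Nat.lt_two_pow_self.le
    have h2 : Q * Q ≤ 2 ^ r * 2 ^ r := Nat.mul_le_mul h1 h1
    rw [← mul_pow] at h2
    simp only [Fintype.card_prod, Fintype.card_fin]
    exact_mod_cast h2
  have hpowM : (c ^ (2 * Q)) ^ M ≤ c ^ (2 * r) := by
    rw [← pow_mul]
    exact pow_le_pow_right₀ hc1 (by nlinarith)
  have hDM : (D : ℝ) ^ r * ((D : ℝ) ^ (2 * Q)) ^ M ≤ c ^ (3 * r) := by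
    calc (D : ℝ) ^ r * ((D : ℝ) ^ (2 * Q)) ^ M ≤ c ^ r * (c ^ (2 * Q)) ^ M := by gcongr
      _ ≤ c ^ r * c ^ (2 * r) := by gcongr
      _ = _ := by ring
  have hB0 : 0 ≤ B := by rw [hB]; positivity
  have hBle : B ≤ (8 * c ^ 7 * Q) ^ r := by
    rw [hB]
    push_cast
    calc _ ≤ c ^ r * 4 ^ r * (c ^ (3 * r) * ((2 * c * Q) ^ r * c ^ (2 * r))) := by
          gcongr
          · exact hcC.trans (le_self_pow₀ hc1 hrpos.ne')
          · refine le_trans ?_ hDM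
            gcongr
      _ = _ := by
          simp only [mul_pow, ← pow_mul, show (8 : ℝ) = 4 * 2 by norm_num]
          ring
  have hH : house x ≤ (64 * c ^ 10 * (Q : ℝ) ^ 2) ^ r := by
    calc _ ≤ _ := hxB
      _ ≤ 4 ^ r * ((8 * c ^ 7 * Q) ^ r * ((2 * c * Q) ^ r * c ^ (2 * r))) := by gcongr
      _ = _ := by
          simp only [mul_pow, ← pow_mul, show (64 : ℝ) = 4 * 8 * 2 by norm_num]
          ring
  have hX : ‖φ x‖ ≤ (c * r * (2 * (2 * h + 4) * Q / r) ^ (2 * h + 4) *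
      (32 * c ^ 7 * Q * Real.exp (2 * c ^ 2))) ^ r := by
    have hR : 2 * (M : ℝ) ≤ r / Q := by
      rw [le_div_iff₀ (by positivity)]
      have : 2 * M * Q ≤ r := le_trans (by rw [hQ, hN]; nlinarith [htM.le]) hNr
      exact_mod_cast this
    have hspos : 0 < ‖s‖ := norm_pos_iff.mpr hs
    have hexple : Real.exp (‖s‖ * (2 * c * Q) * (r / Q)) ≤ Real.exp (2 * c ^ 2) ^ r := by
      rw [← Real.exp_nat_mul]
      refine Real.exp_le_exp.mpr ?_
      calc ‖s‖ * (2 * c * Q) * (r / Q) ≤ c * (2 * c * Q) * (r / Q) := by gcongr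
        _ = _ := by field_simp
    calc ‖φ x‖ = ‖s‖⁻¹ ^ r * (‖s‖ ^ r * ‖φ x‖) := by
          rw [← mul_assoc, ← mul_pow, inv_mul_cancel₀ hspos.ne', one_pow, one_mul]
      _ ≤ c ^ r * ((r : ℝ) ^ r * ((2 * M / (r / Q)) ^ (M * r) *
          (4 ^ r * ((8 * c ^ 7 * Q) ^ r * Real.exp (2 * c ^ 2) ^ r)))) := by
          refine mul_le_mul (by gcongr) ((hxs _ hR).trans ?_) (by positivity) (by positivity)
          gcongr
          exact_mod_cast Nat.factorial_le_pow r
      _ = _ := by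
          have hM' : (M : ℝ) = 2 * h + 4 := by rw [hM]; push_cast; ring
          rw [hM', hM, pow_mul, div_div_eq_mul_div, show (32 : ℝ) = 4 * 8 by norm_num]
          simp only [mul_pow]
          ring
  have hXH : 1 ≤ (c ^ (3 * r)) ^ (h + 1) * (‖φ x‖ * house x ^ h) := by
    have h0 := house_nonneg x
    have := one_le_pow_mul_norm_mul_house_pow φ hx0 _
      (mul_ne_zero (pow_ne_zero _ hD) (pow_ne_zero _ (pow_ne_zero _ hD))) hxint
    rw [hh, Nat.add_sub_cancel] at this
    refine this.trans ?_
    push_cast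
    gcongr
  have hfinal := Real.le_of_gelfond_bounds hc1 hrpos (Q := (Q : ℝ)) (by positivity)
    (house_nonneg _) hXH hH hX (by
      have : Q ^ 2 ≤ 2 * M * r := by
        calc Q ^ 2 = 2 * M * N := by rw [hQ, hN]; ring
          _ ≤ _ := Nat.mul_le_mul_left _ hNr
      rw [hM] at this
      exact_mod_cast this)
  have : (t : ℝ) ≤ Q := by
    exact_mod_cast Nat.le_mul_of_pos_left t (by positivity : 0 < 2 * M)
  linarith

/-- The **Gelfond–Schneider theorem**. -/
theorem Complex.not_isAlgebraic_exp_mul {s β : ℂ} (hs : s ≠ 0) (hβ : IsAlgebraic ℚ β)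
    (hirr : ∀ q : ℚ, β ≠ q) (h : IsAlgebraic ℚ (Complex.exp s)) :
    ¬ IsAlgebraic ℚ (Complex.exp (s * β)) := by
  intro h'
  let S : Set ℂ := {Complex.exp s, β, Complex.exp (s * β)}
  let K := IntermediateField.adjoin ℚ S
  have hfin : FiniteDimensional ℚ K := IntermediateField.finiteDimensional_adjoin fun x hx ↦ by
    rcases hx with rfl | rfl | rfl
    exacts [h.isIntegral, hβ.isIntegral, h'.isIntegral]
  have : NumberField K := ⟨⟩
  have hS : ∀ x ∈ S, x ∈ K := fun x hx ↦ IntermediateField.subset_adjoin ℚ S hx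
  refine NumberField.not_exists_exp_eq (K := K) (algebraMap K ℂ)
    ⟨Complex.exp s, hS _ (by simp [S])⟩ ⟨β, hS _ (by simp [S])⟩
    ⟨Complex.exp (s * β), hS _ (by simp [S])⟩ s hs (fun q hq ↦ hirr q ?_) rfl rfl
  simpa using congrArg (algebraMap K ℂ) hq

/-- A nontrivial `m`-th root of unity has real part at most `cos (2π / m)`. -/
theorem Complex.re_le_cos_of_pow_eq_one {ξ : ℂ} {m : ℕ} (hm : 0 < m) (h : ξ ^ m = 1)
    (h1 : ξ ≠ 1) : ξ.re ≤ Real.cos (2 * Real.pi / m) := by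
  have : NeZero m := ⟨hm.ne'⟩
  obtain ⟨j, hj, rfl⟩ := (Complex.isPrimitiveRoot_exp m hm.ne').eq_pow_of_pow_eq_one h
  have hj0 : 0 < j := Nat.pos_of_ne_zero fun h0 ↦ h1 (by simp [h0])
  have hm' : (0 : ℝ) < m := by exact_mod_cast hm
  have hre : (Complex.exp (2 * Real.pi * Complex.I / m) ^ j).re =
      Real.cos (2 * Real.pi * j / m) := by
    rw [← Complex.exp_nat_mul, show (j : ℂ) * (2 * Real.pi * Complex.I / m) =
      ((2 * Real.pi * j / m : ℝ) : ℂ) * Complex.I by push_cast; ring, Complex.exp_ofReal_mul_I_re]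
  rw [hre]
  have hpi := Real.pi_pos
  rcases le_total (2 * j) m with hle | hle
  · have hle' : (2 : ℝ) * j ≤ m := by exact_mod_cast hle
    have hj1 : (1 : ℝ) ≤ j := by exact_mod_cast hj0
    refine Real.cos_le_cos_of_nonneg_of_le_pi (by positivity) ?_ ?_
    · rw [div_le_iff₀ hm']; nlinarith
    · exact div_le_div_of_nonneg_right (by nlinarith) hm'.le
  · have hle' : (m : ℝ) ≤ 2 * j := by exact_mod_cast hle
    have hj1 : (j : ℝ) + 1 ≤ m := by exact_mod_cast hj
    rw [show 2 * Real.pi * j / m = 2 * Real.pi - 2 * Real.pi * (m - j) / m by field_simp; ring,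
      Real.cos_two_pi_sub]
    refine Real.cos_le_cos_of_nonneg_of_le_pi (by positivity) ?_ ?_
    · rw [div_le_iff₀ hm']; nlinarith
    · exact div_le_div_of_nonneg_right (by nlinarith) hm'.le

open Polynomial in
/-- The relation `n tan x = tan (n x)`, written in terms of `exp (2 i x)`, is invariant under
Galois conjugation of roots of unity. -/
theorem IsPrimitiveRoot.tan_relation_conj {w v : ℂ} {m n : ℕ} (hm : m ≠ 0)
    (hw : IsPrimitiveRoot w m) (hv : IsPrimitiveRoot v m)
    (h : n * (w - 1) * (w ^ n + 1) = (w ^ n - 1) * (w + 1)) :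
    n * (v - 1) * (v ^ n + 1) = (v ^ n - 1) * (v + 1) := by
  have : NeZero m := ⟨hm⟩
  obtain ⟨k, -, hk, rfl⟩ := hw.isPrimitiveRoot_iff.mp hv
  let p : ℤ[X] := (n : ℤ[X]) * (X - 1) * (X ^ n + 1) - (X ^ n - 1) * (X + 1)
  have hp : aeval w p = 0 := by simp [p, h]
  have hdvd : minpoly ℤ (w ^ k) ∣ p := by
    rw [← hw.minpoly_eq_pow_coprime hk]
    exact minpoly.isIntegrallyClosed_dvd (hw.isIntegral (Nat.pos_of_ne_zero hm)) hp
  obtain ⟨g, hg⟩ := hdvd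
  have : aeval (w ^ k) p = 0 := by rw [hg, map_mul, minpoly.aeval, zero_mul]
  simpa [p, sub_eq_zero] using this

/-- The relation `n tan x = tan (n x)` has no solution with `exp (2 i x)` a root of unity of order
at least `3`. -/
theorem IsPrimitiveRoot.tan_relation_false {w : ℂ} {m n : ℕ} (hm : 3 ≤ m) (hn : 2 ≤ n)
    (hw : IsPrimitiveRoot w m)
    (h : n * (w - 1) * (w ^ n + 1) = (w ^ n - 1) * (w + 1)) : False := by
  have hne (v : ℂ) (hv : IsPrimitiveRoot v m) : v ≠ 1 ∧ v ≠ -1 := by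
    constructor
    · rintro rfl
      have := hv.dvd_of_pow_eq_one 1 (by simp)
      exact absurd (Nat.le_of_dvd one_pos this) (by omega)
    · rintro rfl
      have := hv.dvd_of_pow_eq_one 2 (by norm_num)
      exact absurd (Nat.le_of_dvd two_pos this) (by omega)
  obtain ⟨hw1, hw2⟩ := hne w hw
  have hn4 : 4 ≤ n := by
    by_contra! hlt
    have hn23 : n = 2 ∨ n = 3 := by omega
    rcases hn23 with rfl | rfl
    · have : (w - 1) ^ 3 = 0 := by push_cast at h; linear_combination h
      exact hw1 (sub_eq_zero.mp (pow_eq_zero_iff three_ne_zero |>.mp this))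
    · have : (w - 1) ^ 3 * (w + 1) = 0 := by push_cast at h; linear_combination h / 2
      rcases mul_eq_zero.mp this with h3 | h3
      · exact hw1 (sub_eq_zero.mp (pow_eq_zero_iff three_ne_zero |>.mp h3))
      · exact hw2 (eq_neg_of_add_eq_zero_left h3)
  have hn4' : (4 : ℝ) ≤ n := by exact_mod_cast hn4
  have hm' : (3 : ℝ) ≤ m := by exact_mod_cast hm
  have hpi := Real.pi_pos
  have key : ∀ (k : ℕ) (θ : ℝ), k.Coprime m → 2 * Real.pi * k / m = θ + Real.pi →
      ∃ x : ℂ, x ^ m = (-1) ^ m ∧ x ≠ 1 ∧ x.re ≤ 1 ∧ -1 ≤ x.re ∧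
        (n : ℝ) ^ 2 * (1 + Real.cos θ) * (1 - x.re) = (1 + x.re) * (1 - Real.cos θ) := by
    intro k θ hk hθ
    set v := Complex.exp (2 * Real.pi * Complex.I * (k / m)) with hv_def
    have hv : IsPrimitiveRoot v m := Complex.isPrimitiveRoot_exp_of_coprime k m (by omega) hk
    obtain ⟨hv1, hv2⟩ := hne v hv
    have hrel := hw.tan_relation_conj (by omega) hv h
    have hre : v.re = -Real.cos θ := by
      rw [hv_def, show 2 * Real.pi * Complex.I * ((k : ℂ) / m) =
        ((2 * Real.pi * k / m : ℝ) : ℂ) * Complex.I by push_cast; ring,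
        Complex.exp_ofReal_mul_I_re, hθ, Real.cos_add_pi]
    have hnv : ‖v‖ = 1 := hv.norm'_eq_one (by omega)
    have hnvn : ‖v ^ n‖ = 1 := by rw [norm_pow, hnv, one_pow]
    have hadd (z : ℂ) (hz : ‖z‖ = 1) : ‖z + 1‖ ^ 2 = 2 + 2 * z.re := by
      have hz2 : z.re * z.re + z.im * z.im = 1 := by
        rw [← Complex.normSq_apply, Complex.normSq_eq_norm_sq, hz, one_pow]
      rw [← Complex.normSq_eq_norm_sq, Complex.normSq_apply]
      simp only [Complex.add_re, Complex.one_re, Complex.add_im, Complex.one_im]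
      linear_combination hz2
    have hsub (z : ℂ) (hz : ‖z‖ = 1) : ‖z - 1‖ ^ 2 = 2 - 2 * z.re := by
      have hz2 : z.re * z.re + z.im * z.im = 1 := by
        rw [← Complex.normSq_apply, Complex.normSq_eq_norm_sq, hz, one_pow]
      rw [← Complex.normSq_eq_norm_sq, Complex.normSq_apply]
      simp only [Complex.sub_re, Complex.one_re, Complex.sub_im, Complex.one_im]
      linear_combination hz2
    have habs := abs_le.mp ((Complex.abs_re_le_norm (v ^ n)).trans hnvn.le)
    refine ⟨-v ^ n, ?_, ?_, by simpa using by linarith, by simpa using by linarith, ?_⟩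
    · rw [neg_pow, ← pow_mul, mul_comm n m, pow_mul, hv.pow_eq_one, one_pow, mul_one]
    · intro h1
      have hvn : v ^ n = -1 := by rw [← h1, neg_neg]
      rw [hvn] at hrel
      exact hv2 (by linear_combination hrel / 2)
    · have hnorm := congrArg (fun z : ℂ ↦ ‖z‖ ^ 2) hrel
      simp only [norm_mul, mul_pow, Complex.norm_natCast] at hnorm
      rw [hadd _ hnv, hadd _ hnvn, hsub _ hnv, hsub _ hnvn, hre] at hnorm
      rw [Complex.neg_re]
      linear_combination hnorm / 4
  have hmax : ∀ (k : ℕ) (θ : ℝ), k.Coprime m → 2 * Real.pi * k / m = θ + Real.pi → 0 < θ →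
      θ ≤ Real.pi / 2 → (∀ x : ℂ, x ^ m = (-1) ^ m → x ≠ 1 → x.re ≤ Real.cos θ) → False := by
    intro k θ hk hθ h0 hθle hx
    obtain ⟨x, hxm, hx1, hxle, hxge, hrel⟩ := key k θ hk hθ
    have hxc := hx x hxm hx1
    have hc0 : 0 ≤ Real.cos θ := Real.cos_nonneg_of_mem_Icc ⟨by linarith, hθle⟩
    have hc1 : Real.cos θ < 1 := by
      rw [← Real.cos_zero]
      exact Real.cos_lt_cos_of_nonneg_of_le_pi_div_two le_rfl hθle h0
    have h1 : (1 + Real.cos θ) * (1 - Real.cos θ) ≤ (1 + Real.cos θ) * (1 - x.re) := by gcongr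
    have h2 : (1 + x.re) * (1 - Real.cos θ) ≤ (1 + Real.cos θ) * (1 - Real.cos θ) := by
      have : 0 ≤ 1 - Real.cos θ := by linarith
      gcongr
    have h3 : 0 < (1 + Real.cos θ) * (1 - Real.cos θ) := by
      have : 0 < 1 - Real.cos θ := by linarith
      positivity
    have h4 : (16 : ℝ) ≤ (n : ℝ) ^ 2 := by nlinarith
    nlinarith
  rcases Nat.even_or_odd m with hev | hodd
  · obtain ⟨q, hq⟩ := hev
    have hneg : ((-1 : ℂ)) ^ m = 1 := by rw [hq, ← two_mul, pow_mul]; norm_num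
    rcases Nat.even_or_odd q with ⟨a, ha⟩ | ⟨a, ha⟩
    · have hma : m = 4 * a := by omega
      refine hmax (2 * a + 1) (2 * Real.pi / m) ?_ ?_ (by positivity) ?_ fun x hx hx1 ↦
        Complex.re_le_cos_of_pow_eq_one (by omega) (hx.trans hneg) hx1
      · rw [hma, show 4 * a = 2 * (2 * a) by ring]
        refine Nat.Coprime.mul_right ?_ ?_ <;> simp
      · have : (a : ℝ) ≠ 0 := by exact_mod_cast (by omega : a ≠ 0)
        rw [hma]; push_cast; field_simp; ring
      · have : (4 : ℝ) ≤ m := by exact_mod_cast (by omega : 4 ≤ m)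
        rw [div_le_div_iff₀ (by positivity) two_pos]
        nlinarith
    · have hma : m = 4 * a + 2 := by omega
      have hma' : (m : ℝ) = 4 * a + 2 := by rw [hma]; push_cast; ring
      obtain ⟨x, hxm, hx1, hxle, hxge, hrel⟩ := key (2 * a + 3) (2 * (2 * Real.pi / m)) (by
        rw [hma, show 4 * a + 2 = 2 * (2 * a + 1) by ring]
        refine Nat.Coprime.mul_right (Nat.coprime_two_right.mpr ⟨a + 1, by ring⟩) ?_
        rw [show 2 * a + 3 = 2 + (2 * a + 1) by ring]
        simp only [Nat.coprime_add_self_left, Nat.coprime_two_left]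
        exact ⟨a, rfl⟩) (by rw [hma']; push_cast; field_simp; ring)
      have hxd := Complex.re_le_cos_of_pow_eq_one (by omega) (hxm.trans hneg) hx1
      rw [Real.cos_two_mul] at hrel
      set d := Real.cos (2 * Real.pi / m) with hd
      have h6 : (6 : ℝ) ≤ m := by exact_mod_cast (by omega : 6 ≤ m)
      have hdhalf : 1 / 2 ≤ d := by
        rw [← Real.cos_pi_div_three]
        refine Real.cos_le_cos_of_nonneg_of_le_pi (by positivity) (by linarith) ?_
        rw [div_le_div_iff₀ (by positivity) (by norm_num)]
        nlinarith
      have hd1 : d < 1 := by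
        rw [← Real.cos_zero]
        refine Real.cos_lt_cos_of_nonneg_of_le_pi_div_two le_rfl ?_ (by positivity)
        rw [div_le_div_iff₀ (by positivity) two_pos]
        nlinarith
      have h1d : 0 < 1 - d := by linarith
      have h1 : 16 * (2 * d ^ 2) * (1 - d) ≤ (n : ℝ) ^ 2 * (2 * d ^ 2) * (1 - x.re) := by
        gcongr
        nlinarith
      have h2 : (1 + x.re) * (2 * ((1 - d) * (1 + d))) ≤ (1 + d) * (2 * ((1 - d) * (1 + d))) := by
        gcongr
      have h3 : (16 * d ^ 2 - (1 + d) ^ 2) * (1 - d) ≤ 0 := by nlinarith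
      have h4 : 0 < 16 * d ^ 2 - (1 + d) ^ 2 := by nlinarith
      exact h3.not_gt (mul_pos h4 h1d)
  · have hneg : ((-1 : ℂ)) ^ m = -1 := hodd.neg_one_pow
    obtain ⟨a, ha⟩ := hodd
    refine hmax (a + 1) (2 * Real.pi / (2 * m : ℕ)) ?_ ?_ (by positivity) ?_ fun x hx hx1 ↦
      Complex.re_le_cos_of_pow_eq_one (by omega) ?_ hx1
    · rw [ha, show 2 * a + 1 = a + (a + 1) by ring]
      simp
    · rw [ha]; push_cast; field_simp; ring
    · push_cast
      rw [div_le_div_iff₀ (by positivity) two_pos]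
      nlinarith
    · rw [mul_comm, pow_mul, hx, hneg]; norm_num

/-- The relation `n tan x = tan (n x)`, written in terms of `exp (2 i x)`. -/
theorem Complex.exp_two_mul_I_relation {x : ℝ} {n : ℕ} (hx : Real.cos x ≠ 0)
    (hnx : Real.cos (n * x) ≠ 0) (h : (n : ℝ) * Real.tan x = Real.tan (n * x)) :
    n * (Complex.exp (2 * x * Complex.I) - 1) * (Complex.exp (2 * x * Complex.I) ^ n + 1) =
      (Complex.exp (2 * x * Complex.I) ^ n - 1) * (Complex.exp (2 * x * Complex.I) + 1) := by
  have hsub (y : ℝ) : Complex.exp (2 * y * Complex.I) - 1 =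
      2 * Complex.I * Real.sin y * Complex.exp (y * Complex.I) := by
    rw [show (2 : ℂ) * y * Complex.I = y * Complex.I + y * Complex.I by ring, Complex.exp_add,
      Complex.exp_mul_I, ← Complex.ofReal_cos, ← Complex.ofReal_sin]
    have h1 : ((Real.sin y : ℝ) : ℂ) ^ 2 + ((Real.cos y : ℝ) : ℂ) ^ 2 = 1 := by
      exact_mod_cast Real.sin_sq_add_cos_sq y
    linear_combination h1 - ((Real.sin y : ℝ) : ℂ) ^ 2 * Complex.I_sq
  have hadd (y : ℝ) : Complex.exp (2 * y * Complex.I) + 1 =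
      2 * Real.cos y * Complex.exp (y * Complex.I) := by
    rw [show (2 : ℂ) * y * Complex.I = y * Complex.I + y * Complex.I by ring, Complex.exp_add,
      Complex.exp_mul_I, ← Complex.ofReal_cos, ← Complex.ofReal_sin]
    have h1 : ((Real.sin y : ℝ) : ℂ) ^ 2 + ((Real.cos y : ℝ) : ℂ) ^ 2 = 1 := by
      exact_mod_cast Real.sin_sq_add_cos_sq y
    linear_combination (-1) * h1 + ((Real.sin y : ℝ) : ℂ) ^ 2 * Complex.I_sq
  have hpow : Complex.exp (2 * x * Complex.I) ^ n =
      Complex.exp (2 * ((n * x : ℝ) : ℂ) * Complex.I) := by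
    rw [← Complex.exp_nat_mul]
    congr 1
    push_cast
    ring
  rw [Real.tan_eq_sin_div_cos, Real.tan_eq_sin_div_cos, ← mul_div_assoc,
    div_eq_div_iff hx hnx] at h
  have hC : (n : ℂ) * Real.sin x * Real.cos (n * x) = Real.sin (n * x) * Real.cos x := by
    exact_mod_cast h
  rw [hpow, hsub, hadd, hsub, hadd]
  linear_combination 4 * Complex.I * Complex.exp (x * Complex.I) *
    Complex.exp (((n * x : ℝ) : ℂ) * Complex.I) * hC

open Polynomial in
theorem Complex.isAlgebraic_of_tan_relation {w : ℂ} {n : ℕ} (hn : 2 ≤ n)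
    (h : n * (w - 1) * (w ^ n + 1) = (w ^ n - 1) * (w + 1)) : IsAlgebraic ℚ w := by
  refine ⟨(n : ℚ[X]) * (X - 1) * (X ^ n + 1) - (X ^ n - 1) * (X + 1), fun h0 ↦ ?_, by simp [h]⟩
  have := congrArg (eval 0) h0
  have hn0 : n ≠ 0 := by omega
  simp [hn0] at this
  have : (n : ℚ) = 1 := by linear_combination -this
  have : n = 1 := by exact_mod_cast this
  omega

/-- If `n ≥ 2` is an integer and `α ∈ (0, π/2)` satisfies `n·tan α = tan(nα)`,
then `α/(2π)` is transcendental. -/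
theorem stmt_2 (n : ℕ) (hn : 2 ≤ n) (α : ℝ) (hα : α ∈ Set.Ioo 0 (Real.pi / 2))
    (hcos : Real.cos (n * α) ≠ 0) (heq : (n : ℝ) * Real.tan α = Real.tan (n * α)) :
    Transcendental ℚ (α / (2 * Real.pi)) := by
  intro halg
  obtain ⟨hα0, hα1⟩ := hα
  have hpi := Real.pi_pos
  have hpi0 : (Real.pi : ℂ) ≠ 0 := Complex.ofReal_ne_zero.mpr hpi.ne'
  have hrel := Complex.exp_two_mul_I_relation
    (Real.cos_pos_of_mem_Ioo ⟨by linarith, hα1⟩).ne' hcos heq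
  set w := Complex.exp (2 * α * Complex.I) with hw
  by_cases hq : ∃ q : ℚ, α / (2 * Real.pi) = q
  · obtain ⟨q, hq⟩ := hq
    have hwq : w ^ q.den = 1 := by
      rw [hw, ← Complex.exp_nat_mul, Complex.exp_eq_one_iff]
      refine ⟨2 * q.num, ?_⟩
      have hα' : α = 2 * Real.pi * q := by rw [← hq]; field_simp
      have hden : (q.den : ℂ) * (q : ℂ) = q.num := by
        exact_mod_cast Rat.den_mul_eq_num q
      rw [hα']
      push_cast
      linear_combination 4 * Real.pi * Complex.I * hden
    have him : 0 < w.im := by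
      rw [hw, show (2 : ℂ) * α * Complex.I = ((2 * α : ℝ) : ℂ) * Complex.I by push_cast; ring,
        Complex.exp_ofReal_mul_I_im]
      exact Real.sin_pos_of_pos_of_lt_pi (by linarith) (by linarith)
    have hord : 0 < orderOf w := orderOf_pos_iff.mpr
      (isOfFinOrder_iff_pow_eq_one.mpr ⟨q.den, q.den_pos, hwq⟩)
    have h3 : 3 ≤ orderOf w := by
      by_contra! hlt
      have hsq : w ^ 2 = 1 := orderOf_dvd_iff_pow_eq_one.mp (by
        have : orderOf w = 1 ∨ orderOf w = 2 := by omega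
        rcases this with h | h <;> simp [h])
      rcases mul_eq_zero.mp (show (w - 1) * (w + 1) = 0 by linear_combination hsq) with h | h
      · simp [sub_eq_zero.mp h] at him
      · simp [eq_neg_of_add_eq_zero_left h] at him
    exact (IsPrimitiveRoot.orderOf w).tan_relation_false h3 hn hrel
  · have hβ : IsAlgebraic ℚ ((α / (2 * Real.pi) : ℝ) : ℂ) := halg.algebraMap
    have hs : Complex.exp (4 * Real.pi * Complex.I) = 1 :=
      Complex.exp_eq_one_iff.mpr ⟨2, by push_cast; ring⟩
    refine Complex.not_isAlgebraic_exp_mul (s := 4 * Real.pi * Complex.I) (by simp [hpi0]) hβ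
      (fun q h ↦ hq ⟨q, by exact_mod_cast h⟩) (hs ▸ isAlgebraic_one) ?_
    rw [show 4 * Real.pi * Complex.I * ((α / (2 * Real.pi) : ℝ) : ℂ) = 2 * α * Complex.I by
      push_cast; field_simp; ring]
    exact Complex.isAlgebraic_of_tan_relation hn hrel
end

section
/- Let n ≥ 2 be an integer and let α ∈ (0, π/2) be a real number with cos(nα) ≠ 0 satisfying n·tan α = tan(nα). Then α is transcendental, i.e., α is not a root of any nonzero polynomial with rational coefficients. -/
open Polynomial

theorem isIntegral_pow_mul_aeval {K : Type*} [Field K] {l : ℤ} {x : K}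
    (hl : IsIntegral ℤ (l • x)) {g : ℤ[X]} {m : ℕ} (hg : g.natDegree ≤ m) :
    IsIntegral ℤ ((l : K) ^ m * aeval x g) := by
  rw [aeval_eq_sum_range' (Nat.lt_succ_of_le hg), Finset.mul_sum]
  refine IsIntegral.sum _ fun i hi ↦ ?_
  have hi : i ≤ m := Nat.lt_succ_iff.mp (Finset.mem_range.mp hi)
  have h : (l : K) ^ m * (g.coeff i • x ^ i) =
      ((l ^ (m - i) * g.coeff i : ℤ) : K) * (l • x) ^ i := by
    rw [← Nat.sub_add_cancel hi, pow_add, Nat.add_sub_cancel, zsmul_eq_mul, zsmul_eq_mul]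
    push_cast
    ring
  rw [h]
  exact (isIntegral_algebraMap (R := ℤ) (A := K) (x := l ^ (m - i) * g.coeff i)).mul (hl.pow i)

theorem exists_aeval_eq_zero_of_zero_notMem {K : Type*} [Field K] [Algebra ℚ K]
    [Algebra.IsAlgebraic ℚ K] (S : Finset K) (hS : 0 ∉ S) :
    ∃ f : ℤ[X], f.eval 0 ≠ 0 ∧ ∀ x ∈ S, aeval x f = 0 := by
  classical
  induction S using Finset.induction_on with
  | empty => exact ⟨1, by simp, by simp⟩
  | insert a s ha ih =>
    simp only [Finset.mem_insert, not_or] at hS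
    obtain ⟨f, hf0, hf⟩ := ih hS.2
    have halg : IsAlgebraic ℤ a :=
      (IsFractionRing.isAlgebraic_iff ℤ ℚ K).mpr (Algebra.IsAlgebraic.isAlgebraic a)
    obtain ⟨q, hq0, hq⟩ := halg.exists_nonzero_coeff_and_aeval_eq_zero
      (mem_nonZeroDivisors_of_ne_zero (Ne.symm hS.1))
    rw [coeff_zero_eq_eval_zero] at hq0
    refine ⟨q * f, by simpa using ⟨hq0, hf0⟩, fun x hx ↦ ?_⟩
    rcases Finset.mem_insert.mp hx with rfl | hx
    · simp [hq]
    · simp [hf x hx]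

theorem exists_prime_gt_mul_pow_div_factorial_lt_one (B c : ℝ) (N : ℕ) :
    ∃ p > N, p.Prime ∧ B * (c ^ p / (p - 1).factorial) < 1 := by
  have h := (FloorSemiring.tendsto_pow_div_factorial_atTop c).const_mul (B * c)
  rw [mul_zero] at h
  obtain ⟨M, hM⟩ := Filter.eventually_atTop.mp (h.eventually_lt_const one_pos)
  obtain ⟨p, hp, hprime⟩ := Nat.exists_infinite_primes (max N M + 1)
  have hp1 : p - 1 + 1 = p := Nat.sub_add_cancel hprime.one_le
  refine ⟨p, by omega, hprime, ?_⟩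
  have := hM (p - 1) (by omega)
  calc B * (c ^ p / (p - 1).factorial) = B * c * (c ^ (p - 1) / (p - 1).factorial) := by
        nth_rw 1 [← hp1]
        rw [pow_succ]
        ring
    _ < 1 := this

/-- A Galois-invariant integral combination of exponentials of algebraic numbers does not vanish
if its constant term does not. -/
theorem sum_mul_exp_ne_zero_of_invariant {K : Type*} [Field K] [Algebra ℚ K]
    [FiniteDimensional ℚ K] [IsGalois ℚ K] [Algebra K ℂ] (H : K →₀ ℤ)
    (hinv : ∀ (σ : Gal(K/ℚ)) (x : K), H (σ x) = H x) (h0 : H 0 ≠ 0) :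
    H.sum (fun x a ↦ (a : ℂ) * Complex.exp (algebraMap K ℂ x)) ≠ 0 := by
  classical
  intro hsum
  set S := H.support.erase 0 with hSdef
  have h0S : (0 : K) ∉ S := by simp [hSdef]
  have hsplit {M : Type} [AddCommMonoid M] (F : K → M) :
      ∑ x ∈ H.support, F x = F 0 + ∑ x ∈ S, F x :=
    (Finset.add_sum_erase _ _ (Finsupp.mem_support_iff.mpr h0)).symm
  obtain ⟨f, hf0, hf⟩ := exists_aeval_eq_zero_of_zero_notMem S h0S
  obtain ⟨l, hl0, hl⟩ := exists_integral_multiples ℤ ℚ H.support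
  obtain ⟨c, hc⟩ := LindemannWeierstrass.exp_polynomial_approx f hf0
  set A : ℝ := ∑ x ∈ S, |(H x : ℝ)|
  obtain ⟨p, hpN, hp, hlt⟩ := exists_prime_gt_mul_pow_div_factorial_lt_one A
    (|(l : ℝ)| ^ f.natDegree * |c|) ((f.eval 0).natAbs + l.natAbs + (H 0).natAbs)
  obtain ⟨n, hn, g, hgdeg, hg⟩ := hc p (by omega) hp
  set m := p * f.natDegree with hm
  have hgm : g.natDegree ≤ m := hgdeg.trans (Nat.sub_le _ _)
  -- The trace-like sum is an integer up to a power of `l`.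
  obtain ⟨t, ht⟩ : ∃ t : ℤ, (t : K) = (l : K) ^ m * ∑ x ∈ H.support, (H x : K) * aeval x g := by
    set T := ∑ x ∈ H.support, (H x : K) * aeval x g
    have hfix (σ : Gal(K/ℚ)) : σ T = T := by
      simp only [T, map_sum, map_mul, map_intCast]
      refine Finset.sum_bij' (fun x _ ↦ σ x) (fun x _ ↦ σ.symm x) ?_ ?_ ?_ ?_ ?_
      · intro x hx
        rw [Finsupp.mem_support_iff] at hx ⊢
        rwa [hinv]
      · intro x hx
        rw [Finsupp.mem_support_iff] at hx ⊢
        rwa [← hinv σ, AlgEquiv.apply_symm_apply]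
      · simp
      · simp
      · intro x _
        rw [hinv]
        congr 1
        exact (aeval_algHom_apply (σ.toAlgHom.restrictScalars ℤ) x g).symm
    obtain ⟨q, hq⟩ := (IsGalois.mem_range_algebraMap_iff_fixed (F := ℚ) T).mpr hfix
    have hTint : IsIntegral ℤ ((l : K) ^ m * T) := by
      rw [Finset.mul_sum]
      refine IsIntegral.sum _ fun x hx ↦ ?_
      rw [mul_left_comm]
      exact (isIntegral_algebraMap (R := ℤ) (A := K) (x := H x)).mul
        (isIntegral_pow_mul_aeval (hl x hx) hgm)
    have hmap : (l : K) ^ m * T = algebraMap ℚ K ((l : ℚ) ^ m * q) := by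
      rw [map_mul, hq, map_pow, map_intCast]
    rw [hmap] at hTint ⊢
    rw [isIntegral_algebraMap_iff (algebraMap ℚ K).injective] at hTint
    obtain ⟨t, ht⟩ := IsIntegrallyClosed.isIntegral_iff.mp hTint
    exact ⟨t, by rw [← ht]; simp⟩
  -- The integer that is nonzero modulo `p` and has small absolute value.
  set N : ℤ := -(p * t) - l ^ m * H 0 * (n - p * g.eval 0)
  have hN : N ≠ 0 := by
    intro hN0
    have hdvd : (p : ℤ) ∣ l ^ m * H 0 * n :=
      ⟨l ^ m * H 0 * g.eval 0 - t, by linear_combination -hN0⟩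
    have hp' : Prime (p : ℤ) := Nat.prime_iff_prime_int.mp hp
    rcases hp'.dvd_or_dvd hdvd with h | h
    · rcases hp'.dvd_or_dvd h with h | h
      · have := Nat.le_of_dvd (Int.natAbs_pos.mpr hl0)
          (Int.natCast_dvd.mp (hp'.dvd_of_dvd_pow h))
        omega
      · have := Nat.le_of_dvd (Int.natAbs_pos.mpr h0) (Int.natCast_dvd.mp h)
        omega
    · exact hn h
  have hNeq : (N : ℂ) = (l : ℂ) ^ m * ∑ x ∈ S, (H x : ℂ) *
      (n • Complex.exp (algebraMap K ℂ x) - p • aeval (algebraMap K ℂ x) g) := by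
    have ht' : (t : ℂ) =
        (l : ℂ) ^ m * ∑ x ∈ H.support, (H x : ℂ) * aeval (algebraMap K ℂ x) g := by
      have := congrArg (algebraMap K ℂ) ht
      simpa [map_sum, aeval_algebraMap_apply] using this
    rw [Finsupp.sum, hsplit] at hsum
    rw [hsplit] at ht'
    have hg0 : aeval (0 : ℂ) g = (g.eval 0 : ℤ) := by
      simpa using aeval_algebraMap_apply_eq_algebraMap_eval (A := ℂ) (0 : ℤ) g
    simp only [map_zero, Complex.exp_zero, hg0] at hsum ht'
    have hexp : ∑ x ∈ S, (H x : ℂ) *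
        (n • Complex.exp (algebraMap K ℂ x) - p • aeval (algebraMap K ℂ x) g) =
        n * ∑ x ∈ S, (H x : ℂ) * Complex.exp (algebraMap K ℂ x) -
          p * ∑ x ∈ S, (H x : ℂ) * aeval (algebraMap K ℂ x) g := by
      rw [Finset.mul_sum, Finset.mul_sum, ← Finset.sum_sub_distrib]
      refine Finset.sum_congr rfl fun x _ ↦ ?_
      rw [zsmul_eq_mul, nsmul_eq_mul]
      ring
    rw [hexp]
    simp only [N]
    push_cast
    linear_combination (-p : ℂ) * ht' - (l : ℂ) ^ m * n * hsum
  have hle : |(N : ℝ)| ≤ A * ((|(l : ℝ)| ^ f.natDegree * |c|) ^ p / (p - 1).factorial) := by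
    rw [← Complex.norm_intCast, hNeq, norm_mul, norm_pow, Complex.norm_intCast]
    have hroot (x : K) (hx : x ∈ S) : algebraMap K ℂ x ∈ f.aroots ℂ := by
      rw [mem_aroots]
      refine ⟨fun h ↦ hf0 (by simp [h]), ?_⟩
      rw [aeval_algebraMap_apply, hf x hx, map_zero]
    have hterm : ‖∑ x ∈ S, (H x : ℂ) *
        (n • Complex.exp (algebraMap K ℂ x) - p • aeval (algebraMap K ℂ x) g)‖ ≤
        A * (|c| ^ p / (p - 1).factorial) := by
      rw [Finset.sum_mul]
      refine norm_sum_le_of_le _ fun x hx ↦ ?_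
      rw [norm_mul, Complex.norm_intCast]
      gcongr
      refine (hg (hroot x hx)).trans ?_
      exact div_le_div_of_nonneg_right ((le_abs_self _).trans (abs_pow c p).le) (by positivity)
    calc _ ≤ |(l : ℝ)| ^ m * (A * (|c| ^ p / (p - 1).factorial)) := by gcongr
      _ = _ := by
        rw [hm, mul_comm p, pow_mul, mul_pow]
        ring
  have h1 : (1 : ℝ) ≤ |(N : ℝ)| := by exact_mod_cast Int.one_le_abs hN
  linarith

open AddMonoidAlgebra in
/-- The **Lindemann–Weierstrass theorem** with integral coefficients: exponentials of distinct
elements of a Galois number field are linearly independent over the integers. -/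
theorem sum_mul_exp_ne_zero {K : Type*} [Field K] [Algebra ℚ K]
    [FiniteDimensional ℚ K] [IsGalois ℚ K] [Algebra K ℂ] (F : K →₀ ℤ) (hF : F ≠ 0) :
    F.sum (fun x a ↦ (a : ℂ) * Complex.exp (algebraMap K ℂ x)) ≠ 0 := by
  classical
  have : CharZero K := algebraRat.charZero K
  let E : AddMonoidAlgebra ℤ K →ₐ[ℤ] ℂ := AddMonoidAlgebra.lift ℤ ℂ K
    { toFun := fun x ↦ Complex.exp (algebraMap K ℂ x.toAdd)
      map_one' := by simp
      map_mul' := fun x y ↦ by simp [Complex.exp_add] }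
  have hE (x : AddMonoidAlgebra ℤ K) :
      E x = x.coeff.sum (fun x a ↦ (a : ℂ) * Complex.exp (algebraMap K ℂ x)) := by
    simp [E, AddMonoidAlgebra.lift_apply]
  let act (σ : Gal(K/ℚ)) : AddMonoidAlgebra ℤ K ≃ₐ[ℤ] AddMonoidAlgebra ℤ K :=
    domCongr ℤ ℤ (σ : K ≃+ K)
  have hact (σ : Gal(K/ℚ)) (x : AddMonoidAlgebra ℤ K) (y : K) :
      (act σ x).coeff (σ y) = x.coeff y := by
    simp only [act, coeff_domCongr]
    congr 1
    exact σ.symm_apply_apply y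
  have hactsingle (σ : Gal(K/ℚ)) (y : K) (a : ℤ) : act σ (single y a) = single (σ y) a := by
    simp only [act, domCongr_single]
    rfl
  have hactmul (σ τ : Gal(K/ℚ)) (x : AddMonoidAlgebra ℤ K) : act σ (act τ x) = act (σ * τ) x := by
    ext y
    obtain ⟨z, rfl⟩ := (σ * τ).surjective y
    rw [hact, AlgEquiv.mul_apply, hact, hact]
  set F' : AddMonoidAlgebra ℤ K := ofCoeff F
  have hF'0 : F' ≠ 0 := by simpa [F', ← AddMonoidAlgebra.coeff_inj] using hF
  set P : AddMonoidAlgebra ℤ K := ∏ σ : Gal(K/ℚ), act σ F'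
  have hP0 : P ≠ 0 := Finset.prod_ne_zero_iff.mpr fun σ _ ↦
    (map_ne_zero_iff _ (act σ).injective).mpr hF'0
  have hPinv (σ : Gal(K/ℚ)) : act σ P = P := by
    simp only [P, map_prod, hactmul]
    exact Fintype.prod_equiv (Equiv.mulLeft σ) _ _ fun _ ↦ rfl
  have hPcoeff (σ : Gal(K/ℚ)) (y : K) : P.coeff (σ y) = P.coeff y := by
    conv_lhs => rw [← hPinv σ]
    exact hact σ P y
  obtain ⟨z, hz⟩ : ∃ z, P.coeff z ≠ 0 := by
    by_contra! h
    exact hP0 (by ext y; simpa using h y)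
  set Q : AddMonoidAlgebra ℤ K := P * ∑ σ : Gal(K/ℚ), single (-σ z) 1
  have hQinv (σ : Gal(K/ℚ)) : act σ Q = Q := by
    simp only [Q, map_mul, hPinv, map_sum, hactsingle, map_neg]
    congr 1
    exact Fintype.sum_equiv (Equiv.mulLeft σ) _ _ fun _ ↦ rfl
  have hQ0 : Q.coeff 0 ≠ 0 := by
    have : Q.coeff 0 = Fintype.card Gal(K/ℚ) * P.coeff z := by
      simp [Q, Finset.mul_sum, coeff_mul_single_apply, hPcoeff]
    rw [this]
    exact mul_ne_zero (by exact_mod_cast Fintype.card_ne_zero) hz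
  have hQ := sum_mul_exp_ne_zero_of_invariant Q.coeff
    (fun σ y ↦ by conv_lhs => rw [← hQinv σ, hact]) hQ0
  rw [← hE] at hQ
  have hone : act 1 F' = F' := by
    ext y
    exact hact 1 F' y
  have hEF : E F' ≠ 0 := by
    intro h
    apply hQ
    rw [map_mul, map_prod, Finset.prod_eq_zero (Finset.mem_univ 1) (by rw [hone, h]), zero_mul]
  rwa [hE] at hEF

open IntermediateField in
/-- The **Hermite–Lindemann theorem**. -/
theorem transcendental_exp {β : ℂ} (hβ : β ≠ 0) (halg : IsAlgebraic ℚ β) :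
    Transcendental ℚ (Complex.exp β) := by
  intro hexp
  obtain ⟨q, hq0, hq⟩ := (IsFractionRing.isAlgebraic_iff ℤ ℚ ℂ).mpr hexp
  have : FiniteDimensional ℚ ℚ⟮β⟯ := IntermediateField.adjoin.finiteDimensional halg.isIntegral
  let K := IntermediateField.normalClosure ℚ ℚ⟮β⟯ ℂ
  have : FiniteDimensional ℚ K := normalClosure.is_finiteDimensional ℚ ℚ⟮β⟯ ℂ
  have : Normal ℚ K := (Algebra.IsAlgebraic.isNormalClosure_normalClosure (F := ℚ) (K := ℚ⟮β⟯)
    (L := ℂ) fun x ↦ IsAlgClosed.splits _).normal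
  have : IsGalois ℚ K := ⟨⟩
  let b : K := ⟨β, (IntermediateField.le_normalClosure ℚ⟮β⟯)
    (IntermediateField.mem_adjoin_simple_self ℚ β)⟩
  have hb : b ≠ 0 := fun h ↦ hβ (congrArg Subtype.val h)
  have hinj : Function.Injective fun k : ℕ ↦ (k : K) * b := fun i j hij ↦ by
    simpa [hb] using hij
  refine sum_mul_exp_ne_zero (Finsupp.mapDomain (fun k : ℕ ↦ (k : K) * b) q.toFinsupp.coeff) ?_ ?_
  · rw [← Finsupp.mapDomain_zero (f := fun k : ℕ ↦ (k : K) * b),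
      (Finsupp.mapDomain_injective hinj).ne_iff]
    intro h
    refine hq0 (Polynomial.ext fun i ↦ ?_)
    exact DFunLike.congr_fun h i
  · rw [Finsupp.sum_mapDomain_index_inj hinj, ← hq, aeval_def, eval₂_eq_sum]
    refine Finset.sum_congr rfl fun k _ ↦ ?_
    beta_reduce
    rw [← Complex.exp_nat_mul, map_mul, map_natCast]
    rfl

/-- If `n ≥ 2` is an integer and `α ∈ (0, π/2)` satisfies `n·tan α = tan(nα)`,
then `α` is transcendental. -/
theorem stmt_3 (n : ℕ) (hn : 2 ≤ n) (α : ℝ) (hα : α ∈ Set.Ioo 0 (Real.pi / 2))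
    (hcos : Real.cos (n * α) ≠ 0) (heq : (n : ℝ) * Real.tan α = Real.tan (n * α)) :
    Transcendental ℚ α := by
  intro halg
  have hαC : IsAlgebraic ℚ (α : ℂ) := halg.algebraMap (A := ℂ)
  have hI : IsAlgebraic ℚ Complex.I := by
    refine ⟨X ^ 2 + 1, ?_, by simp⟩
    exact (monic_X_pow_add_C (1 : ℚ) two_ne_zero).ne_zero
  have hβ : (α : ℂ) * Complex.I ≠ 0 := by
    simpa using hα.1.ne'
  refine transcendental_exp hβ (hαC.mul hI) ?_
  set u := Complex.exp (α * Complex.I) with hu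
  have hc : Real.cos α ≠ 0 :=
    (Real.cos_pos_of_mem_Ioo ⟨by linarith [hα.1, Real.pi_pos], hα.2⟩).ne'
  have hreal : n * Real.sin α * Real.cos (n * α) = Real.sin (n * α) * Real.cos α := by
    rw [Real.tan_eq_sin_div_cos, Real.tan_eq_sin_div_cos] at heq
    field_simp at heq
    linarith
  have hu0 : u ≠ 0 := Complex.exp_ne_zero _
  have hpoly : (n : ℂ) * (u ^ 2 - 1) * (u ^ (2 * n) + 1) - (u ^ (2 * n) - 1) * (u ^ 2 + 1) = 0 := by
    have h := congrArg (fun x : ℝ ↦ (x : ℂ)) hreal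
    push_cast [Complex.sin, Complex.cos] at h
    have e1 : Complex.exp (-α * Complex.I) = u⁻¹ := by rw [hu, ← Complex.exp_neg, neg_mul]
    have e2 : Complex.exp (n * α * Complex.I) = u ^ n := by
      rw [hu, ← Complex.exp_nat_mul, mul_assoc]
    have e3 : Complex.exp (-(n * α) * Complex.I) = (u ^ n)⁻¹ := by
      rw [← e2, ← Complex.exp_neg, neg_mul]
    rw [e1, e2, e3, ← hu] at h
    have hun : u ^ n ≠ 0 := pow_ne_zero _ hu0
    have h2 : u ^ (2 * n) = (u ^ n) ^ 2 := by rw [mul_comm, pow_mul]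
    rw [h2]
    generalize u ^ n = w at *
    field_simp at h
    linear_combination (-1) * h
  refine ⟨C (n : ℚ) * (X ^ 2 - 1) * (X ^ (2 * n) + 1) - (X ^ (2 * n) - 1) * (X ^ 2 + 1), ?_, ?_⟩
  · intro h0
    have h : -(n : ℚ) + 1 = 0 := by
      simpa [show n ≠ 0 by omega] using congrArg (Polynomial.eval 0) h0
    have hn' : (2 : ℚ) ≤ n := by exact_mod_cast hn
    linarith
  · simpa using hpoly
end
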